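/- arXiv:2010.04522 — 9 statements merged into one kernel-verified Lean document; each statement's English description precedes it below -/
import Mathlib

section
/- Let d ≥ 1 and let K ⊆ [0,1]^d be a nonempty closed convex set. Then for every ρ ≥ 0 one has Vol(K_ρ^+) ≥ Vol(K_ρ^−), i.e., the volume of the outer ρ-neighbourhood of ∂K is at least the volume of the inner ρ-neighbourhood. -/
open MeasureTheory Metric
open scoped ENNReal

/-- The closed unit cube `[0,1]^d` in `ℝ^d`. -/
def closedUnitCube (d : ℕ) : Set (EuclideanSpace ℝ (Fin d)) := {x | ∀ i, 0 ≤ x i ∧ x i ≤ 1}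

/-- The outer `ρ`-neighbourhood `K_ρ^+ = {x ∉ K : dist(x,K) ≤ ρ}` of `∂K`. -/
def outerNbhd {d : ℕ} (K : Set (EuclideanSpace ℝ (Fin d))) (ρ : ℝ) :
    Set (EuclideanSpace ℝ (Fin d)) :=
  {x | x ∉ K ∧ Metric.infDist x K ≤ ρ}

/-- The inner `ρ`-neighbourhood `K_ρ^- = {x ∈ K : dist(x, K^C) ≤ ρ}` of `∂K`. -/
def innerNbhd {d : ℕ} (K : Set (EuclideanSpace ℝ (Fin d))) (ρ : ℝ) :
    Set (EuclideanSpace ℝ (Fin d)) :=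
  {x | x ∈ K ∧ Metric.infDist x Kᶜ ≤ ρ}

/-- A nonexpansive surjection from (part of) `T` onto `S` shows `volume S ≤ volume T`; stated with
an expanding right inverse `g`. -/
theorem volume_le_of_expanding {d : ℕ} (S T : Set (EuclideanSpace ℝ (Fin d)))
    (g : EuclideanSpace ℝ (Fin d) → EuclideanSpace ℝ (Fin d)) (hg : ∀ x ∈ S, g x ∈ T)
    (hexp : ∀ x ∈ S, ∀ y ∈ S, dist x y ≤ dist (g x) (g y)) : volume S ≤ volume T := by
  have hinj : Set.InjOn g S := by
    intro x hx y hy hxy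
    have := hexp x hx y hy
    rw [hxy, dist_self] at this
    exact dist_le_zero.1 this
  have hlip : LipschitzOnWith 1 (Function.invFunOn g S) (g '' S) := by
    apply LipschitzOnWith.of_dist_le_mul
    rintro _ ⟨x, hx, rfl⟩ _ ⟨y, hy, rfl⟩
    rw [hinj.leftInvOn_invFunOn hx, hinj.leftInvOn_invFunOn hy]
    simpa using hexp x hx y hy
  have himg : Function.invFunOn g S '' (g '' S) = S := hinj.leftInvOn_invFunOn.image_image
  have hH := hlip.hausdorffMeasure_image_le
    (d := (Module.finrank ℝ (EuclideanSpace ℝ (Fin d)) : ℝ)) (Nat.cast_nonneg _)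
  rw [himg] at hH
  have hH' := hH.trans (mul_le_mul_right (measure_mono (Set.image_subset_iff.2 hg)) _)
  rw [ENNReal.coe_one, ENNReal.one_rpow, one_mul] at hH'
  rw [Measure.isAddLeftInvariant_eq_smul (volume : Measure (EuclideanSpace ℝ (Fin d)))
    (Measure.hausdorffMeasure ((Module.finrank ℝ (EuclideanSpace ℝ (Fin d)) : ℝ)))]
  simp only [Measure.smul_apply]
  gcongr

/-- An interior point has a nearest boundary point `p`, and `p - x` is an outer normal at `p`. -/
theorem exists_foot {d : ℕ} (K : Set (EuclideanSpace ℝ (Fin d))) (hcl : IsClosed K)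
    (hconv : Convex ℝ K) (hc : Kᶜ.Nonempty) (x : EuclideanSpace ℝ (Fin d))
    (hx : x ∈ interior K) :
    ∃ p ∈ K, p ≠ x ∧ infDist x Kᶜ = dist x p ∧ ∀ z ∈ K, inner ℝ (p - x) (z - p) ≤ 0 := by
  obtain ⟨p, hp, hr⟩ := exists_mem_closure_infDist_eq_dist hc x
  rw [closure_compl] at hp
  have hpx : p ≠ x := fun h => hp (h ▸ hx)
  have hrpos : 0 < dist x p := dist_pos.2 hpx.symm
  have hball : closedBall x (dist x p) ⊆ K := by
    rw [← closure_ball x hrpos.ne']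
    refine closure_minimal ?_ hcl
    rw [← hr]
    exact fun z hz => by
      by_contra hzK
      have := infDist_le_dist_of_mem (x := x) (show z ∈ Kᶜ from hzK)
      rw [mem_ball'] at hz
      linarith
  have hpK : p ∈ K := hball (by rw [mem_closedBall'])
  refine ⟨p, hpK, hpx, hr, ?_⟩
  obtain ⟨f, hf⟩ := geometric_hahn_banach_open_point hconv.interior isOpen_interior hp
  obtain ⟨v, rfl⟩ := (InnerProductSpace.toDual ℝ (EuclideanSpace ℝ (Fin d))).surjective f
  simp only [InnerProductSpace.toDual_apply_apply] at hf
  have hle : ∀ z ∈ K, inner ℝ v z ≤ inner ℝ v p := by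
    intro z hz
    have hz' : z ∈ closure (interior K) := by
      rw [hconv.closure_interior_eq_closure_of_nonempty_interior ⟨x, hx⟩]
      exact subset_closure hz
    refine closure_minimal (fun a ha => (hf a ha).le)
      (isClosed_le (f := fun a => inner ℝ v a) (g := fun _ => inner ℝ v p)
        (by fun_prop) continuous_const) hz'
  have hv : 0 < ‖v‖ := by
    rw [norm_pos_iff]
    rintro rfl
    simpa using hf x hx
  set u := p - x with hu
  have hun : dist x p = ‖u‖ := by rw [dist_comm, dist_eq_norm]
  have h1 : ‖u‖ * ‖v‖ ≤ inner ℝ v u := by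
    have h := hle (x + (‖u‖ / ‖v‖) • v) (hball (by
      rw [mem_closedBall, dist_eq_norm, hun, add_sub_cancel_left, norm_smul, norm_div, norm_norm,
        norm_norm, div_mul_cancel₀ _ hv.ne']))
    rw [inner_add_right, inner_smul_right, real_inner_self_eq_norm_sq] at h
    rw [hu, inner_sub_right, ← hu]
    have : ‖u‖ / ‖v‖ * ‖v‖ ^ 2 = ‖u‖ * ‖v‖ := by field_simp
    linarith
  have h2 : ‖v‖ • u - ‖u‖ • v = 0 := by
    have : ‖‖v‖ • u - ‖u‖ • v‖ ^ 2 ≤ 0 := by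
      rw [@norm_sub_sq_real, norm_smul, norm_smul, norm_norm, norm_norm, inner_smul_left,
        inner_smul_right, real_inner_comm]
      simp only [conj_trivial]
      nlinarith [mul_le_mul_of_nonneg_left h1 (mul_nonneg (norm_nonneg u) (norm_nonneg v))]
    exact norm_eq_zero.1 (by nlinarith [norm_nonneg (‖v‖ • u - ‖u‖ • v)])
  intro z hz
  have h3 : ‖v‖ * inner ℝ u (z - p) = ‖u‖ * inner ℝ v (z - p) := by
    rw [← real_inner_smul_left, ← real_inner_smul_left, sub_eq_zero.1 h2]
  have h4 : inner ℝ v (z - p) ≤ 0 := by rw [inner_sub_right]; linarith [hle z hz]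
  by_contra! h
  nlinarith [mul_pos hv h, mul_nonneg (norm_nonneg u) (neg_nonneg.2 h4)]

/-- For a nonempty closed convex `K ⊆ [0,1]^d` and `ρ ≥ 0`,
the volume of the outer `ρ`-neighbourhood of `∂K` is at least the volume of the
inner `ρ`-neighbourhood. -/
theorem volume_outerNbhd_ge_volume_innerNbhd (d : ℕ) (hd : 1 ≤ d)
    (K : Set (EuclideanSpace ℝ (Fin d))) (hne : K.Nonempty) (hcl : IsClosed K)
    (hconv : Convex ℝ K) (hsub : K ⊆ closedUnitCube d) (ρ : ℝ) (hρ : 0 ≤ ρ) :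
    volume (innerNbhd K ρ) ≤ volume (outerNbhd K ρ) := by
  have hc : Kᶜ.Nonempty := by
    refine ⟨WithLp.toLp 2 (fun _ => 2), fun h => ?_⟩
    have := (hsub h ⟨0, hd⟩).2
    norm_num at this
  have hfoot := exists_foot K hcl hconv hc
  choose! p hpK hpx hr hn using hfoot
  have hmain : volume (innerNbhd K ρ ∩ interior K) ≤ volume (outerNbhd K ρ) := by
    refine volume_le_of_expanding _ _ (fun x => (2 : ℝ) • p x - x) ?_ ?_
    · rintro x ⟨⟨hxK, hxρ⟩, hx⟩
      have he : (2 : ℝ) • p x - x - p x = p x - x := by module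
      refine ⟨fun h => ?_, ?_⟩
      · have := hn x hx _ h
        rw [he, real_inner_self_eq_norm_sq] at this
        have h0 : 0 < ‖p x - x‖ := norm_pos_iff.2 (sub_ne_zero.2 (hpx x hx))
        nlinarith
      · refine (infDist_le_dist_of_mem (hpK x hx)).trans ?_
        rw [dist_eq_norm, he, ← dist_eq_norm, dist_comm, ← hr x hx]
        exact hxρ
    · rintro x ⟨-, hx⟩ y ⟨-, hy⟩
      have h1 := hn x hx _ (hpK y hy)
      have h2 := hn y hy _ (hpK x hx)
      rw [dist_eq_norm, dist_eq_norm]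
      have e : (2 : ℝ) • p x - x - ((2 : ℝ) • p y - y)
          = (x - y) + (2 : ℝ) • ((p x - x) - (p y - y)) := by module
      have e2 : p y - p x = -((x - y) + ((p x - x) - (p y - y))) := by module
      have e3 : p x - p y = (x - y) + ((p x - x) - (p y - y)) := by module
      rw [e]
      rw [e2] at h1
      rw [e3] at h2
      generalize p x - x = a at *
      generalize p y - y = b at *
      generalize x - y = w at *
      refine le_of_sq_le_sq ?_ (norm_nonneg _)
      rw [@norm_add_sq_real, norm_smul, inner_smul_right, mul_pow, ← real_inner_self_eq_norm_sq (a - b)]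
      simp only [inner_neg_right, inner_add_right, inner_sub_right, inner_sub_left] at *
      have := real_inner_comm a b
      have := real_inner_comm a w
      have := real_inner_comm b w
      have := real_inner_self_eq_norm_sq a
      have := real_inner_self_eq_norm_sq b
      norm_num
      linarith
  have hsubset : innerNbhd K ρ ⊆ (innerNbhd K ρ ∩ interior K) ∪ frontier K := by
    intro x hx
    by_cases h : x ∈ interior K
    · exact Or.inl ⟨hx, h⟩
    · exact Or.inr ⟨subset_closure hx.1, h⟩
  calc volume (innerNbhd K ρ) ≤ _ := measure_mono hsubset
    _ ≤ volume (innerNbhd K ρ ∩ interior K) + volume (frontier K) := measure_union_le _ _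
    _ = volume (innerNbhd K ρ ∩ interior K) := by rw [hconv.addHaar_frontier volume, add_zero]
    _ ≤ _ := hmain
end

section
/- Let d ≥ 1 and let K ⊆ [0,1]^d be a nonempty closed convex set. Then for every ρ ∈ [0,1] one has max{Vol(K_ρ^+), Vol(K_ρ^−)} ≤ 2^(d+3) · ρ. -/
open MeasureTheory Metric
open scoped ENNReal

namespace ZonoAux
variable {d : ℕ}

abbrev Eu (d : ℕ) := EuclideanSpace ℝ (Fin d)

/-- extension of `K` along `v` with parameters in `[a,b]` -/
def ext (K : Set (Eu d)) (v : Eu d) (a b : ℝ) : Set (Eu d) :=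
  (fun p : Eu d × ℝ => p.1 + p.2 • v) '' (K ×ˢ Set.Icc a b)

lemma mem_ext {K : Set (Eu d)} {v x : Eu d} {a b : ℝ} :
    x ∈ ext K v a b ↔ ∃ k ∈ K, ∃ t, a ≤ t ∧ t ≤ b ∧ x = k + t • v := by
  constructor
  · rintro ⟨⟨k, t⟩, ⟨hk, ht⟩, rfl⟩
    exact ⟨k, hk, t, ht.1, ht.2, rfl⟩
  · rintro ⟨k, hk, t, h1, h2, rfl⟩
    exact ⟨⟨k, t⟩, ⟨hk, h1, h2⟩, rfl⟩

lemma ext_compact {K : Set (Eu d)} (hK : IsCompact K) (v : Eu d) (a b : ℝ) :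
    IsCompact (ext K v a b) :=
  (hK.prod isCompact_Icc).image (by fun_prop)

lemma ext_convex {K : Set (Eu d)} (hK : Convex ℝ K) (v : Eu d) (a b : ℝ) :
    Convex ℝ (ext K v a b) := by
  have := (hK.prod (convex_Icc a b)).linear_image
    (LinearMap.fst ℝ (Eu d) ℝ + (LinearMap.snd ℝ (Eu d) ℝ).smulRight v)
  exact this

lemma ext_mono {K L : Set (Eu d)} (h : K ⊆ L) (v : Eu d) (a b : ℝ) : ext K v a b ⊆ ext L v a b :=
  Set.image_mono (Set.prod_mono h subset_rfl)

lemma subset_ext (K : Set (Eu d)) (v : Eu d) {a b : ℝ} (ha : a ≤ 0) (hb : 0 ≤ b) :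
    K ⊆ ext K v a b := fun x hx => mem_ext.2 ⟨x, hx, 0, ha, hb, by simp⟩

lemma diff_eq {K : Set (Eu d)} (hK : Convex ℝ K) (v : Eu d) (n : ℕ) :
    ext K v 0 (n + 1) \ ext K v 0 n = (fun x => ((n : ℝ) • v) + x) '' (ext K v 0 1 \ K) := by
  ext x
  constructor
  · rintro ⟨h1, h2⟩
    obtain ⟨k, hk, t, h0, ht, rfl⟩ := mem_ext.1 h1
    have htn : (n : ℝ) < t := by
      by_contra h
      exact h2 (mem_ext.2 ⟨k, hk, t, h0, not_lt.1 h, rfl⟩)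
    refine ⟨k + (t - n) • v, ⟨mem_ext.2 ⟨k, hk, t - n, by linarith, by linarith, rfl⟩, ?_⟩, ?_⟩
    · intro hmem
      exact h2 (mem_ext.2 ⟨_, hmem, n, by positivity, le_rfl, by module⟩)
    · simp only; module
  · rintro ⟨y, ⟨h1, h2⟩, rfl⟩
    obtain ⟨k, hk, t, h0, ht, rfl⟩ := mem_ext.1 h1
    refine ⟨mem_ext.2 ⟨k, hk, t + n, by positivity, by linarith, by module⟩, ?_⟩
    intro h
    obtain ⟨k', hk', s, hs0, hsn, he⟩ := mem_ext.1 h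
    have hne : t ≠ 0 := by
      rintro rfl
      exact h2 (by simpa using hk)
    have htp : 0 < t := lt_of_le_of_ne h0 hne.symm
    have hq : 0 < (n - s) + t := by linarith
    apply h2
    have := hK hk hk' (a := (n - s) / ((n - s) + t)) (b := t / ((n - s) + t))
      (div_nonneg (by linarith) hq.le) (div_nonneg h0 hq.le) (by field_simp)
    convert this using 1
    have hk'e : k' = k + (t + n - s) • v := by
      have : k' = (n : ℝ) • v + (k + t • v) - s • v := by
        simp only at he
        rw [he]; abel
      rw [this]; module
    rw [hk'e]
    have e1 : (n - s) / ((n - s) + t) + t / ((n - s) + t) = 1 := by field_simp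
    have e2 : t = t / ((n - s) + t) * (t + n - s) := by field_simp; ring
    calc k + t • v = ((n - s) / ((n - s) + t) + t / ((n - s) + t)) • k
        + (t / ((n - s) + t) * (t + n - s)) • v := by rw [e1, ← e2, one_smul]
      _ = _ := by module

lemma real_ext {K : Set (Eu d)} (hc : IsCompact K) (hK : Convex ℝ K) (v : Eu d) (n : ℕ) :
    volume.real (ext K v 0 n) = volume.real K + n * (volume.real (ext K v 0 1) - volume.real K) := by
  have hsub : ∀ {A B : Set (Eu d)}, IsCompact A → IsCompact B → A ⊆ B →
      volume.real (B \ A) = volume.real B - volume.real A := fun hA hB h =>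
    measureReal_sdiff h hA.measurableSet hB.measure_lt_top.ne
  induction n with
  | zero =>
    have : ext K v 0 ((0 : ℕ) : ℝ) = K := by
      ext x; rw [mem_ext]
      constructor
      · rintro ⟨k, hk, t, h1, h2, rfl⟩
        have : t = 0 := le_antisymm (by simpa using h2) h1
        simpa [this] using hk
      · intro h; exact ⟨x, h, 0, le_rfl, by simp, by simp⟩
    rw [this]; simp
  | succ n ih =>
    have h1 := congrArg volume.real (diff_eq hK v n)
    rw [hsub (ext_compact hc _ _ _) (ext_compact hc _ _ _)] at h1
    · have h2 : volume.real ((fun x => ((n : ℝ) • v) + x) '' (ext K v 0 1 \ K))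
        = volume.real (ext K v 0 1 \ K) := by
        rw [Measure.real, Set.image_add_left, measure_preimage_add, Measure.real]
      rw [h2, hsub hc (ext_compact hc _ _ _) (subset_ext K v le_rfl zero_le_one)] at h1
      push_cast
      linarith
    · exact Set.image_mono (Set.prod_mono subset_rfl (Set.Icc_subset_Icc le_rfl (by linarith)))

lemma ext_key {K L : Set (Eu d)} (hc : IsCompact K) (hK : Convex ℝ K)
    (hcL : IsCompact L) (hL : Convex ℝ L) (h : K ⊆ L) (v : Eu d) :
    volume.real (ext K v 0 1) - volume.real K ≤ volume.real (ext L v 0 1) - volume.real L := by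
  by_contra hlt
  push Not at hlt
  set a := volume.real (ext K v 0 1) - volume.real K
  set b := volume.real (ext L v 0 1) - volume.real L
  obtain ⟨n, hn⟩ := exists_nat_gt ((volume.real L - volume.real K) / (a - b))
  rw [div_lt_iff₀ (by linarith)] at hn
  have h1 := real_ext hc hK v n
  have h2 := real_ext hcL hL v n
  have h3 : volume.real (ext K v 0 n) ≤ volume.real (ext L v 0 n) :=
    measureReal_mono (ext_mono h _ _ _) (ext_compact hcL _ _ _).measure_lt_top.ne
  rw [h1, h2] at h3
  linarith

lemma real_ext_sym (K : Set (Eu d)) (v : Eu d) :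
    volume.real (ext K v (-1) 1) = volume.real (ext K ((2 : ℝ) • v) 0 1) := by
  have : ext K v (-1) 1 = (fun x => (-v) + x) '' (ext K ((2 : ℝ) • v) 0 1) := by
    ext x
    constructor
    · intro h
      obtain ⟨k, hk, t, h1, h2, rfl⟩ := mem_ext.1 h
      exact ⟨_, mem_ext.2 ⟨k, hk, (t + 1) / 2, by linarith, by linarith, rfl⟩, by
        simp only; module⟩
    · rintro ⟨y, h, rfl⟩
      obtain ⟨k, hk, t, h1, h2, rfl⟩ := mem_ext.1 h
      exact mem_ext.2 ⟨k, hk, 2 * t - 1, by linarith, by linarith, by module⟩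
  rw [this]
  simp [Measure.real, measure_preimage_add]

/-- Sum of `K` and the zonotope with generators the list `l`. -/
def zon (K : Set (Eu d)) : List (Eu d) → Set (Eu d)
  | [] => K
  | v :: l => ext (zon K l) v (-1) 1

/-- support function -/
noncomputable def hh (l : List (Eu d)) (u : Eu d) : ℝ := (l.map fun v => |inner ℝ u v|).sum

lemma zon_compact {K : Set (Eu d)} (hK : IsCompact K) : ∀ l, IsCompact (zon K l)
  | [] => hK
  | _ :: l => ext_compact (zon_compact hK l) _ _ _

lemma zon_convex {K : Set (Eu d)} (hK : Convex ℝ K) : ∀ l, Convex ℝ (zon K l)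
  | [] => hK
  | _ :: l => ext_convex (zon_convex hK l) _ _ _

lemma zon_mono {K L : Set (Eu d)} (h : K ⊆ L) : ∀ l, zon K l ⊆ zon L l
  | [] => h
  | _ :: l => ext_mono (zon_mono h l) _ _ _

lemma zon_key {K L : Set (Eu d)} (hc : IsCompact K) (hK : Convex ℝ K)
    (hcL : IsCompact L) (hL : Convex ℝ L) (h : K ⊆ L) (l : List (Eu d)) :
    volume.real (zon K l) - volume.real K ≤ volume.real (zon L l) - volume.real L := by
  induction l with
  | nil => simp [zon]
  | cons v l ih =>
    have := ext_key (zon_compact hc l) (zon_convex hK l) (zon_compact hcL l) (zon_convex hL l)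
      (zon_mono h l) ((2 : ℝ) • v)
    simp only [zon, real_ext_sym]
    linarith

lemma zon_support {K : Set (Eu d)} {y : Eu d} (hy : y ∈ K) (u : Eu d) (l : List (Eu d)) :
    ∃ z ∈ zon K l, inner ℝ u z = inner ℝ u y + hh l u := by
  induction l with
  | nil => exact ⟨y, hy, by simp [hh]⟩
  | cons v l ih =>
    obtain ⟨z, hz, he⟩ := ih
    rcases le_total 0 (inner ℝ u v : ℝ) with h | h
    · refine ⟨z + (1 : ℝ) • v, mem_ext.2 ⟨z, hz, 1, by norm_num, le_rfl, rfl⟩, ?_⟩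
      simp only [one_smul, inner_add_right, he, hh, List.map_cons, List.sum_cons, abs_of_nonneg h]
      ring
    · refine ⟨z + (-1 : ℝ) • v, mem_ext.2 ⟨z, hz, -1, le_rfl, by norm_num, rfl⟩, ?_⟩
      simp only [inner_smul_right, inner_add_right, he, hh, List.map_cons, List.sum_cons,
        abs_of_nonpos h]
      ring

lemma zon_bound {K : Set (Eu d)} (l : List (Eu d)) {z : Eu d} (hz : z ∈ zon K l) :
    ∃ y ∈ K, ∀ u, inner ℝ u (z - y) ≤ hh l u := by
  induction l generalizing z with
  | nil => exact ⟨z, hz, by simp [hh]⟩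
  | cons v l ih =>
    obtain ⟨w, hw, t, h1, h2, rfl⟩ := mem_ext.1 hz
    obtain ⟨y, hy, hu⟩ := ih hw
    refine ⟨y, hy, fun u => ?_⟩
    have e : w + t • v - y = (w - y) + t • v := by abel
    rw [e, inner_add_right, inner_smul_right]
    simp only [hh, List.map_cons, List.sum_cons]
    have := hu u
    have h3 : t * inner ℝ u v ≤ |inner ℝ u v| := by
      calc t * inner ℝ u v ≤ |t * inner ℝ u v| := le_abs_self _
        _ = |t| * |inner ℝ u v| := abs_mul _ _
        _ ≤ 1 * |inner ℝ u v| := by gcongr; exact abs_le.2 ⟨h1, h2⟩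
        _ = _ := one_mul _
    simp only [hh] at this
    linarith

lemma sub_zon {K : Set (Eu d)} (hc : IsCompact K) (hK : Convex ℝ K) {l : List (Eu d)} {ρ : ℝ}
    (hl : ∀ u, ρ * ‖u‖ ≤ hh l u) {x y : Eu d} (hy : y ∈ K) (hxy : dist x y ≤ ρ) :
    x ∈ zon K l := by
  by_contra hx
  obtain ⟨f, c, h1, h2⟩ := geometric_hahn_banach_closed_point (zon_convex hK l)
    (zon_compact hc l).isClosed hx
  set u := (InnerProductSpace.toDual ℝ (Eu d)).symm f with hu
  have hf : ∀ z, f z = inner ℝ u z := fun z => by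
    rw [hu, InnerProductSpace.toDual_symm_apply]
  obtain ⟨z, hz, he⟩ := zon_support hy u l
  have h3 := h1 z hz
  rw [hf] at h2 h3
  have h4 : inner ℝ u (x - y) ≤ ‖u‖ * ‖x - y‖ := real_inner_le_norm _ _
  rw [inner_sub_right] at h4
  rw [dist_eq_norm] at hxy
  have h5 := hl u
  have h6 : ‖u‖ * ‖x - y‖ ≤ ‖u‖ * ρ := by gcongr
  linarith

lemma zon_sub {K : Set (Eu d)} {l : List (Eu d)} {R : ℝ}
    (hl : ∀ u, hh l u ≤ R * ‖u‖) {z : Eu d} (hz : z ∈ zon K l) (hR : 0 ≤ R):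
    ∃ y ∈ K, dist z y ≤ R := by
  obtain ⟨y, hy, hu⟩ := zon_bound l hz
  refine ⟨y, hy, ?_⟩
  have h := (hu (z - y)).trans (hl _)
  rw [real_inner_self_eq_norm_sq] at h
  rw [dist_eq_norm]
  by_contra hlt
  push Not at hlt
  nlinarith [norm_nonneg (z - y)]

lemma hh_append (l m : List (Eu d)) (u : Eu d) : hh (l ++ m) u = hh l u + hh m u := by
  simp [hh]

lemma hh_smul {a : ℝ} (ha : 0 ≤ a) (l : List (Eu d)) (u : Eu d) :
    hh (l.map (a • ·)) u = a * hh l u := by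
  induction l with
  | nil => simp [hh]
  | cons v l ih =>
    simp only [hh, List.map_cons, List.sum_cons] at ih ⊢
    rw [ih, inner_smul_right, abs_mul, abs_of_nonneg ha]; ring

lemma hh_smul_right (l : List (Eu d)) (u : Eu d) (a : ℝ) : hh l (a • u) = |a| * hh l u := by
  induction l with
  | nil => simp [hh]
  | cons v l ih =>
    simp only [hh, List.map_cons, List.sum_cons] at ih ⊢
    rw [ih, real_inner_smul_left, abs_mul]; ring

noncomputable def absMap (d : ℕ) : C(Eu d, C(sphere (0 : Eu d) 1, ℝ)) :=
  ContinuousMap.curry ⟨fun p => |inner ℝ (p.2 : Eu d) p.1|, by fun_prop⟩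

lemma absMap_apply (v : Eu d) (u : sphere (0 : Eu d) 1) : absMap d v u = |inner ℝ (u : Eu d) v| :=
  rfl

lemma integral_rot {u u' : Eu d} (h : ‖u‖ = ‖u'‖) :
    ∫ v in closedBall (0 : Eu d) 1, |inner ℝ u' v| = ∫ v in closedBall (0 : Eu d) 1, |inner ℝ u v| := by
  set R : Eu d ≃ₗᵢ[ℝ] Eu d := Submodule.reflection (ℝ ∙ (u - u'))ᗮ with hR
  have hu : R u = u' := Submodule.reflection_sub h
  have h1 := R.measurePreserving.setIntegral_preimage_emb
    R.toHomeomorph.measurableEmbedding (fun v => |inner ℝ u' v|) (closedBall (0 : Eu d) 1)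
  have h2 : R ⁻¹' (closedBall (0 : Eu d) 1) = closedBall (0 : Eu d) 1 := by
    ext x; simp
  rw [h2] at h1
  rw [← h1]
  congr 1
  ext v
  rw [← hu, R.inner_map_map]

lemma integral_pos' {u : Eu d} (h : ‖u‖ = 1) :
    0 < ∫ v in closedBall (0 : Eu d) 1, |inner ℝ u v| := by
  have hcont : Continuous (fun v : Eu d => |inner ℝ u v|) := by fun_prop
  rw [setIntegral_pos_iff_support_of_nonneg_ae (Filter.Eventually.of_forall fun v => abs_nonneg _)
    (hcont.continuousOn.integrableOn_compact (isCompact_closedBall _ _))]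
  have hO : IsOpen ((Function.support fun v : Eu d => |inner ℝ u v|) ∩ ball 0 1) :=
    (hcont.isOpen_support).inter isOpen_ball
  refine lt_of_lt_of_le (hO.measure_pos volume ⟨(1 / 2 : ℝ) • u, ?_, ?_⟩)
    (measure_mono (Set.inter_subset_inter_right _ ball_subset_closedBall))
  · simp [inner_smul_right, h]
  · simp [norm_smul, h]; norm_num

lemma exists_zon (ε : ℝ) (hε : 0 < ε) :
    ∃ l : List (Eu d), ∀ u, ‖u‖ ≤ hh l u ∧ hh l u ≤ (1 + ε) * ‖u‖ := by
  by_cases hd : ∃ u₀ : Eu d, ‖u₀‖ = 1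
  swap
  · refine ⟨[], fun u => ?_⟩
    have : u = 0 := by
      by_contra hne
      exact hd ⟨‖u‖⁻¹ • u, by rw [norm_smul, norm_inv, norm_norm, inv_mul_cancel₀ (norm_ne_zero_iff.2 hne)]⟩
    simp [this, hh]
  obtain ⟨u₀, hu₀⟩ := hd
  let G : Set C(sphere (0 : Eu d) 1, ℝ) := {g | ∃ l : List (Eu d), ∀ u, g u = hh l u}
  have hG : Convex ℝ G := by
    rintro f ⟨l, hl⟩ g ⟨m, hm⟩ a b ha hb -
    refine ⟨l.map (a • ·) ++ m.map (b • ·), fun u => ?_⟩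
    rw [hh_append, hh_smul ha, hh_smul hb, ← hl, ← hm]
    simp
  have hmem : ∀ v, absMap d v ∈ closure G := fun v =>
    subset_closure ⟨[v], fun u => by simp [hh, absMap_apply]⟩
  have hint : IntegrableOn (absMap d) (closedBall (0 : Eu d) 1) volume :=
    (absMap d).continuous.continuousOn.integrableOn_compact (isCompact_closedBall _ _)
  have hav := hG.closure.set_average_mem isClosed_closure
    (measure_closedBall_pos volume (0 : Eu d) one_pos).ne' measure_closedBall_lt_top.ne
    (Filter.Eventually.of_forall hmem) hint
  set A : C(sphere (0 : Eu d) 1, ℝ) := ⨍ x in closedBall (0 : Eu d) 1, absMap d x with hA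
  set c : ℝ := (volume.real (closedBall (0 : Eu d) 1))⁻¹ *
    ∫ v in closedBall (0 : Eu d) 1, |inner ℝ u₀ v| with hc
  have hAu : ∀ u, A u = c := by
    intro u
    rw [hA, setAverage_eq, ContinuousMap.smul_apply]
    have := (ContinuousMap.evalCLM ℝ u : C(sphere (0 : Eu d) 1, ℝ) →L[ℝ] ℝ).integral_comp_comm hint
    simp only [ContinuousMap.evalCLM_apply, absMap_apply] at this
    rw [← this, integral_rot (u := u₀) (by rw [hu₀]; simp), smul_eq_mul]
  have hcpos : 0 < c := by
    refine mul_pos (inv_pos.2 ?_) (integral_pos' hu₀)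
    exact ENNReal.toReal_pos (measure_closedBall_pos volume (0 : Eu d) one_pos).ne'
      measure_closedBall_lt_top.ne
  set δ : ℝ := c * ε / (2 + ε) with hδ
  have hδpos : 0 < δ := by positivity
  have hδe : δ * (2 + ε) = c * ε := by rw [hδ]; field_simp
  have hδc : δ < c := by nlinarith
  obtain ⟨g, ⟨l, hl⟩, hg⟩ := Metric.mem_closure_iff.1 hav δ hδpos
  have hb : ∀ u : Eu d, ‖u‖ = 1 → c - δ ≤ hh l u ∧ hh l u ≤ c + δ := by
    intro u hu
    have h1 := ContinuousMap.dist_apply_le_dist (f := A) (g := g) ⟨u, by simpa using hu⟩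
    rw [hAu, hl, Real.dist_eq] at h1
    have := abs_le.1 (h1.trans hg.le)
    constructor <;> linarith
  refine ⟨l.map ((c - δ)⁻¹ • ·), fun u => ?_⟩
  have hp : 0 < c - δ := by linarith
  rw [hh_smul (inv_pos.2 hp).le]
  by_cases hu : u = 0
  · subst hu
    have := hh_smul_right l (0 : Eu d) 0
    simp at this
    simp [this]
  have hn : 0 < ‖u‖ := norm_pos_iff.2 hu
  have h1 := hb (‖u‖⁻¹ • u) (by rw [norm_smul, norm_inv, norm_norm, inv_mul_cancel₀ hn.ne'])
  rw [hh_smul_right, abs_of_pos (inv_pos.2 hn), ← div_eq_inv_mul, le_div_iff₀ hn, div_le_iff₀ hn] at h1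
  rw [← div_eq_inv_mul, le_div_iff₀ hp, div_le_iff₀ hp]
  refine ⟨by linarith [h1.1], h1.2.trans ?_⟩
  have : (1 + ε) * ‖u‖ * (c - δ) = ‖u‖ * ((1 + ε) * (c - δ)) := by ring
  rw [this, mul_comm]
  gcongr
  nlinarith

lemma kappa_le (n : ℕ) : √Real.pi ^ n / Real.Gamma (n / 2 + 1) ≤ 8 := by
  have hrec : ∀ n : ℕ, √Real.pi ^ (n + 2) / Real.Gamma ((n + 2 : ℕ) / 2 + 1) =
      (√Real.pi ^ n / Real.Gamma (n / 2 + 1)) * (Real.pi / (n / 2 + 1)) := by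
    intro n
    have e : (((n + 2 : ℕ) : ℝ) / 2 + 1) = ((n : ℝ) / 2 + 1) + 1 := by push_cast; ring
    rw [e, Real.Gamma_add_one (by positivity), pow_add, Real.sq_sqrt Real.pi_pos.le]
    have : 0 < Real.Gamma ((n : ℝ) / 2 + 1) := Real.Gamma_pos_of_pos (by positivity)
    field_simp
  have h3 := Real.pi_gt_three
  have h32 := Real.pi_lt_d2
  set a : ℕ → ℝ := fun n => √Real.pi ^ n / Real.Gamma (n / 2 + 1) with ha
  have hpos : ∀ n, 0 ≤ a n := fun n => by
    have : 0 < Real.Gamma ((n : ℝ) / 2 + 1) := Real.Gamma_pos_of_pos (by positivity)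
    simp only [ha]; positivity
  have hr : ∀ n, a (n + 2) = a n * (Real.pi / (n / 2 + 1)) := hrec
  have a0 : a 0 = 1 := by simp [ha]
  have a1 : a 1 = 2 := by
    simp only [ha]
    have : ((1 : ℕ) : ℝ) / 2 + 1 = 1 / 2 + 1 := by norm_num
    rw [this, Real.Gamma_add_one (by norm_num), Real.Gamma_one_half_eq]
    have : 0 < √Real.pi := Real.sqrt_pos.2 Real.pi_pos
    field_simp
  have a2 : a 2 ≤ 3.15 := by rw [hr 0, a0]; norm_num; linarith
  have a3 : a 3 ≤ 4.2 := by rw [hr 1, a1]; norm_num; linarith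
  have step : ∀ n, ∀ x y : ℝ, a n ≤ x → x * (3.15 / (n / 2 + 1)) ≤ y → a (n + 2) ≤ y := by
    intro n x y hx hy
    rw [hr]
    refine le_trans ?_ hy
    have := hpos n
    have : 0 ≤ x := this.trans hx
    gcongr
  have a4 : a 4 ≤ 5 := step 2 _ _ a2 (by norm_num)
  have a5 : a 5 ≤ 6 := step 3 _ _ a3 (by norm_num)
  have a6 : a 6 ≤ 6 := step 4 _ _ a4 (by norm_num)
  have main : ∀ n, a n ≤ 8 ∧ a (n + 1) ≤ 8 := by
    intro n
    induction n with
    | zero => rw [a0, a1]; norm_num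
    | succ n ih =>
      refine ⟨ih.2, ?_⟩
      match n with
      | 0 => exact a2.trans (by norm_num)
      | 1 => exact a3.trans (by norm_num)
      | 2 => exact a4.trans (by norm_num)
      | 3 => exact a5.trans (by norm_num)
      | 4 => exact a6.trans (by norm_num)
      | n + 5 =>
        refine step (n + 5) 8 8 ih.1 ?_
        have : 3.15 / (((n + 5 : ℕ) : ℝ) / 2 + 1) ≤ 1 := by
          rw [div_le_one (by positivity)]
          push_cast
          have : (0 : ℝ) ≤ n := by positivity
          linarith
        linarith
  exact (main n).1

/-- signed distance to `[0,1]` -/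
noncomputable def sg (t : ℝ) : ℝ := if t < 0 then t else if 1 < t then t - 1 else 0

lemma sg_meas : Measurable sg :=
  Measurable.ite measurableSet_Iio measurable_id
    (Measurable.ite measurableSet_Ioi (measurable_id.sub_const 1) measurable_const)

lemma sg_le {t y : ℝ} (h0 : 0 ≤ y) (h1 : y ≤ 1) : sg t ^ 2 ≤ (t - y) ^ 2 := by
  unfold sg
  split_ifs
  · nlinarith
  · nlinarith
  · nlinarith [sq_nonneg (t - y)]

lemma sg_pres : MeasurePreserving sg (volume.restrict (Set.Icc (0 : ℝ) 1)ᶜ) volume := by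
  refine ⟨sg_meas, ?_⟩
  ext s hs
  rw [Measure.map_apply sg_meas hs, Measure.restrict_apply (sg_meas hs)]
  have e : sg ⁻¹' s ∩ (Set.Icc (0 : ℝ) 1)ᶜ =
      (s ∩ Set.Iio 0) ∪ ((fun x => x + (-1)) ⁻¹' (s ∩ Set.Ioi 0)) := by
    ext x
    simp only [Set.mem_inter_iff, Set.mem_preimage, Set.mem_compl_iff, Set.mem_Icc, Set.mem_union,
      Set.mem_Iio, Set.mem_Ioi, sg]
    rcases lt_or_ge x 0 with h | h
    · simp only [h, if_true]
      have : ¬ (0 ≤ x) := not_le.2 h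
      have h2 : ¬ (0 < x + -1) := by linarith
      simp [this, h2]
    · rcases lt_or_ge 1 x with h2 | h2
      · have h3 : ¬ x < 0 := not_lt.2 h
        have h4 : ¬ x ≤ 1 := not_le.2 h2
        have h5 : 0 < x + -1 := by linarith
        have h6 : x - 1 = x + -1 := by ring
        simp [h3, h4, h2, h6]
      · have h3 : ¬ x < 0 := not_lt.2 h
        have h5 : ¬ 0 < x + -1 := by linarith
        simp [h, h2, h3, h5]
  rw [e, measure_union]
  · rw [measure_preimage_add_right, ← measure_union]
    · rw [← Set.inter_union_distrib_left]
      have : Set.Iio (0 : ℝ) ∪ Set.Ioi 0 = {0}ᶜ := by ext; simp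
      rw [this, measure_inter_conull (by simp)]
    · exact (Set.disjoint_left.2 fun x hx hy => by
        have := hx.2; have := hy.2; simp at *; linarith)
    · exact hs.inter measurableSet_Ioi
  · exact (Set.disjoint_left.2 fun x hx hy => by
        have := hx.2; have := hy.2; simp at *; linarith)
  · exact (hs.inter measurableSet_Ioi).preimage (by fun_prop)

lemma vol_quad {ι : Type} [Fintype ι] [Nonempty ι] (R : ℝ) (hR : 0 ≤ R) :
    volume {y : ι → ℝ | (∀ i, y i ∉ Set.Icc (0 : ℝ) 1) ∧ ∑ i, sg (y i) ^ 2 ≤ R ^ 2} ≤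
      ENNReal.ofReal (8 * R ^ (Fintype.card ι)) := by
  have hp : MeasurePreserving (fun (y : ι → ℝ) i => sg (y i))
      (volume.restrict (Set.univ.pi fun _ : ι => (Set.Icc (0 : ℝ) 1)ᶜ)) volume := by
    have := measurePreserving_pi (fun _ : ι => (volume.restrict (Set.Icc (0 : ℝ) 1)ᶜ))
      (fun _ : ι => (volume : Measure ℝ)) (fun _ => sg_pres)
    rwa [← Measure.restrict_pi_pi] at this
  set B : Set (ι → ℝ) := {y | ∑ i, y i ^ 2 ≤ R ^ 2} with hB
  have hBm : MeasurableSet B := measurableSet_le (by fun_prop) (by fun_prop)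
  have e1 := hp.measure_preimage hBm.nullMeasurableSet
  rw [Measure.restrict_apply (hp.measurable hBm)] at e1
  have e2 : volume B = volume (closedBall (0 : EuclideanSpace ℝ ι) R) := by
    rw [← (EuclideanSpace.volume_preserving_symm_measurableEquiv_toLp ι).measure_preimage hBm.nullMeasurableSet]
    congr 1
    ext x
    simp [hB, EuclideanSpace.norm_eq, Real.sqrt_le_left, hR]
  calc _ ≤ _ := measure_mono (t := (fun (y : ι → ℝ) i => sg (y i)) ⁻¹' B ∩
          (Set.univ.pi fun _ : ι => (Set.Icc (0 : ℝ) 1)ᶜ)) (fun y hy => ⟨hy.2, fun i _ => hy.1 i⟩)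
    _ = _ := e1.trans (e2.trans (EuclideanSpace.volume_closedBall ι 0 R))
    _ ≤ _ := by
      rw [← ENNReal.ofReal_pow hR, ← ENNReal.ofReal_mul (by positivity)]
      apply ENNReal.ofReal_le_ofReal
      rw [mul_comm]
      gcongr
      exact kappa_le _

lemma vol_piece {d : ℕ} (J : Finset (Fin d)) (hJ : J.Nonempty) (R : ℝ) (hR : 0 ≤ R) :
    volume {x : Fin d → ℝ | (∀ i, x i ∉ Set.Icc (0 : ℝ) 1 ↔ i ∈ J) ∧ ∑ i, sg (x i) ^ 2 ≤ R ^ 2} ≤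
      ENNReal.ofReal (8 * R ^ J.card) := by
  have : Nonempty {i // i ∈ J} := hJ.to_subtype
  have hp := volume_preserving_piEquivPiSubtypeProd (fun _ : Fin d => ℝ) (fun i => i ∈ J)
  let _ : Fintype {i // i ∈ J} := Subtype.fintype _
  have := vol_quad (ι := {i // i ∈ J}) R hR
  have hcard : @Fintype.card {i // i ∈ J} (Subtype.fintype _) = J.card := by
    rw [← Fintype.card_coe J]
  rw [hcard] at this
  set D := {y : {i // i ∈ J} → ℝ | (∀ i, y i ∉ Set.Icc (0 : ℝ) 1) ∧ ∑ i, sg (y i) ^ 2 ≤ R ^ 2}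
  have hsub : {x : Fin d → ℝ | (∀ i, x i ∉ Set.Icc (0 : ℝ) 1 ↔ i ∈ J) ∧ ∑ i, sg (x i) ^ 2 ≤ R ^ 2} ⊆
      (MeasurableEquiv.piEquivPiSubtypeProd (fun _ : Fin d => ℝ) (fun i => i ∈ J)) ⁻¹'
      (D ×ˢ (Set.univ.pi fun _ => Set.Icc (0 : ℝ) 1)) := by
    rintro x ⟨h1, h2⟩
    refine ⟨⟨fun i => (h1 i).2 i.2, ?_⟩, fun i _ => ?_⟩
    · refine le_trans ?_ h2
      change ∑ i : {i // i ∈ J}, sg (x i) ^ 2 ≤ _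
      rw [← Finset.sum_subtype J (fun _ => Iff.rfl) (fun i => sg (x i) ^ 2)]
      exact Finset.sum_le_sum_of_subset_of_nonneg (Finset.subset_univ _) fun _ _ _ => sq_nonneg _
    · by_contra h
      exact i.2 ((h1 i).1 h)
  refine (measure_mono hsub).trans ?_
  rw [hp.measure_preimage_equiv, Measure.volume_eq_prod, Measure.prod_prod, volume_pi_pi]
  simp only [Real.volume_Icc, sub_zero, ENNReal.ofReal_one, Finset.prod_const_one, mul_one]
  exact this

lemma cube_compact : IsCompact (closedUnitCube d) := by
  have h : IsCompact (Set.Icc (0 : Fin d → ℝ) 1) := isCompact_Icc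
  have := h.image (PiLp.continuous_toLp 2 (fun _ : Fin d => ℝ))
  convert this using 1
  ext x
  constructor
  · intro hx
    exact ⟨x.ofLp, ⟨fun i => (hx i).1, fun i => (hx i).2⟩, rfl⟩
  · rintro ⟨y, hy, rfl⟩ i
    exact ⟨hy.1 i, hy.2 i⟩

lemma cube_convex : Convex ℝ (closedUnitCube d) := by
  intro x hx y hy a b ha hb hab i
  have h1 := hx i
  have h2 := hy i
  simp only [PiLp.add_apply, PiLp.smul_apply, smul_eq_mul]
  constructor <;> nlinarith

lemma cube_bound (ρ ε : ℝ) (h0 : 0 ≤ ρ) (h1 : ρ ≤ 1) (hε : 0 < ε) :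
    volume {x : Eu d | x ∉ closedUnitCube d ∧ ∃ y ∈ closedUnitCube d, dist x y ≤ ρ * (1 + ε)} ≤
      ENNReal.ofReal (2 ^ d * (8 * (ρ * (1 + ε) ^ d))) := by
  set R := ρ * (1 + ε) with hRdef
  have hR : 0 ≤ R := by positivity
  let P : Finset (Fin d) → Set (Fin d → ℝ) := fun J =>
    {x | (∀ i, x i ∉ Set.Icc (0 : ℝ) 1 ↔ i ∈ J) ∧ ∑ i, sg (x i) ^ 2 ≤ R ^ 2}
  let F : Finset (Finset (Fin d)) := Finset.univ.filter Finset.Nonempty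
  have hsub : {x : Eu d | x ∉ closedUnitCube d ∧ ∃ y ∈ closedUnitCube d, dist x y ≤ R} ⊆
      (MeasurableEquiv.toLp 2 (Fin d → ℝ)).symm ⁻¹' (⋃ J ∈ F, P J) := by
    rintro x ⟨hx, y, hy, hxy⟩
    simp only [Set.mem_preimage, Set.mem_iUnion]
    classical
    refine ⟨Finset.univ.filter (fun i => x i ∉ Set.Icc (0 : ℝ) 1), ?_, ?_, ?_⟩
    · simp only [F, Finset.mem_filter, Finset.mem_univ, true_and]
      by_contra hne
      rw [Finset.not_nonempty_iff_eq_empty, Finset.filter_eq_empty_iff] at hne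
      exact hx fun i => not_not.1 (hne (Finset.mem_univ i))
    · intro i
      simp
    · rw [EuclideanSpace.dist_eq, Real.sqrt_le_left hR] at hxy
      refine le_trans (Finset.sum_le_sum fun i _ => ?_) hxy
      rw [Real.dist_eq, sq_abs]
      exact sg_le (hy i).1 (hy i).2
  refine (measure_mono hsub).trans ?_
  rw [(EuclideanSpace.volume_preserving_symm_measurableEquiv_toLp (Fin d)).measure_preimage_equiv]
  refine (measure_biUnion_finset_le F P).trans ?_
  have hP : ∀ J ∈ F, volume (P J) ≤ ENNReal.ofReal (8 * (ρ * (1 + ε) ^ d)) := by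
    intro J hJ
    have hJ' : J.Nonempty := by simpa [F] using hJ
    refine (vol_piece J hJ' R hR).trans (ENNReal.ofReal_le_ofReal ?_)
    have hc : J.card ≤ d := by simpa using Finset.card_le_univ J
    have hc0 : J.card ≠ 0 := hJ'.card_pos.ne'
    rw [hRdef, mul_pow]
    gcongr
    · exact pow_le_of_le_one h0 h1 hc0
    · linarith
  refine (Finset.sum_le_card_nsmul F _ _ hP).trans ?_
  rw [nsmul_eq_mul, ENNReal.ofReal_mul (p := 2 ^ d) (by positivity)]
  refine mul_le_mul' ?_ le_rfl
  have : F.card ≤ 2 ^ d := (Finset.card_filter_le _ _).trans (by simp)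
  rw [ENNReal.ofReal_pow (by norm_num)]
  simpa using (Nat.cast_le (α := ℝ≥0∞)).2 this

lemma vol_diff_le {A B A' B' : Set (Eu d)} (hA : IsCompact A) (hB : IsCompact B)
    (hA' : IsCompact A') (hB' : IsCompact B') (h : A ⊆ B) (h' : A' ⊆ B')
    (hle : volume.real B - volume.real A ≤ volume.real B' - volume.real A') :
    volume (B \ A) ≤ volume (B' \ A') := by
  rw [← measureReal_sdiff h hA.measurableSet hB.measure_lt_top.ne,
    ← measureReal_sdiff h' hA'.measurableSet hB'.measure_lt_top.ne] at hle
  exact (ENNReal.toReal_le_toReal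
    ((measure_mono Set.sdiff_subset).trans_lt hB.measure_lt_top).ne
    ((measure_mono Set.sdiff_subset).trans_lt hB'.measure_lt_top).ne).1 hle

lemma subset_zon (K : Set (Eu d)) : ∀ l, K ⊆ zon K l
  | [] => subset_rfl
  | _ :: l => (subset_zon K l).trans (subset_ext _ _ (by norm_num) (by norm_num))

lemma outer_eps {K : Set (Eu d)} (hne : K.Nonempty) (hc : IsCompact K) (hK : Convex ℝ K)
    (hsub : K ⊆ closedUnitCube d) (ρ ε : ℝ) (h0 : 0 ≤ ρ) (h1 : ρ ≤ 1) (hε : 0 < ε) :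
    volume (outerNbhd K ρ) ≤ ENNReal.ofReal (2 ^ d * (8 * (ρ * (1 + ε) ^ d))) := by
  obtain ⟨l₀, hl₀⟩ := exists_zon (d := d) ε hε
  set l := l₀.map (ρ • ·) with hl
  have hlow : ∀ u, ρ * ‖u‖ ≤ hh l u := fun u => by
    rw [hl, hh_smul h0]; exact mul_le_mul_of_nonneg_left (hl₀ u).1 h0
  have hup : ∀ u, hh l u ≤ ρ * (1 + ε) * ‖u‖ := fun u => by
    rw [hl, hh_smul h0, mul_assoc]; exact mul_le_mul_of_nonneg_left (hl₀ u).2 h0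
  calc volume (outerNbhd K ρ) ≤ volume (zon K l \ K) := by
        refine measure_mono ?_
        rintro x ⟨hx, hd⟩
        refine ⟨?_, hx⟩
        obtain ⟨y, hy, he⟩ := hc.exists_infDist_eq_dist hne x
        exact sub_zon hc hK hlow hy (he ▸ hd)
    _ ≤ volume (zon (closedUnitCube d) l \ closedUnitCube d) :=
        vol_diff_le hc (zon_compact hc l) cube_compact (zon_compact cube_compact l)
          (subset_zon _ _) (subset_zon _ _) (zon_key hc hK cube_compact cube_convex hsub l)
    _ ≤ _ := by
        refine (measure_mono ?_).trans (cube_bound ρ ε h0 h1 hε)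
        rintro x ⟨hx, hx'⟩
        exact ⟨hx', zon_sub hup hx (by positivity)⟩

lemma outer_le {K : Set (Eu d)} (hne : K.Nonempty) (hc : IsCompact K) (hK : Convex ℝ K)
    (hsub : K ⊆ closedUnitCube d) (ρ : ℝ) (h0 : 0 ≤ ρ) (h1 : ρ ≤ 1) :
    volume (outerNbhd K ρ) ≤ ENNReal.ofReal (2 ^ (d + 3) * ρ) := by
  have hcont : Continuous fun ε : ℝ => ENNReal.ofReal (2 ^ d * (8 * (ρ * (1 + ε) ^ d))) :=
    ENNReal.continuous_ofReal.comp (by fun_prop)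
  have ht := (hcont.tendsto 0).mono_left (nhdsWithin_le_nhds (s := Set.Ioi 0))
  have := ge_of_tendsto ht (Filter.eventually_of_mem self_mem_nhdsWithin
    fun ε hε => outer_eps hne hc hK hsub ρ ε h0 h1 hε)
  refine this.trans (le_of_eq (congrArg _ ?_))
  rw [pow_add]; norm_num; ring

lemma cube_volume : volume (closedUnitCube d) = 1 := by
  have : closedUnitCube d = (MeasurableEquiv.toLp 2 (Fin d → ℝ)).symm ⁻¹'
      (Set.Icc (0 : Fin d → ℝ) 1) := by
    ext x
    exact ⟨fun h => ⟨fun i => (h i).1, fun i => (h i).2⟩, fun h i => ⟨h.1 i, h.2 i⟩⟩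
  rw [this, (EuclideanSpace.volume_preserving_symm_measurableEquiv_toLp
    (Fin d)).measure_preimage_equiv, Real.volume_Icc_pi]
  simp

lemma cube_ext_volume (i : Fin d) (s : ℝ) :
    volume (ext (closedUnitCube d) (EuclideanSpace.single i s) 0 1) ≤ ENNReal.ofReal (1 + |s|) := by
  have hsub : ext (closedUnitCube d) (EuclideanSpace.single i s) 0 1 ⊆
      (MeasurableEquiv.toLp 2 (Fin d → ℝ)).symm ⁻¹'
      (Set.Icc (fun j => if j = i then min 0 s else 0)
        (fun j => if j = i then 1 + max 0 s else 1)) := by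
    intro x hx
    obtain ⟨k, hk, t, ht0, ht1, rfl⟩ := mem_ext.1 hx
    have hts : min 0 s ≤ t * s ∧ t * s ≤ max 0 s := by
      rcases le_total 0 s with h | h
      · rw [min_eq_left h, max_eq_right h]; constructor <;> nlinarith
      · rw [min_eq_right h, max_eq_left h]; constructor <;> nlinarith
    have hval : ∀ j, (k + t • EuclideanSpace.single i s) j = k j + if j = i then t * s else 0 := by
      intro j
      simp
    constructor
    · intro j
      change _ ≤ (k + t • EuclideanSpace.single i s) j
      rw [hval]
      have := hk j
      dsimp only
      split_ifs <;> linarith [hts.1]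
    · intro j
      change (k + t • EuclideanSpace.single i s) j ≤ _
      rw [hval]
      have := hk j
      dsimp only
      split_ifs <;> linarith [hts.2]
  refine (measure_mono hsub).trans ?_
  rw [(EuclideanSpace.volume_preserving_symm_measurableEquiv_toLp
    (Fin d)).measure_preimage_equiv, Real.volume_Icc_pi]
  have : ∀ j, ENNReal.ofReal ((if j = i then 1 + max 0 s else 1) - (if j = i then min 0 s else 0))
      = if j = i then ENNReal.ofReal (1 + |s|) else 1 := by
    intro j
    split_ifs
    · congr 1
      rcases le_total 0 s with h | h
      · rw [min_eq_left h, max_eq_right h, abs_of_nonneg h]; ring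
      · rw [min_eq_right h, max_eq_left h, abs_of_nonpos h]; ring
    · simp
  simp_rw [this]
  simp

lemma shift_le {K : Set (Eu d)} (hc : IsCompact K) (hK : Convex ℝ K)
    (hsub : K ⊆ closedUnitCube d) (i : Fin d) (s : ℝ) :
    volume {x | x ∈ K ∧ x + EuclideanSpace.single i s ∉ K} ≤ ENNReal.ofReal |s| := by
  set v : Eu d := EuclideanSpace.single i s with hv
  have h1 : {x | x ∈ K ∧ x + v ∉ K} ⊆ (fun x => x + v) ⁻¹' (ext K v 0 1 \ K) := by
    rintro x ⟨hx, hx'⟩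
    exact ⟨mem_ext.2 ⟨x, hx, 1, zero_le_one, le_rfl, by simp⟩, hx'⟩
  refine (measure_mono h1).trans ?_
  rw [measure_preimage_add_right]
  refine (vol_diff_le hc (ext_compact hc _ _ _) cube_compact (ext_compact cube_compact _ _ _)
    (subset_ext _ _ le_rfl zero_le_one) (subset_ext _ _ le_rfl zero_le_one)
    (ext_key hc hK cube_compact cube_convex hsub v)).trans ?_
  rw [measure_sdiff (subset_ext _ _ le_rfl zero_le_one)
    cube_compact.measurableSet.nullMeasurableSet cube_compact.measure_lt_top.ne, cube_volume]
  rw [tsub_le_iff_right]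
  refine (cube_ext_volume i s).trans ?_
  rw [ENNReal.ofReal_add zero_le_one (abs_nonneg _), add_comm]
  simp

lemma two_sq_le (d : ℕ) : 2 * d * d ≤ 2 ^ (d + 3) := by
  induction d with
  | zero => simp
  | succ n ih =>
    have := Nat.lt_two_pow_self (n := n)
    rw [pow_add] at ih ⊢
    rw [pow_succ]
    nlinarith

lemma inner_eps (hd : 1 ≤ d) {K : Set (Eu d)} (hc : IsCompact K) (hK : Convex ℝ K)
    (hsub : K ⊆ closedUnitCube d) (ρ r : ℝ) (h0 : 0 ≤ ρ) (hr : ρ < r) :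
    volume (innerNbhd K ρ) ≤ ENNReal.ofReal (2 ^ (d + 3) * r) := by
  have hKc : (Kᶜ).Nonempty := by
    refine ⟨EuclideanSpace.single ⟨0, hd⟩ 2, fun h => ?_⟩
    have := (hsub h ⟨0, hd⟩).2
    norm_num at this
  have hr0 : 0 < r := h0.trans_lt hr
  let T : Fin d × Bool → Set (Eu d) := fun p =>
    {x | x ∈ K ∧ x + EuclideanSpace.single p.1 (if p.2 then d * r else -(d * r)) ∉ K}
  have hcov : innerNbhd K ρ ⊆ ⋃ p ∈ (Finset.univ : Finset (Fin d × Bool)), T p := by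
    rintro x ⟨hx, hdx⟩
    obtain ⟨y, hy, hxy⟩ := (infDist_lt_iff hKc).1 (hdx.trans_lt hr)
    obtain ⟨f, c, hf1, hf2⟩ := geometric_hahn_banach_closed_point hK hc.isClosed hy
    set u := (InnerProductSpace.toDual ℝ (Eu d)).symm f with hu
    have hf : ∀ z, f z = inner ℝ u z := fun z => by
      rw [hu, InnerProductSpace.toDual_symm_apply]
    have : Nonempty (Fin d) := ⟨⟨0, hd⟩⟩
    obtain ⟨i, hi⟩ := Finite.exists_max (fun j => |u j|)
    have hbd : f (y - x) ≤ d * r * |u i| := by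
      rw [hf, PiLp.inner_apply]
      calc ∑ j, inner ℝ (u j) ((y - x) j) ≤ ∑ j : Fin d, r * |u i| := by
            refine Finset.sum_le_sum fun j _ => ?_
            have e : inner ℝ (u j) ((y - x) j) = (y - x) j * u j := by simp
            rw [e]
            have h1 : |(y - x) j| ≤ r := by
              have := PiLp.norm_apply_le (y - x) j
              rw [← dist_eq_norm, dist_comm, Real.norm_eq_abs] at this
              exact this.trans hxy.le
            calc (y - x) j * u j ≤ |(y - x) j * u j| := le_abs_self _
              _ = |(y - x) j| * |u j| := abs_mul _ _
              _ ≤ r * |u i| := mul_le_mul h1 (hi j) (abs_nonneg _) hr0.le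
        _ = _ := by simp; ring
    have hsingle : ∀ s : ℝ, f (EuclideanSpace.single i s) = s * u i := fun s => by
      rw [hf, EuclideanSpace.inner_single_right]; simp
    rw [map_sub] at hbd
    simp only [Set.mem_iUnion, Finset.mem_univ, exists_prop, true_and]
    rcases le_total 0 (u i) with h | h
    · refine ⟨(i, true), hx, fun hmem => ?_⟩
      have := hf1 _ hmem
      rw [map_add, hsingle] at this
      rw [abs_of_nonneg h] at hbd
      simp only [if_true] at this
      linarith
    · refine ⟨(i, false), hx, fun hmem => ?_⟩
      have := hf1 _ hmem
      rw [map_add, hsingle] at this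
      rw [abs_of_nonpos h] at hbd
      simp only [Bool.false_eq_true, if_false] at this
      linarith
  refine (measure_mono hcov).trans ((measure_biUnion_finset_le _ _).trans ?_)
  have hT : ∀ p ∈ (Finset.univ : Finset (Fin d × Bool)), volume (T p) ≤ ENNReal.ofReal (d * r) := by
    intro p _
    refine (shift_le hc hK hsub p.1 _).trans (le_of_eq ?_)
    have : 0 ≤ (d : ℝ) * r := by positivity
    congr 1
    split_ifs
    · exact abs_of_nonneg this
    · rw [abs_neg, abs_of_nonneg this]
  refine (Finset.sum_le_card_nsmul _ _ _ hT).trans ?_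
  rw [← ENNReal.ofReal_nsmul]
  apply ENNReal.ofReal_le_ofReal
  have h2 : ((2 * d * d : ℕ) : ℝ) ≤ ((2 ^ (d + 3) : ℕ) : ℝ) := Nat.cast_le.2 (two_sq_le d)
  push_cast at h2
  simp only [Finset.card_univ, Fintype.card_prod, Fintype.card_fin, Fintype.card_bool,
    nsmul_eq_mul]
  push_cast
  calc (d : ℝ) * 2 * (d * r) = 2 * d * d * r := by ring
    _ ≤ _ := by gcongr

lemma inner_le (hd : 1 ≤ d) {K : Set (Eu d)} (hc : IsCompact K) (hK : Convex ℝ K)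
    (hsub : K ⊆ closedUnitCube d) (ρ : ℝ) (h0 : 0 ≤ ρ) :
    volume (innerNbhd K ρ) ≤ ENNReal.ofReal (2 ^ (d + 3) * ρ) := by
  have hcont : Continuous fun r : ℝ => ENNReal.ofReal (2 ^ (d + 3) * r) :=
    ENNReal.continuous_ofReal.comp (by fun_prop)
  have ht := (hcont.tendsto ρ).mono_left (nhdsWithin_le_nhds (s := Set.Ioi ρ))
  exact ge_of_tendsto ht (Filter.eventually_of_mem self_mem_nhdsWithin
    fun r hr => inner_eps hd hc hK hsub ρ r h0 hr)

end ZonoAux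

/-- For a nonempty closed convex `K ⊆ [0,1]^d` and `ρ ∈ [0,1]`,
`max{Vol(K_ρ^+), Vol(K_ρ^-)} ≤ 2^(d+3) · ρ`. -/
theorem max_volume_nbhd_le (d : ℕ) (hd : 1 ≤ d)
    (K : Set (EuclideanSpace ℝ (Fin d))) (hne : K.Nonempty) (hcl : IsClosed K)
    (hconv : Convex ℝ K) (hsub : K ⊆ closedUnitCube d) (ρ : ℝ) (hρ : ρ ∈ Set.Icc (0:ℝ) 1) :
    max (volume (outerNbhd K ρ)) (volume (innerNbhd K ρ))
      ≤ ENNReal.ofReal (2 ^ (d + 3) * ρ) := by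
  have hc : IsCompact K := ZonoAux.cube_compact.of_isClosed_subset hcl hsub
  exact max_le (ZonoAux.outer_le hne hc hconv hsub ρ hρ.1 hρ.2)
    (ZonoAux.inner_le hd hc hconv hsub ρ hρ.1)
end

section
/- Let d ≥ 1 and let K ⊆ [0,1]^d be a nonempty closed convex set. Then for every ρ ∈ [0,1] one has Vol({x ∈ ℝ^d : dist(x, ∂K) ≤ ρ}) ≤ d · 2^(d+4) · ρ, where ∂K denotes the topological boundary of K. -/
open MeasureTheory Metric
open scoped ENNReal

/-- Fiberwise estimate: the part of a bounded interval that is lost by eroding it by `s`. -/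
lemma nfl_fiber (S : Set ℝ) (hS : S.OrdConnected) (hb : Bornology.IsBounded S) (s : ℝ)
    (hs : 0 ≤ s) :
    volume {t | t ∈ S ∧ ¬ (t + s ∈ S ∧ t - s ∈ S)} ≤ ENNReal.ofReal (2 * s) := by
  have hsub : {t | t ∈ S ∧ ¬ (t + s ∈ S ∧ t - s ∈ S)} ⊆
      Set.Icc (sInf S) (sInf S + s) ∪ Set.Icc (sSup S - s) (sSup S) := by
    rintro t ⟨ht, hn⟩
    have hne : S.Nonempty := ⟨t, ht⟩
    have h1 : sInf S ≤ t := csInf_le hb.bddBelow ht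
    have h2 : t ≤ sSup S := le_csSup hb.bddAbove ht
    by_contra hcon
    simp only [Set.mem_union, Set.mem_Icc, not_or, not_and, not_le] at hcon
    have h3 : sInf S < t - s := by linarith [hcon.1 h1]
    have h4 : t + s < sSup S := by
      by_contra h
      have := hcon.2 (by linarith)
      linarith
    obtain ⟨a, ha, ha'⟩ := exists_lt_of_csInf_lt hne h3
    obtain ⟨b, hb, hb'⟩ := exists_lt_of_lt_csSup hne h4
    exact hn ⟨hS.out ht hb ⟨by linarith, by linarith⟩, hS.out ha ht ⟨by linarith, by linarith⟩⟩
  calc _ ≤ volume (Set.Icc (sInf S) (sInf S + s) ∪ Set.Icc (sSup S - s) (sSup S)) :=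
        measure_mono hsub
    _ ≤ _ := measure_union_le _ _
    _ = ENNReal.ofReal (2 * s) := by
        rw [Real.volume_Icc, Real.volume_Icc, ← ENNReal.ofReal_add (by linarith) (by linarith)]
        congr 1; ring

/-- Erosion in one coordinate direction. -/
lemma nfl_erode (n : ℕ) (F : Set (Fin (n + 1) → ℝ)) (hF : IsClosed F) (hc : Convex ℝ F) (r : ℝ)
    (hr : 0 ≤ r)
    (hbox : ∀ x ∈ F, ∀ i, -r ≤ x i ∧ x i ≤ 1 + r) (s : ℝ) (hs : 0 ≤ s) (j : Fin (n + 1)) :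
    volume {x | x ∈ F ∧ ¬ (x + s • Pi.single j (1 : ℝ) ∈ F ∧ x - s • Pi.single j (1 : ℝ) ∈ F)}
      ≤ ENNReal.ofReal (2 * s * (1 + 2 * r) ^ n) := by
  set D := {x | x ∈ F ∧ ¬ (x + s • Pi.single j (1 : ℝ) ∈ F ∧ x - s • Pi.single j (1 : ℝ) ∈ F)}
    with hD
  have hDm : MeasurableSet D := by
    have h1 : MeasurableSet {x : Fin (n + 1) → ℝ | x + s • Pi.single j (1 : ℝ) ∈ F} :=
      (hF.preimage (by fun_prop : Continuous fun x : Fin (n + 1) → ℝ =>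
        x + s • Pi.single j (1 : ℝ))).measurableSet
    have h2 : MeasurableSet {x : Fin (n + 1) → ℝ | x - s • Pi.single j (1 : ℝ) ∈ F} :=
      (hF.preimage (by fun_prop : Continuous fun x : Fin (n + 1) → ℝ =>
        x - s • Pi.single j (1 : ℝ))).measurableSet
    exact hF.measurableSet.inter (h1.inter h2).compl
  have hmp := (volume_preserving_piFinSuccAbove (fun _ : Fin (n + 1) => ℝ) j).symm
  rw [← hmp.measure_preimage_equiv, Measure.volume_eq_prod,
    Measure.prod_apply_symm (by exact (MeasurableEquiv.measurable _) hDm)]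
  have key : ∀ y : Fin n → ℝ, volume ((fun x : ℝ => (x, y)) ⁻¹'
      ((MeasurableEquiv.piFinSuccAbove (fun _ : Fin (n + 1) => ℝ) j).symm ⁻¹' D)) ≤
      (Set.Icc (fun _ => -r) (fun _ => 1 + r) : Set (Fin n → ℝ)).indicator
        (fun _ => ENNReal.ofReal (2 * s)) y := by
    intro y
    have hadd : ∀ t u : ℝ, j.insertNth (α := fun _ => ℝ) t y + u • Pi.single j (1 : ℝ) =
        j.insertNth (α := fun _ => ℝ) (t + u) y := by
      intro t u
      ext i
      rcases Fin.eq_self_or_eq_succAbove j i with rfl | ⟨k, rfl⟩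
      · simp
      · simp [Fin.succAbove_ne]
    have hsubt : ∀ t u : ℝ, j.insertNth (α := fun _ => ℝ) t y - u • Pi.single j (1 : ℝ) =
        j.insertNth (α := fun _ => ℝ) (t - u) y := by
      intro t u
      have := hadd t (-u)
      rw [neg_smul, ← sub_eq_add_neg, ← sub_eq_add_neg] at this
      exact this
    set S : Set ℝ := {t | j.insertNth (α := fun _ => ℝ) t y ∈ F} with hS
    have heq : ((fun x : ℝ => (x, y)) ⁻¹'
      ((MeasurableEquiv.piFinSuccAbove (fun _ : Fin (n + 1) => ℝ) j).symm ⁻¹' D)) =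
      {t | t ∈ S ∧ ¬ (t + s ∈ S ∧ t - s ∈ S)} := by
      ext t
      change (j.insertNth (α := fun _ => ℝ) t y ∈ F ∧
        ¬ (j.insertNth (α := fun _ => ℝ) t y + s • Pi.single j (1 : ℝ) ∈ F ∧
          j.insertNth (α := fun _ => ℝ) t y - s • Pi.single j (1 : ℝ) ∈ F)) ↔ _
      rw [hadd, hsubt]
      rfl
    rw [heq]
    by_cases hy : y ∈ (Set.Icc (fun _ => -r) (fun _ => 1 + r) : Set (Fin n → ℝ))
    · rw [Set.indicator_of_mem hy]
      apply nfl_fiber _ _ _ _ hs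
      · apply Convex.ordConnected
        intro a ha b hb p q hp hq hpq
        have := hc ha hb hp hq hpq
        change j.insertNth (α := fun _ => ℝ) (p • a + q • b) y ∈ F
        convert this using 1
        ext i
        rcases Fin.eq_self_or_eq_succAbove j i with rfl | ⟨k, rfl⟩
        · simp
        · simp [← add_mul, hpq]
      · apply (Metric.isBounded_Icc (-r) (1 + r)).subset
        intro t ht
        have := hbox _ ht j
        simpa using this
    · rw [Set.indicator_of_notMem hy]
      have : {t | t ∈ S ∧ ¬ (t + s ∈ S ∧ t - s ∈ S)} = ∅ := by
        ext t
        simp only [Set.mem_ofPred_eq, Set.mem_empty_iff_false, iff_false]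
        rintro ⟨ht, -⟩
        apply hy
        constructor <;> intro k
        · have := (hbox _ ht (j.succAbove k)).1
          simpa using this
        · have := (hbox _ ht (j.succAbove k)).2
          simpa using this
      rw [this]; simp
  calc _ ≤ ∫⁻ y, (Set.Icc (fun _ => -r) (fun _ => 1 + r) : Set (Fin n → ℝ)).indicator
        (fun _ => ENNReal.ofReal (2 * s)) y := lintegral_mono key
    _ = ENNReal.ofReal (2 * s) * volume (Set.Icc (fun _ => -r) (fun _ => 1 + r) :
          Set (Fin n → ℝ)) := by
        rw [lintegral_indicator_const measurableSet_Icc]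
    _ = _ := by
        rw [Real.volume_Icc_pi]
        simp only [Finset.prod_const, Finset.card_univ, Fintype.card_fin]
        rw [← ENNReal.ofReal_pow (by linarith), ← ENNReal.ofReal_mul (by linarith)]
        congr 2; ring

/-- Iterated erosion. -/
lemma nfl_iter (n : ℕ) (E : Set (Fin (n + 1) → ℝ)) (hE : IsClosed E) (hc : Convex ℝ E) (r : ℝ)
    (hr : 0 ≤ r)
    (hbox : ∀ x ∈ E, ∀ i, -r ≤ x i ∧ x i ≤ 1 + r) (s : ℝ) (hs : 0 < s)
    (J : Finset (Fin (n + 1))) :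
    ∃ F ⊆ E, IsClosed F ∧ Convex ℝ F ∧
      (∀ x ∈ F, ∀ v : Fin (n + 1) → ℝ, (∀ i, |v i| ≤ s) → (∀ i ∉ J, v i = 0) → x + v ∈ E) ∧
      volume (E \ F) ≤ J.card * ENNReal.ofReal (2 * s * (1 + 2 * r) ^ n) := by
  induction J using Finset.induction_on with
  | empty =>
    refine ⟨E, subset_rfl, hE, hc, ?_, by simp⟩
    intro x hx v _ hv
    have : v = 0 := by ext i; exact hv i (by simp)
    simpa [this] using hx
  | insert j J hj ih =>
    obtain ⟨F, hFE, hF, hFc, hFv, hvol⟩ := ih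
    set e : Fin (n + 1) → ℝ := s • Pi.single j (1 : ℝ) with he
    refine ⟨{x | x ∈ F ∧ (x + e ∈ F ∧ x - e ∈ F)}, fun x hx => hFE hx.1, ?_, ?_, ?_, ?_⟩
    · exact hF.inter ((hF.preimage (by fun_prop : Continuous fun x => x + e)).inter
        (hF.preimage (by fun_prop : Continuous fun x => x - e)))
    · rintro a ⟨ha, ha1, ha2⟩ b ⟨hb, hb1, hb2⟩ p q hp hq hpq
      refine ⟨hFc ha hb hp hq hpq, ?_, ?_⟩
      · convert hFc ha1 hb1 hp hq hpq using 1
        rw [smul_add, smul_add, add_add_add_comm, ← add_smul, hpq, one_smul]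
      · convert hFc ha2 hb2 hp hq hpq using 1
        rw [smul_sub, smul_sub, sub_add_sub_comm, ← add_smul, hpq, one_smul]
    · rintro x ⟨hx, hx1, hx2⟩ v hv hv0
      have hvj := abs_le.1 (hv j)
      have h1 : x + v j • Pi.single j (1 : ℝ) ∈ F := by
        have h := hFc hx1 hx2 (a := (s + v j) / (2 * s)) (b := (s - v j) / (2 * s))
          (div_nonneg (by linarith) (by linarith)) (div_nonneg (by linarith) (by linarith))
          (by field_simp; ring)
        convert h using 1
        ext i
        simp only [he, Pi.add_apply, Pi.smul_apply, Pi.sub_apply, smul_eq_mul]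
        field_simp
        ring
      have h2 := hFv _ h1 (v - v j • Pi.single j (1 : ℝ)) ?_ ?_
      · convert h2 using 1
        abel
      · intro i
        by_cases hij : i = j
        · subst hij; simp [hs.le]
        · simpa [hij] using hv i
      · intro i hi
        by_cases hij : i = j
        · subst hij; simp
        · simp [hij, hv0 i (by simp [hij, hi])]
    · rw [Finset.card_insert_of_notMem hj]
      have hsub : E \ {x | x ∈ F ∧ (x + e ∈ F ∧ x - e ∈ F)} ⊆
          (E \ F) ∪ {x | x ∈ F ∧ ¬ (x + e ∈ F ∧ x - e ∈ F)} := by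
        rintro x ⟨hx, hn⟩
        by_cases hxF : x ∈ F
        · right; exact ⟨hxF, fun h => hn ⟨hxF, h⟩⟩
        · left; exact ⟨hx, hxF⟩
      calc _ ≤ _ := measure_mono hsub
        _ ≤ _ := measure_union_le _ _
        _ ≤ _ := add_le_add hvol
            (nfl_erode n F hF hFc r hr (fun x hx => hbox x (hFE hx)) s hs.le j)
        _ = _ := by push_cast; ring

/-- If `x` is within `ρ` of the frontier, the ball of radius `3ρ` is not contained
in the `ρ`-thickening. -/
lemma nfl_sep {V : Type*} [NormedAddCommGroup V] [InnerProductSpace ℝ V] [CompleteSpace V]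
    (K : Set V) (hne : K.Nonempty) (hK : IsCompact K) (hc : Convex ℝ K)
    (hfr : (frontier K).Nonempty) (ρ : ℝ) (hρ : 0 < ρ) (x : V)
    (hx : Metric.infDist x (frontier K) ≤ ρ) :
    ∃ v : V, ‖v‖ ≤ 3 * ρ ∧ x + v ∉ cthickening ρ K := by
  obtain ⟨y, hy, hxy⟩ := (Metric.infDist_lt_iff hfr).1 (by linarith : infDist x (frontier K) < 3 / 2 * ρ)
  have hy2 : y ∈ closure Kᶜ := by
    rw [frontier_eq_closure_inter_closure] at hy; exact hy.2
  obtain ⟨z, hz, hyz⟩ := Metric.mem_closure_iff.1 hy2 (ρ / 2) (by linarith)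
  obtain ⟨w, hw, hmin⟩ := exists_norm_eq_iInf_of_complete_convex hne hK.isComplete hc z
  rw [norm_eq_iInf_iff_real_inner_le_zero hc hw] at hmin
  have hzw : 0 < ‖z - w‖ := by
    rw [norm_pos_iff, sub_ne_zero]
    rintro rfl
    exact hz hw
  set N := ‖z - w‖ with hN
  have hxz : ‖z - x‖ < 2 * ρ := by
    rw [← dist_eq_norm, dist_comm]
    linarith [dist_triangle x y z]
  refine ⟨(3 * ρ / N) • (z - w), ?_, ?_⟩
  · rw [norm_smul, Real.norm_eq_abs, abs_of_nonneg (by positivity), ← hN]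
    field_simp
    exact le_rfl
  · intro hmem
    rw [hK.cthickening_eq_biUnion_closedBall hρ.le] at hmem
    simp only [Set.mem_iUnion, Metric.mem_closedBall, exists_prop] at hmem
    obtain ⟨k, hk, hd⟩ := hmem
    rw [dist_eq_norm] at hd
    have h1 := hmin k hk
    have h2 : inner ℝ (z - w) (x + (3 * ρ / N) • (z - w) - k) ≤ N * ρ :=
      (real_inner_le_norm _ _).trans (by rw [← hN]; gcongr)
    have h3 : inner ℝ (z - w) (z - x) < N * (2 * ρ) :=
      (real_inner_le_norm _ _).trans_lt (by rw [← hN]; gcongr)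
    have h4 : inner ℝ (z - w) (z - w) = N * N := by
      rw [real_inner_self_eq_norm_mul_norm]
    have h5 : x + (3 * ρ / N) • (z - w) - k =
        (3 * ρ / N) • (z - w) + (z - w) - (z - x) - (k - w) := by abel
    rw [h5, inner_sub_right, inner_sub_right, inner_add_right, inner_smul_right, h4] at h2
    have h6 : 3 * ρ / N * (N * N) = 3 * ρ * N := by field_simp
    rw [h6] at h2
    nlinarith

/-- One-dimensional Gaussian envelope of the unit interval. -/
noncomputable def nflG (t : ℝ) : ℝ :=
  (Set.Iio (0 : ℝ)).indicator (fun t => Real.exp (-Real.pi * t ^ 2)) t +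
  (Set.Icc (0 : ℝ) 1).indicator (fun _ => 1) t +
  (Set.Ioi (1 : ℝ)).indicator (fun t => Real.exp (-Real.pi * (t - 1) ^ 2)) t

lemma nflG_nonneg (t : ℝ) : 0 ≤ nflG t := by
  unfold nflG
  refine add_nonneg (add_nonneg ?_ ?_) ?_ <;>
    exact Set.indicator_nonneg (fun _ _ => by positivity) _

lemma nflG_ge (t k : ℝ) (hk : 0 ≤ k ∧ k ≤ 1) : Real.exp (-Real.pi * (t - k) ^ 2) ≤ nflG t := by
  have hpi := Real.pi_pos
  unfold nflG
  rcases lt_or_ge t 0 with h | h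
  · rw [Set.indicator_of_mem (by exact h), Set.indicator_of_notMem (by simp [h]),
      Set.indicator_of_notMem (by simp; linarith)]
    simp only [add_zero]
    apply Real.exp_le_exp.2
    have : t ^ 2 ≤ (t - k) ^ 2 := by nlinarith
    nlinarith
  · rcases le_or_gt t 1 with h' | h'
    · rw [Set.indicator_of_notMem (by simp [h]), Set.indicator_of_mem (by exact ⟨h, h'⟩),
        Set.indicator_of_notMem (by simp; linarith)]
      simp only [add_zero, zero_add]
      apply Real.exp_le_one_iff.2
      nlinarith [sq_nonneg (t - k)]
    · rw [Set.indicator_of_notMem (by simp [h]), Set.indicator_of_notMem (by simp [h']),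
        Set.indicator_of_mem (by exact h')]
      simp only [zero_add]
      apply Real.exp_le_exp.2
      have : (t - 1) ^ 2 ≤ (t - k) ^ 2 := by nlinarith
      nlinarith

lemma nflG_integrable : Integrable nflG := by
  have h := integrable_exp_neg_mul_sq Real.pi_pos
  refine ((h.indicator measurableSet_Iio).add ?_).add
    ((h.comp_sub_right 1).indicator measurableSet_Ioi)
  exact (integrable_indicator_iff measurableSet_Icc).2 (by simp)

lemma nflG_integral : ∫ t, nflG t = 2 := by
  have h := integrable_exp_neg_mul_sq Real.pi_pos
  have h1 := h.indicator (measurableSet_Iio (a := (0 : ℝ)))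
  have h2 : Integrable ((Set.Icc (0 : ℝ) 1).indicator (fun _ => (1 : ℝ))) :=
    (integrable_indicator_iff measurableSet_Icc).2 (by simp)
  have h3 := (h.comp_sub_right 1).indicator (measurableSet_Ioi (a := (1 : ℝ)))
  have hg : ∫ t in Set.Ioi (0 : ℝ), Real.exp (-Real.pi * t ^ 2) = 1 / 2 := by
    rw [integral_gaussian_Ioi, div_self Real.pi_pos.ne']; simp
  have e1 : ∫ t in Set.Iio (0 : ℝ), Real.exp (-Real.pi * t ^ 2) = 1 / 2 := by
    rw [← integral_Iic_eq_integral_Iio, ← hg]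
    have := integral_comp_neg_Iic (0 : ℝ) (fun t => Real.exp (-Real.pi * t ^ 2))
    simpa using this
  have e3 : ∫ t in Set.Ioi (1 : ℝ), Real.exp (-Real.pi * (t - 1) ^ 2) = 1 / 2 := by
    rw [← hg]
    rw [← integral_indicator measurableSet_Ioi, ← integral_indicator measurableSet_Ioi,
      ← integral_sub_right_eq_self ((Set.Ioi (0 : ℝ)).indicator _) (1 : ℝ)]
    congr 1
    ext t
    simp only [Set.indicator, Set.mem_Ioi, sub_pos]
  unfold nflG
  rw [integral_add (by exact h1.add h2) h3, integral_add h1 h2,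
    integral_indicator measurableSet_Iio, integral_indicator measurableSet_Icc,
    integral_indicator measurableSet_Ioi, e1, e3]
  simp
  norm_num

lemma nfl_gauss (d : ℕ) (A : Set (Fin d → ℝ))
    (hA : ∀ x ∈ A, ∃ k : Fin d → ℝ, (∀ i, 0 ≤ k i ∧ k i ≤ 1) ∧ ∑ i, (x i - k i) ^ 2 ≤ 1) :
    volume A ≤ ENNReal.ofReal (Real.exp Real.pi * 2 ^ d) := by
  have hGint : Integrable (fun x : Fin d → ℝ => ∏ i, nflG (x i)) :=
    Integrable.fintype_prod (f := fun _ => nflG) (fun _ => nflG_integrable)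
  have hnn : ∀ x : Fin d → ℝ, 0 ≤ ∏ i, nflG (x i) :=
    fun x => Finset.prod_nonneg fun i _ => nflG_nonneg _
  have hI : ∫ x : Fin d → ℝ, ∏ i, nflG (x i) = 2 ^ d := by
    rw [integral_fintype_prod_volume_eq_pow, nflG_integral, Fintype.card_fin]
  have hle : ∀ x ∈ A, Real.exp (-Real.pi) ≤ ∏ i, nflG (x i) := by
    intro x hx
    obtain ⟨k, hk, hsum⟩ := hA x hx
    calc Real.exp (-Real.pi) ≤ Real.exp (∑ i, -Real.pi * (x i - k i) ^ 2) := by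
          apply Real.exp_le_exp.2
          rw [← Finset.mul_sum]
          nlinarith [Real.pi_pos]
      _ = ∏ i, Real.exp (-Real.pi * (x i - k i) ^ 2) := Real.exp_sum _ _
      _ ≤ _ := Finset.prod_le_prod (fun i _ => (Real.exp_pos _).le)
          fun i _ => nflG_ge _ _ (hk i)
  have hε : ENNReal.ofReal (Real.exp (-Real.pi)) ≠ 0 := by
    simp [Real.exp_pos]
  calc volume A ≤ volume {x : Fin d → ℝ | ENNReal.ofReal (Real.exp (-Real.pi)) ≤
          ENNReal.ofReal (∏ i, nflG (x i))} :=
        measure_mono fun x hx => ENNReal.ofReal_le_ofReal (hle x hx)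
    _ ≤ (∫⁻ x : Fin d → ℝ, ENNReal.ofReal (∏ i, nflG (x i))) /
          ENNReal.ofReal (Real.exp (-Real.pi)) :=
        meas_ge_le_lintegral_div hGint.aestronglyMeasurable.aemeasurable.ennreal_ofReal hε
          ENNReal.ofReal_ne_top
    _ = _ := by
        rw [← ofReal_integral_eq_lintegral_ofReal hGint (Filter.Eventually.of_forall hnn), hI,
          ← ENNReal.ofReal_div_of_pos (Real.exp_pos _), Real.exp_neg]
        congr 1
        rw [div_inv_eq_mul, mul_comm]

lemma nfl_exp_pi : Real.exp Real.pi ≤ 48 := by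
  have h1 : Real.exp Real.pi ≤ Real.exp (1 + 1 + 1 + 1 / 2) :=
    Real.exp_le_exp.2 (by linarith [Real.pi_lt_d2])
  have h2 := Real.exp_one_lt_d9
  have h3 : Real.exp (1 / 2) ≤ 1.7 := by
    have : Real.exp (1 / 2) * Real.exp (1 / 2) = Real.exp 1 := by
      rw [← Real.exp_add]; norm_num
    nlinarith [Real.exp_pos (1 / 2)]
  rw [Real.exp_add, Real.exp_add, Real.exp_add] at h1
  have h4 := Real.exp_pos 1
  have h5 : Real.exp 1 * Real.exp 1 * Real.exp 1 * Real.exp (1 / 2) ≤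
    2.7182818286 * 2.7182818286 * 2.7182818286 * 1.7 := by gcongr
  norm_num at h5
  linarith

/-- For a nonempty closed convex `K ⊆ [0,1]^d` and `ρ ∈ [0,1]`,
`Vol({x ∈ ℝ^d : dist(x, ∂K) ≤ ρ}) ≤ d · 2^(d+4) · ρ`. -/
theorem volume_nbhd_frontier_le (d : ℕ) (hd : 1 ≤ d)
    (K : Set (EuclideanSpace ℝ (Fin d))) (hne : K.Nonempty) (hcl : IsClosed K)
    (hconv : Convex ℝ K) (hsub : K ⊆ closedUnitCube d) (ρ : ℝ) (hρ : ρ ∈ Set.Icc (0:ℝ) 1) :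
    volume {x : EuclideanSpace ℝ (Fin d) | Metric.infDist x (frontier K) ≤ ρ}
      ≤ ENNReal.ofReal ((d : ℝ) * 2 ^ (d + 4) * ρ) := by
  obtain ⟨hρ0, hρ1⟩ := hρ
  have hbd : Bornology.IsBounded K := by
    apply (Metric.isBounded_closedBall (x := (0 : EuclideanSpace ℝ (Fin d)))
      (r := Real.sqrt d)).subset
    intro x hx
    rw [mem_closedBall_zero_iff, EuclideanSpace.norm_eq]
    apply Real.sqrt_le_sqrt
    calc ∑ i, ‖x i‖ ^ 2 ≤ ∑ i : Fin d, (1 : ℝ) := by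
          apply Finset.sum_le_sum
          intro i _
          have := hsub hx i
          rw [Real.norm_eq_abs, sq_abs]
          nlinarith
      _ = d := by simp
  have hK : IsCompact K := Metric.isCompact_of_isClosed_isBounded hcl hbd
  have : Nonempty (Fin d) := ⟨⟨0, hd⟩⟩
  have hfr : (frontier K).Nonempty := by
    rw [nonempty_frontier_iff]
    exact ⟨hne, fun h => NormedSpace.unbounded_univ ℝ (EuclideanSpace ℝ (Fin d)) (h ▸ hbd)⟩
  rcases hρ0.eq_or_lt with rfl | hρpos
  · have : {x : EuclideanSpace ℝ (Fin d) | Metric.infDist x (frontier K) ≤ 0} ⊆ frontier K := by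
      intro x hx
      rw [isClosed_frontier.mem_iff_infDist_zero hfr]
      exact le_antisymm hx Metric.infDist_nonneg
    refine (measure_mono this).trans ?_
    rw [hconv.addHaar_frontier volume]
    exact zero_le
  set T := {x : EuclideanSpace ℝ (Fin d) | Metric.infDist x (frontier K) ≤ ρ} with hT
  have hTE : T ⊆ cthickening ρ K := by
    intro x hx
    rw [hK.cthickening_eq_biUnion_closedBall hρ0]
    have hfc : IsCompact (frontier K) := hK.of_isClosed_subset isClosed_frontier hcl.frontier_subset
    obtain ⟨y, hy, hxy⟩ := hfc.exists_infDist_eq_dist hfr x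
    simp only [Set.mem_iUnion, Metric.mem_closedBall, exists_prop]
    exact ⟨y, hcl.frontier_subset hy, hxy ▸ hx⟩
  have hEk : ∀ x ∈ cthickening ρ K, ∃ k ∈ K, ‖x - k‖ ≤ ρ := by
    intro x hx
    rw [hK.cthickening_eq_biUnion_closedBall hρ0] at hx
    simpa only [Set.mem_iUnion, Metric.mem_closedBall, exists_prop, dist_eq_norm] using hx
  have hTm : MeasurableSet T :=
    (isClosed_le (Metric.continuous_infDist_pt _) continuous_const).measurableSet
  rw [← (PiLp.volume_preserving_toLp (Fin d)).measure_preimage hTm.nullMeasurableSet]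
  by_cases hcase : 6 ≤ d ∧ 1 / 2 ≤ ρ
  · have hg := nfl_gauss d (WithLp.toLp 2 ⁻¹' T) (by
      intro x hx
      obtain ⟨k, hk, hxk⟩ := hEk _ (hTE hx)
      refine ⟨fun i => k i, fun i => hsub hk i, ?_⟩
      have h : ‖WithLp.toLp 2 x - k‖ ^ 2 ≤ 1 := by
        have := norm_nonneg (WithLp.toLp 2 x - k)
        nlinarith
      rw [EuclideanSpace.norm_sq_eq] at h
      simpa using h)
    refine hg.trans (ENNReal.ofReal_le_ofReal ?_)
    have h6 : (6 : ℝ) ≤ d := by exact_mod_cast hcase.1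
    have h7 : (0 : ℝ) < 2 ^ d := by positivity
    have h8 : (3 : ℝ) ≤ d * ρ := by nlinarith [hcase.2]
    calc Real.exp Real.pi * 2 ^ d ≤ 48 * 2 ^ d := by gcongr; exact nfl_exp_pi
      _ ≤ (d * ρ * 16) * 2 ^ d := by gcongr; linarith
      _ = _ := by ring
  · obtain ⟨n, rfl⟩ : ∃ n, d = n + 1 := ⟨d - 1, by omega⟩
    set L := (WithLp.linearEquiv 2 ℝ (Fin (n + 1) → ℝ)).symm with hL
    have hcont : Continuous (WithLp.toLp 2 : (Fin (n + 1) → ℝ) → EuclideanSpace ℝ (Fin (n + 1))) :=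
      PiLp.continuous_toLp 2 _
    set E : Set (Fin (n + 1) → ℝ) := WithLp.toLp 2 ⁻¹' cthickening ρ K with hE
    have hEcl : IsClosed E := isClosed_cthickening.preimage hcont
    have hEc : Convex ℝ E := (hconv.cthickening ρ).linear_preimage L.toLinearMap
    have hbox : ∀ x ∈ E, ∀ i, -ρ ≤ x i ∧ x i ≤ 1 + ρ := by
      intro x hx i
      obtain ⟨k, hk, hxk⟩ := hEk _ hx
      have h1 := hsub hk i
      have h2 := (PiLp.norm_apply_le (WithLp.toLp 2 x - k) i).trans hxk
      have h3 : |x i - k i| ≤ ρ := by simpa using h2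
      have h4 := abs_le.1 h3
      constructor <;> linarith
    obtain ⟨F, -, -, -, hFv, hvol⟩ := nfl_iter n E hEcl hEc ρ hρ0 hbox (3 * ρ) (by linarith)
      Finset.univ
    have hTF : WithLp.toLp 2 ⁻¹' T ⊆ E \ F := by
      intro x hx
      refine ⟨hTE hx, fun hxF => ?_⟩
      obtain ⟨v, hv, hnot⟩ := nfl_sep K hne hK hconv hfr ρ hρpos (WithLp.toLp 2 x) hx
      have := hFv x hxF (fun i => v i)
        (fun i => by simpa using (PiLp.norm_apply_le v i).trans hv) (by simp)
      exact hnot this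
    refine ((measure_mono hTF).trans hvol).trans ?_
    rw [Finset.card_univ, Fintype.card_fin, ← ENNReal.ofReal_natCast,
      ← ENNReal.ofReal_mul (by positivity)]
    apply ENNReal.ofReal_le_ofReal
    have hpow : (1 + 2 * ρ) ^ n * 6 ≤ 2 ^ (n + 1 + 4) := by
      rcases le_or_gt ρ (1 / 2) with h | h
      · calc (1 + 2 * ρ) ^ n * 6 ≤ 2 ^ n * 32 := by gcongr <;> linarith
          _ = _ := by ring
      · have hn : n ≤ 4 := by
          by_contra hn
          exact hcase ⟨by omega, h.le⟩
        have h3 : (1 + 2 * ρ) ^ n ≤ 3 ^ n := by gcongr; linarith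
        refine (mul_le_mul_of_nonneg_right h3 (by norm_num)).trans ?_
        interval_cases n <;> norm_num
    calc _ = ((n + 1 : ℕ) : ℝ) * ((1 + 2 * ρ) ^ n * 6) * ρ := by ring
      _ ≤ _ := by gcongr
end

section
/- Let d ≥ 1, let K ⊆ [0,1]^d be a nonempty closed convex set, and let ρ ≥ 0. Then Vol({x ∈ ℝ^d \ K : dist(x, K) ≤ ρ}) ≤ ∑_{j=1}^d binom(d, j) · κ_j · ρ^j, where κ_j = π^(j/2) / Γ(1 + j/2). -/
open MeasureTheory Metric
open scoped ENNReal Real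

section aux

/-- Cutting a compact set by a half space does not increase `vol (thick L) - vol L`. -/
lemma steiner_cut_step {d : ℕ} (L : Set (EuclideanSpace ℝ (Fin d))) (hL : IsCompact L)
    (l : StrongDual ℝ (EuclideanSpace ℝ (Fin d))) (c : ℝ) (hne : (L ∩ {x | l x ≤ c}).Nonempty)
    (ρ : ℝ) (hρ : 0 ≤ ρ) :
    volume (cthickening ρ (L ∩ {x | l x ≤ c})) + volume L
      ≤ volume (cthickening ρ L) + volume (L ∩ {x | l x ≤ c}) := by
  have hHc : IsClosed {x | l x ≤ c} := isClosed_le l.continuous continuous_const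
  by_cases hl : l = 0
  · obtain ⟨x, hx, hx2⟩ := hne
    have : {x : EuclideanSpace ℝ (Fin d) | l x ≤ c} = Set.univ := by
      ext y
      simp only [hl, Set.mem_ofPred_eq] at hx2 ⊢
      simpa using hx2
    rw [this, Set.inter_univ]
  set v := (InnerProductSpace.toDual ℝ (EuclideanSpace ℝ (Fin d))).symm l with hv
  have hlv : ∀ x, l x = inner ℝ v x := fun x => by
    rw [hv, InnerProductSpace.toDual_symm_apply]
  have hv0 : v ≠ 0 := by
    intro h; apply hl; ext x; simp [hlv, h]
  have hvn : 0 < ‖v‖ := norm_pos_iff.mpr hv0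
  set w : EuclideanSpace ℝ (Fin d) := (ρ / ‖v‖) • v with hw
  have hlw : l w = ρ * ‖v‖ := by
    rw [hlv, hw, inner_smul_right, real_inner_self_eq_norm_sq]; field_simp
  have hwn : ‖w‖ = ρ := by
    rw [hw, norm_smul, Real.norm_of_nonneg (by positivity)]; field_simp
  have hcomp : IsCompact (L ∩ {x | l x ≤ c}) := hL.inter_right hHc
  have hdis : Disjoint (cthickening ρ (L ∩ {x | l x ≤ c}))
      ((fun x => x + -w) ⁻¹' (L \ {x | l x ≤ c})) := by
    rw [Set.disjoint_left]
    rintro x hx ⟨-, hx2⟩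
    rw [hcomp.cthickening_eq_biUnion_closedBall hρ] at hx
    simp only [Set.mem_iUnion, mem_closedBall, exists_prop] at hx
    obtain ⟨y, ⟨-, hy⟩, hxy⟩ := hx
    apply hx2
    simp only [Set.mem_ofPred_eq] at hy ⊢
    have h1 : l (x - y) ≤ ‖v‖ * ρ := by
      rw [hlv]
      refine (real_inner_le_norm _ _).trans ?_
      rw [dist_eq_norm] at hxy
      gcongr
    rw [map_sub] at h1
    rw [map_add, map_neg, hlw]
    linarith
  have hmeas : MeasurableSet ((fun x => x + -w) ⁻¹' (L \ {x | l x ≤ c})) :=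
    (hL.measurableSet.diff hHc.measurableSet).preimage (measurable_add_const _)
  have hsub : cthickening ρ (L ∩ {x | l x ≤ c}) ∪ ((fun x => x + -w) ⁻¹' (L \ {x | l x ≤ c}))
      ⊆ cthickening ρ L := by
    apply Set.union_subset
    · exact cthickening_subset_of_subset _ Set.inter_subset_left
    · rintro x ⟨hx, -⟩
      refine mem_cthickening_of_dist_le x (x + -w) ρ L hx ?_
      rw [dist_eq_norm]; simp [hwn]
  have h1 := measure_mono (μ := volume) hsub
  rw [measure_union hdis hmeas, measure_preimage_add_right] at h1
  calc _ = volume (cthickening ρ (L ∩ {x | l x ≤ c})) + (volume (L \ {x | l x ≤ c})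
        + volume (L ∩ {x | l x ≤ c})) := by
          rw [measure_sdiff_add_inter _ hHc.measurableSet]
    _ ≤ _ := by rw [← add_assoc]; gcongr

lemma steiner_mono {d : ℕ} (C K : Set (EuclideanSpace ℝ (Fin d))) (hC : IsCompact C)
    (hne : K.Nonempty) (hcl : IsClosed K)
    (hconv : Convex ℝ K) (hsub : K ⊆ C) (ρ : ℝ) (hρ : 0 ≤ ρ) :
    volume (cthickening ρ K) + volume C ≤ volume (cthickening ρ C) + volume K := by
  obtain ⟨l, c, hlc⟩ := RCLike.iInter_countable_halfSpaces_eq (𝕜 := ℝ) hconv hcl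
  simp only [RCLike.re_to_real] at hlc
  let L : ℕ → Set (EuclideanSpace ℝ (Fin d)) := fun n =>
    n.rec C (fun k S => S ∩ {x | l k x ≤ c k})
  have hLs : ∀ n, L (n+1) = L n ∩ {x | l n x ≤ c n} := fun n => rfl
  have hKH : ∀ n, K ⊆ {x | l n x ≤ c n} := fun n => by
    rw [← hlc]; exact Set.iInter_subset _ n
  have hKL : ∀ n, K ⊆ L n := by
    intro n; induction n with
    | zero => exact hsub
    | succ k ih => rw [hLs]; exact Set.subset_inter ih (hKH k)
  have hLc : ∀ n, IsCompact (L n) := by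
    intro n; induction n with
    | zero => exact hC
    | succ k ih => rw [hLs]; exact ih.inter_right (isClosed_le (l k).continuous continuous_const)
  have hanti : Antitone L := antitone_nat_of_succ_le fun n => by
    rw [hLs]; exact Set.inter_subset_left
  have hInt : ⋂ n, L n = K := by
    apply Set.Subset.antisymm
    · rw [← hlc]
      refine Set.subset_iInter fun n => (Set.iInter_subset _ (n+1)).trans ?_
      rw [hLs]; exact Set.inter_subset_right
    · exact Set.subset_iInter hKL
  have key : ∀ n, volume (cthickening ρ (L n)) + volume C
      ≤ volume (cthickening ρ C) + volume (L n) := by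
    intro n; induction n with
    | zero => exact le_rfl
    | succ k ih =>
      have h := steiner_cut_step (L k) (hLc k) (l k) (c k)
        (hne.mono (hKL (k+1))) ρ hρ
      rw [← hLs] at h
      have hf : volume (L k) ≠ ⊤ := (hLc k).measure_lt_top.ne
      have hf2 : volume (cthickening ρ (L k)) ≠ ⊤ :=
        ((hLc k).cthickening).measure_lt_top.ne
      have := add_le_add h ih
      have h3 : (volume (cthickening ρ (L (k+1))) + volume C) +
          (volume (L k) + volume (cthickening ρ (L k))) ≤
          (volume (cthickening ρ C) + volume (L (k+1))) +
          (volume (L k) + volume (cthickening ρ (L k))) := by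
        calc _ = _ := by ring
          _ ≤ _ := this
          _ = _ := by ring
      exact (ENNReal.add_le_add_iff_right (ENNReal.add_ne_top.mpr ⟨hf, hf2⟩)).mp h3
  have hlim : Filter.Tendsto (fun n => volume (L n)) Filter.atTop (nhds (volume K)) := by
    rw [← hInt]
    exact tendsto_measure_iInter_atTop (fun n => (hLc n).measurableSet.nullMeasurableSet) hanti
      ⟨0, (hLc 0).measure_lt_top.ne⟩
  refine ge_of_tendsto' (hlim.const_add (volume (cthickening ρ C))) fun n => ?_
  refine le_trans ?_ (key n)
  gcongr
  exact cthickening_subset_of_subset _ (hKL n)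

noncomputable def cubeShift (t : ℝ) : ℝ := if t < 0 then t else t - 1

lemma cubeShift_mp :
    MeasurePreserving cubeShift (volume.restrict (Set.Icc (0:ℝ) 1)ᶜ) volume := by
  have hm : Measurable cubeShift :=
    Measurable.ite measurableSet_Iio measurable_id (measurable_id.sub_const 1)
  refine ⟨hm, ?_⟩
  ext s hs
  rw [Measure.map_apply hm hs, Measure.restrict_apply (hm hs)]
  have e : cubeShift ⁻¹' s ∩ (Set.Icc (0:ℝ) 1)ᶜ
      = (s ∩ Set.Iio 0) ∪ (fun x => x + (-1:ℝ)) ⁻¹' (s ∩ Set.Ioi 0) := by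
    ext t
    simp only [cubeShift, Set.mem_inter_iff, Set.mem_preimage, Set.mem_compl_iff, Set.mem_Icc,
      Set.mem_union, Set.mem_Iio, Set.mem_Ioi, ← sub_eq_add_neg]
    by_cases h : t < 0
    · simp only [h, if_true]
      constructor
      · rintro ⟨h1, -⟩; exact Or.inl ⟨h1, trivial⟩
      · rintro (⟨h1, -⟩ | ⟨-, h1⟩)
        · exact ⟨h1, fun h2 => by linarith [h2.1]⟩
        · linarith
    · simp only [h, if_false]
      constructor
      · rintro ⟨h1, h2⟩
        refine Or.inr ⟨h1, ?_⟩
        by_contra h3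
        exact h2 ⟨by linarith, by linarith⟩
      · rintro (⟨-, h1⟩ | ⟨h1, h2⟩)
        · exact h1.elim
        · exact ⟨h1, fun h3 => by linarith [h3.2]⟩
  rw [e, measure_union, measure_preimage_add_right]
  · have := measure_inter_add_sdiff (μ := volume) s (measurableSet_Iio (a := (0:ℝ)))
    rw [← this]
    congr 1
    apply measure_congr
    have : s \ Set.Iio 0 = s ∩ Set.Ici 0 := by ext; simp
    rw [this]
    exact (Filter.EventuallyEq.refl _ s).inter Ioi_ae_eq_Ici
  · rw [Set.disjoint_left]
    rintro x ⟨-, hx⟩ ⟨-, hx2⟩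
    simp only [Set.mem_Iio, Set.mem_Ioi] at hx hx2
    linarith
  · exact (hs.inter measurableSet_Ioi).preimage (measurable_add_const _)

lemma cubeShift_le {t s : ℝ} (ht : t ∉ Set.Icc (0:ℝ) 1) (hs : 0 ≤ s ∧ s ≤ 1) :
    cubeShift t ^ 2 ≤ (t - s) ^ 2 := by
  unfold cubeShift
  split_ifs with h
  · nlinarith
  · have : 1 < t := by
      by_contra h2; exact ht ⟨by linarith, by linarith⟩
    nlinarith

/-- Outer shell in coordinates. -/
lemma shell_volume {ι : Type*} [Fintype ι] [Nonempty ι] (ρ : ℝ) (hρ : 0 ≤ ρ) :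
    volume {x : ι → ℝ | (∀ i, x i ∉ Set.Icc (0:ℝ) 1) ∧ ∑ i, cubeShift (x i) ^ 2 ≤ ρ ^ 2}
      = .ofReal ρ ^ Fintype.card ι *
        .ofReal (√π ^ Fintype.card ι / Real.Gamma (Fintype.card ι / 2 + 1)) := by
  rw [← EuclideanSpace.volume_closedBall ι 0 ρ,
    ← (PiLp.volume_preserving_toLp ι).measure_preimage measurableSet_closedBall.nullMeasurableSet]
  have hmp : MeasurePreserving (fun (x : ι → ℝ) i => cubeShift (x i))
      (Measure.pi fun _ => volume.restrict (Set.Icc (0:ℝ) 1)ᶜ) (Measure.pi fun _ => volume) :=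
    measurePreserving_pi _ _ (fun _ => cubeShift_mp)
  rw [← volume_pi] at hmp
  have hms : MeasurableSet (WithLp.toLp 2 ⁻¹' closedBall (0 : EuclideanSpace ℝ ι) ρ) :=
    measurableSet_closedBall.preimage (PiLp.volume_preserving_toLp ι).measurable
  rw [← hmp.measure_preimage hms.nullMeasurableSet, ← Measure.restrict_pi_pi,
    Measure.restrict_apply (hms.preimage hmp.measurable), ← volume_pi]
  congr 1
  ext x
  simp only [Set.mem_ofPred_eq, Set.mem_inter_iff, Set.mem_preimage, mem_closedBall, dist_zero_right,
    EuclideanSpace.norm_eq, Real.norm_eq_abs, sq_abs, Set.mem_pi, Set.mem_univ, forall_true_left,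
    Set.mem_compl_iff]
  rw [Real.sqrt_le_left hρ, and_comm]

lemma piece_volume_aux {d : ℕ} (p : Fin d → Prop) [DecidablePred p] [Nonempty (Subtype p)]
    (ρ : ℝ) (hρ : 0 ≤ ρ) :
    volume {x : Fin d → ℝ | (∀ i, p i → x i ∉ Set.Icc (0:ℝ) 1) ∧
      (∀ i, ¬ p i → x i ∈ Set.Icc (0:ℝ) 1) ∧ ∑ i : Subtype p, cubeShift (x i) ^ 2 ≤ ρ ^ 2}
      = .ofReal ρ ^ Fintype.card (Subtype p) *
        .ofReal (√π ^ Fintype.card (Subtype p) /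
          Real.Gamma (Fintype.card (Subtype p) / 2 + 1)) := by
  rw [← shell_volume (ι := Subtype p) ρ hρ]
  have hmp := volume_preserving_piEquivPiSubtypeProd (fun _ : Fin d => ℝ) p
  have hc : volume (Set.univ.pi fun _ : {i // ¬ p i} => Set.Icc (0:ℝ) 1) = 1 := by
    rw [volume_pi_pi]; simp
  symm
  rw [← mul_one (volume _), ← hc, ← Measure.prod_prod, ← Measure.volume_eq_prod,
    ← hmp.measure_preimage_equiv]
  symm
  congr 1
  ext x
  simp only [Set.mem_ofPred_eq, Set.mem_preimage, Set.mem_prod, Set.mem_pi, Set.mem_univ,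
    forall_true_left, MeasurableEquiv.piEquivPiSubtypeProd, MeasurableEquiv.coe_mk,
    Equiv.piEquivPiSubtypeProd_apply, Subtype.forall]
  tauto

lemma piece_volume {d : ℕ} (J : Finset (Fin d)) (hJ : J.Nonempty) (ρ : ℝ) (hρ : 0 ≤ ρ) :
    volume {x : Fin d → ℝ | (∀ i ∈ J, x i ∉ Set.Icc (0:ℝ) 1) ∧ (∀ i ∉ J, x i ∈ Set.Icc (0:ℝ) 1) ∧
      ∑ i ∈ J, cubeShift (x i) ^ 2 ≤ ρ ^ 2}
      = .ofReal ρ ^ J.card * .ofReal (√π ^ J.card / Real.Gamma (J.card / 2 + 1)) := by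
  have : Nonempty (Subtype (fun i => i ∈ J)) := hJ.to_subtype
  have h := piece_volume_aux (fun i => i ∈ J) ρ hρ
  rw [Fintype.card_subtype, Finset.filter_univ_mem] at h
  rw [← h]
  congr 1
  ext x
  simp only [Set.mem_ofPred_eq]
  rw [Finset.sum_subtype J (fun _ => Iff.rfl) (fun i => cubeShift (x i) ^ 2)]

lemma cube_compact (d : ℕ) : IsCompact (closedUnitCube d) := by
  have : closedUnitCube d = (WithLp.toLp 2) '' (Set.univ.pi fun _ : Fin d => Set.Icc (0:ℝ) 1) := by
    ext x
    constructor
    · intro hx; exact ⟨x.ofLp, fun i _ => hx i, rfl⟩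
    · rintro ⟨y, hy, rfl⟩ i; exact hy i trivial
  rw [this]
  exact (isCompact_univ_pi fun _ => isCompact_Icc).image (PiLp.continuous_toLp 2 _)

lemma cube_shell (d : ℕ) (ρ : ℝ) (hρ : 0 ≤ ρ) :
    volume (cthickening ρ (closedUnitCube d) \ closedUnitCube d) ≤ ENNReal.ofReal
          (∑ j ∈ Finset.Icc 1 d,
            (d.choose j : ℝ) * (Real.pi ^ ((j : ℝ) / 2) / Real.Gamma (1 + (j : ℝ) / 2))
              * ρ ^ j) := by
  classical
  rw [← (PiLp.volume_preserving_toLp (Fin d)).measure_preimage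
    (((cube_compact d).cthickening).measurableSet.diff
      (cube_compact d).measurableSet).nullMeasurableSet]
  let A : Finset (Fin d) → Set (Fin d → ℝ) := fun J =>
    {x : Fin d → ℝ | (∀ i ∈ J, x i ∉ Set.Icc (0:ℝ) 1) ∧ (∀ i ∉ J, x i ∈ Set.Icc (0:ℝ) 1) ∧
      ∑ i ∈ J, cubeShift (x i) ^ 2 ≤ ρ ^ 2}
  have hsub : (WithLp.toLp 2) ⁻¹' (cthickening ρ (closedUnitCube d) \ closedUnitCube d) ⊆
      ⋃ J ∈ (Finset.univ : Finset (Fin d)).powerset.filter (·.Nonempty), A J := by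
    rintro x ⟨hx, hx2⟩
    rw [(cube_compact d).cthickening_eq_biUnion_closedBall hρ] at hx
    simp only [Set.mem_iUnion, mem_closedBall, exists_prop] at hx
    obtain ⟨y, hy, hxy⟩ := hx
    simp only [Set.mem_iUnion, exists_prop]
    refine ⟨Finset.univ.filter (fun i => x i ∉ Set.Icc (0:ℝ) 1), ?_, ?_, ?_, ?_⟩
    · simp only [Finset.mem_filter, Finset.powerset_univ, Finset.mem_univ, true_and]
      by_contra h
      rw [Finset.not_nonempty_iff_eq_empty, Finset.filter_eq_empty_iff] at h
      exact hx2 fun i => by simpa using h (Finset.mem_univ i)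
    · intro i hi; exact (Finset.mem_filter.mp hi).2
    · intro i hi; by_contra h; exact hi (Finset.mem_filter.mpr ⟨Finset.mem_univ _, h⟩)
    · rw [EuclideanSpace.dist_eq, Real.sqrt_le_left hρ] at hxy
      refine le_trans ?_ hxy
      refine (Finset.sum_le_sum (g := fun i => dist (x i) (y i) ^ 2) fun i hi => ?_).trans
        (Finset.sum_le_sum_of_subset_of_nonneg (Finset.filter_subset _ _)
          fun _ _ _ => by positivity)
      rw [Real.dist_eq, sq_abs]
      exact cubeShift_le (Finset.mem_filter.mp hi).2 (hy i)
  let g : ℕ → ℝ := fun j => (Real.pi ^ ((j : ℝ) / 2) / Real.Gamma (1 + (j : ℝ) / 2)) * ρ ^ j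
  have hg : ∀ j, 0 ≤ g j := fun j => by
    have : 0 < Real.Gamma (1 + (j : ℝ) / 2) := Real.Gamma_pos_of_pos (by positivity)
    positivity
  have hA : ∀ J : Finset (Fin d), J.Nonempty → volume (A J) = ENNReal.ofReal (g J.card) := by
    intro J hJ
    rw [piece_volume J hJ ρ hρ, ← ENNReal.ofReal_pow hρ, ← ENNReal.ofReal_mul (by positivity)]
    congr 1
    simp only [g]
    rw [mul_comm, add_comm (1:ℝ), Real.sqrt_eq_rpow, ← Real.rpow_natCast, ← Real.rpow_mul Real.pi_pos.le,
      one_div_mul_eq_div]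
  calc _ ≤ _ := measure_mono hsub
    _ ≤ ∑ J ∈ (Finset.univ : Finset (Fin d)).powerset.filter (·.Nonempty), volume (A J) :=
        measure_biUnion_finset_le _ _
    _ = ∑ J ∈ (Finset.univ : Finset (Fin d)).powerset.filter (·.Nonempty),
          ENNReal.ofReal (g J.card) :=
        Finset.sum_congr rfl fun J hJ => hA J (Finset.mem_filter.mp hJ).2
    _ = ENNReal.ofReal (∑ J ∈ (Finset.univ : Finset (Fin d)).powerset.filter (·.Nonempty),
          g J.card) := (ENNReal.ofReal_sum_of_nonneg fun _ _ => hg _).symm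
    _ = _ := by
      congr 1
      have h1 : ∑ J ∈ (Finset.univ : Finset (Fin d)).powerset.filter (·.Nonempty), g J.card
          = ∑ J ∈ (Finset.univ : Finset (Fin d)).powerset,
            (if J.card = 0 then 0 else g J.card) := by
        rw [Finset.sum_filter]
        refine Finset.sum_congr rfl fun J _ => ?_
        by_cases h : J.Nonempty
        · simp [h, h.ne_empty]
        · simp [Finset.not_nonempty_iff_eq_empty.mp h]
      rw [h1, Finset.sum_powerset_apply_card (fun j => if j = 0 then 0 else g j)]
      rw [Finset.card_univ, Fintype.card_fin, Finset.sum_range_succ']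
      simp only [Nat.succ_ne_zero, if_false, if_true, smul_zero, add_zero, nsmul_eq_mul]
      rw [← Finset.Ico_add_one_right_eq_Icc, Finset.sum_Ico_eq_sum_range]
      refine Finset.sum_congr (by simp) fun j _ => ?_
      simp only [g]
      rw [add_comm 1 j]
      ring

end aux

/-- For a nonempty closed convex `K ⊆ [0,1]^d` and `ρ ≥ 0`,
`Vol({x ∉ K : dist(x,K) ≤ ρ}) ≤ ∑_{j=1}^d binom(d,j) · κ_j · ρ^j`,
where `κ_j = π^(j/2) / Γ(1 + j/2)`. -/
theorem volume_outerNbhd_le_steiner (d : ℕ) (hd : 1 ≤ d)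
    (K : Set (EuclideanSpace ℝ (Fin d))) (hne : K.Nonempty) (hcl : IsClosed K)
    (hconv : Convex ℝ K) (hsub : K ⊆ closedUnitCube d) (ρ : ℝ) (hρ : 0 ≤ ρ) :
    volume {x : EuclideanSpace ℝ (Fin d) | x ∉ K ∧ Metric.infDist x K ≤ ρ}
      ≤ ENNReal.ofReal
          (∑ j ∈ Finset.Icc 1 d,
            (d.choose j : ℝ) * (Real.pi ^ ((j : ℝ) / 2) / Real.Gamma (1 + (j : ℝ) / 2))
              * ρ ^ j) := by
  have hC := cube_compact d
  have hK : IsCompact K := hC.of_isClosed_subset hcl hsub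
  have hset : {x : EuclideanSpace ℝ (Fin d) | x ∉ K ∧ Metric.infDist x K ≤ ρ}
      = cthickening ρ K \ K := by
    ext x
    have : infEDist x K ≠ ⊤ := infEDist_ne_top hne
    simp only [Set.mem_ofPred_eq, Set.mem_sdiff, mem_cthickening_iff, infDist,
      ENNReal.le_ofReal_iff_toReal_le this hρ]
    tauto
  have hm := steiner_mono (closedUnitCube d) K hC hne hcl hconv hsub ρ hρ
  rw [hset]
  refine le_trans ?_ (cube_shell d ρ hρ)
  have hKf : volume K ≠ ⊤ := hK.measure_lt_top.ne
  have hCf : volume (closedUnitCube d) ≠ ⊤ := hC.measure_lt_top.ne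
  rw [measure_sdiff (self_subset_cthickening _) hK.measurableSet.nullMeasurableSet hKf,
    measure_sdiff (self_subset_cthickening _) hC.measurableSet.nullMeasurableSet hCf]
  rw [tsub_le_iff_right]
  have h2 : volume (cthickening ρ (closedUnitCube d)) - volume (closedUnitCube d)
      + volume (closedUnitCube d) = volume (cthickening ρ (closedUnitCube d)) :=
    tsub_add_cancel_of_le (measure_mono (self_subset_cthickening _))
  rw [← h2] at hm
  refine (ENNReal.add_le_add_iff_right hCf).mp (hm.trans (le_of_eq ?_))
  ring
end

section
/- For every d ≥ 1 and every ρ ≥ 0, the volume of the closed ρ-neighbourhood of the unit cube satisfies Vol({x ∈ ℝ^d : dist(x, [0,1]^d) ≤ ρ}) = ∑_{j=0}^d binom(d, j) · κ_j · ρ^j, where κ_j = π^(j/2) / Γ(1 + j/2) and κ_0 = 1. -/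
open MeasureTheory Metric
open scoped ENNReal Real

/-- Displacement from the nearest point of the unit interval. -/
noncomputable def psiC (t : ℝ) : ℝ := t - max 0 (min t 1)

lemma psiC_meas : Measurable psiC := by unfold psiC; fun_prop

lemma lintegral_psiC (h : ℝ → ℝ≥0∞) :
    ∫⁻ t, h (psiC t) = h 0 + ∫⁻ t, h t := by
  have e1 : ∫⁻ t in Set.Iic 0, h (psiC t) = ∫⁻ t in Set.Iic 0, h t := by
    refine setLIntegral_congr_fun measurableSet_Iic fun t ht => ?_
    have ht' : t ≤ 0 := ht
    have : psiC t = t := by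
      unfold psiC; rw [max_eq_left ((min_le_left _ _).trans ht')]; ring
    simp only [this]
  have e2 : ∫⁻ t in Set.Ioc 0 1, h (psiC t) = h 0 := by
    have : ∫⁻ t in Set.Ioc (0:ℝ) 1, h (psiC t) = ∫⁻ t in Set.Ioc (0:ℝ) 1, h 0 := by
      refine setLIntegral_congr_fun measurableSet_Ioc fun t ht => ?_
      have : psiC t = 0 := by
        unfold psiC; rw [min_eq_left ht.2, max_eq_right ht.1.le]; ring
      simp only [this]
    rw [this]; simp
  have e3 : ∫⁻ t in Set.Ioi 1, h (psiC t) = ∫⁻ t in Set.Ioi 0, h t := by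
    have : ∫⁻ t in Set.Ioi (1:ℝ), h (psiC t) = ∫⁻ t in Set.Ioi (1:ℝ), h (t - 1) := by
      refine setLIntegral_congr_fun measurableSet_Ioi fun t ht => ?_
      have ht' : 1 < t := ht
      have : psiC t = t - 1 := by
        unfold psiC; rw [min_eq_right ht'.le, max_eq_right zero_le_one]
      simp only [this]
    rw [this, ← lintegral_indicator measurableSet_Ioi, ← lintegral_indicator measurableSet_Ioi,
      ← lintegral_sub_right_eq_self (fun t => (Set.Ioi (0:ℝ)).indicator (fun t => h t) t) (1:ℝ)]
    refine lintegral_congr fun t => ?_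
    simp [Set.indicator]
  have c1 : (Set.Iic (0:ℝ))ᶜ = Set.Ioc 0 1 ∪ Set.Ioi 1 := by
    rw [Set.compl_Iic, Set.Ioc_union_Ioi_eq_Ioi zero_le_one]
  have hR := (lintegral_add_compl (μ := volume) (fun t => h t) (measurableSet_Iic (a := (0:ℝ)))).symm
  rw [← lintegral_add_compl _ (measurableSet_Iic (a := (0:ℝ))), c1,
    lintegral_union measurableSet_Ioi (by
      rw [Set.disjoint_left]; intro t ht h2; exact absurd ht.2 (not_le.2 h2)), e1, e2, e3, hR, Set.compl_Iic]
  ring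

/-- Volume of the sublevel set of a sum of squares. -/
noncomputable def subVol (ψ : ℝ → ℝ) (n : ℕ) (R : ℝ) : ℝ≥0∞ :=
  volume {x : Fin n → ℝ | ∑ i, ψ (x i) ^ 2 ≤ R}

lemma subVol_meas (ψ : ℝ → ℝ) (n : ℕ) : Measurable (subVol ψ n) := by
  apply Monotone.measurable
  intro a b hab
  exact measure_mono fun x hx => le_trans hx hab

lemma subVol_succ (ψ : ℝ → ℝ) (hψ : Measurable ψ) (n : ℕ) (R : ℝ) :
    subVol ψ (n+1) R = ∫⁻ t, subVol ψ n (R - ψ t ^ 2) := by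
  have mp := volume_preserving_piFinSuccAbove (fun _ : Fin (n+1) => ℝ) 0
  have ms : MeasurableSet {p : ℝ × (Fin n → ℝ) | ψ p.1 ^ 2 + ∑ i, ψ (p.2 i) ^ 2 ≤ R} := by
    apply measurableSet_le <;> fun_prop
  have := mp.measure_preimage ms.nullMeasurableSet
  unfold subVol
  rw [Measure.volume_eq_prod, Measure.prod_apply ms] at this
  convert this using 1
  · congr 1
    ext x
    simp [Fin.sum_univ_succ, MeasurableEquiv.piFinSuccAbove, Fin.tail]
  · refine lintegral_congr fun t => ?_
    congr 1
    ext x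
    simp [le_sub_iff_add_le, add_comm]

lemma subVol_psiC (m : ℕ) (R : ℝ) :
    subVol psiC m R = ∑ j ∈ Finset.range (m+1), (m.choose j : ℝ≥0∞) * subVol id j R := by
  induction m generalizing R with
  | zero => simp [subVol]
  | succ m ih =>
    rw [subVol_succ _ psiC_meas, lintegral_psiC (fun t => subVol psiC m (R - t^2))]
    simp only [ih]
    rw [lintegral_finsetSum _ (fun j _ => by
      have := subVol_meas id j
      fun_prop)]
    have : ∀ j, ∫⁻ t : ℝ, (m.choose j : ℝ≥0∞) * subVol id j (R - t^2)
        = (m.choose j : ℝ≥0∞) * subVol id (j+1) R := by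
      intro j
      rw [lintegral_const_mul' _ _ (by simp), subVol_succ id measurable_id]; rfl
    simp only [this]
    rw [Finset.sum_range_succ' _ (m+1)]
    simp only [Nat.choose_succ_succ, Nat.cast_add, add_mul, Finset.sum_add_distrib]
    rw [Finset.sum_range_succ' _ m, Finset.sum_range_succ (fun j => (m.choose (j+1) : ℝ≥0∞) * subVol id (j+1) R) m]
    simp
    ring

lemma subVol_id (j : ℕ) (ρ : ℝ) (hρ : 0 ≤ ρ) :
    subVol id j (ρ^2) = ENNReal.ofReal
      (Real.pi ^ ((j : ℝ) / 2) / Real.Gamma (1 + (j : ℝ) / 2) * ρ ^ j) := by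
  rcases Nat.eq_zero_or_pos j with rfl | hj
  · simp [subVol, sq_nonneg, volume_pi]
  have : Nonempty (Fin j) := ⟨⟨0, hj⟩⟩
  have h := EuclideanSpace.volume_closedBall (Fin j) (0 : EuclideanSpace ℝ (Fin j)) ρ
  rw [← (EuclideanSpace.volume_preserving_symm_measurableEquiv_toLp (Fin j)).symm.measure_preimage
    measurableSet_closedBall.nullMeasurableSet] at h
  have hs : subVol id j (ρ^2) = ENNReal.ofReal ρ ^ Fintype.card (Fin j) * ENNReal.ofReal (√π ^ Fintype.card (Fin j) / Real.Gamma ((Fintype.card (Fin j)) / 2 + 1)) := by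
    rw [← h]
    unfold subVol
    congr 1
    ext x
    simp [EuclideanSpace.norm_eq, Real.sqrt_le_left hρ]
  rw [hs, Fintype.card_fin, ← ENNReal.ofReal_pow hρ, ← ENNReal.ofReal_mul (by positivity)]
  congr 1
  rw [Real.sqrt_eq_rpow, ← Real.rpow_mul_natCast Real.pi_pos.le, add_comm (1:ℝ), mul_comm]
  congr 3
  ring

lemma infDist_cube (d : ℕ) (x : EuclideanSpace ℝ (Fin d)) :
    Metric.infDist x (closedUnitCube d) = √(∑ i, psiC (x i) ^ 2) := by
  let p : EuclideanSpace ℝ (Fin d) := WithLp.toLp 2 fun i => max 0 (min (x i) 1)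
  have hp : p ∈ closedUnitCube d := fun i => by
    constructor
    · exact le_max_left _ _
    · exact max_le zero_le_one (min_le_right _ _)
  have hd : dist x p = √(∑ i, psiC (x i) ^ 2) := by
    rw [EuclideanSpace.dist_eq]
    simp [p, psiC, Real.dist_eq, sq_abs]
  apply le_antisymm
  · rw [← hd]; exact infDist_le_dist_of_mem hp
  · rw [le_infDist ⟨p, hp⟩]
    intro y hy
    rw [EuclideanSpace.dist_eq]
    refine Real.sqrt_le_sqrt (Finset.sum_le_sum fun i _ => ?_)
    rw [Real.dist_eq, sq_abs, sq_le_sq]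
    obtain ⟨h0, h1⟩ := hy i
    unfold psiC
    grind

/-- For every `d ≥ 1` and `ρ ≥ 0`, the volume of the closed
`ρ`-neighbourhood of the unit cube is `∑_{j=0}^d binom(d,j) · κ_j · ρ^j`,
where `κ_j = π^(j/2) / Γ(1 + j/2)` (so `κ_0 = 1`). -/
theorem volume_nbhd_unitCube_eq_steiner (d : ℕ) (hd : 1 ≤ d) (ρ : ℝ) (hρ : 0 ≤ ρ) :
    volume {x : EuclideanSpace ℝ (Fin d) | Metric.infDist x (closedUnitCube d) ≤ ρ}
      = ENNReal.ofReal
          (∑ j ∈ Finset.range (d + 1),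
            (d.choose j : ℝ) * (Real.pi ^ ((j : ℝ) / 2) / Real.Gamma (1 + (j : ℝ) / 2))
              * ρ ^ j) := by
  have hpos : ∀ j : ℕ, 0 ≤ Real.pi ^ ((j : ℝ) / 2) / Real.Gamma (1 + (j : ℝ) / 2) * ρ ^ j := by
    intro j
    have := Real.Gamma_pos_of_pos (show (0:ℝ) < 1 + (j:ℝ)/2 by positivity)
    positivity
  rw [ENNReal.ofReal_sum_of_nonneg (fun j _ => by
    rw [mul_assoc]; exact mul_nonneg (by positivity) (hpos j))]
  have hm : MeasurableSet {x : EuclideanSpace ℝ (Fin d) | Metric.infDist x (closedUnitCube d) ≤ ρ} :=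
    (isClosed_le (continuous_infDist_pt _) continuous_const).measurableSet
  rw [← (EuclideanSpace.volume_preserving_symm_measurableEquiv_toLp (Fin d)).symm.measure_preimage
    hm.nullMeasurableSet]
  have hs := subVol_psiC d (ρ^2)
  unfold subVol at hs
  convert hs using 1
  · congr 1
    ext x
    simp [infDist_cube, Real.sqrt_le_left hρ]
  · refine Finset.sum_congr rfl fun j _ => ?_
    have := subVol_id j ρ hρ
    unfold subVol at this
    rw [this, mul_assoc, ENNReal.ofReal_mul (by positivity), ENNReal.ofReal_natCast]
end

section
/- For every κ > e · (2π)^(1/3) there exists a constant C > 0 (depending only on κ) such that for all d ≥ 1: ∑_{j=1}^d binom(d, j) · π^(j/2) / Γ(1 + j/2) ≤ C · (d · √(2 e³ π))^(κ · d^(2/3)). -/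
open scoped Real

open MeasureTheory in
/-- `Γ(1+x) ≥ s^x e^{-s}`. -/
lemma gamma_lower_aux (x s : ℝ) (hx : 0 ≤ x) (hs : 0 < s) :
    s ^ x * Real.exp (-s) ≤ Real.Gamma (1 + x) := by
  have hI := Real.GammaIntegral_convergent (s := 1 + x) (by linarith)
  rw [Real.Gamma_eq_integral (by linarith)]
  have hsub : Set.Ioi s ⊆ Set.Ioi (0 : ℝ) := Set.Ioi_subset_Ioi hs.le
  have h1 : ∫ t in Set.Ioi s, s ^ x * Real.exp (-t) = s ^ x * Real.exp (-s) := by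
    rw [integral_const_mul, integral_exp_neg_Ioi]
  rw [← h1]
  calc ∫ t in Set.Ioi s, s ^ x * Real.exp (-t)
      ≤ ∫ t in Set.Ioi s, Real.exp (-t) * t ^ (1 + x - 1) := by
        refine setIntegral_mono_on ?_ (hI.mono_set hsub) measurableSet_Ioi ?_
        · exact (integrableOn_exp_neg_Ioi s).const_mul _
        · intro t ht
          have ht' : s < t := ht
          rw [mul_comm, add_sub_cancel_left]
          gcongr
    _ ≤ ∫ t in Set.Ioi (0 : ℝ), Real.exp (-t) * t ^ (1 + x - 1) := by
        refine setIntegral_mono_set hI ?_ hsub.eventuallyLE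
        filter_upwards [ae_restrict_mem measurableSet_Ioi] with t ht
        have ht' : (0 : ℝ) < t := ht
        simp only [Pi.zero_apply]
        positivity

lemma sum_bound_aux (d : ℕ) (s : ℝ) (hs : 0 < s) :
    ∑ j ∈ Finset.Icc 1 d,
        (d.choose j : ℝ) * (Real.pi ^ ((j : ℝ) / 2) / Real.Gamma (1 + (j : ℝ) / 2))
      ≤ Real.exp (s + d * Real.sqrt (Real.pi / s)) := by
  have hpi := Real.pi_pos
  have hterm : ∀ j : ℕ, Real.pi ^ ((j : ℝ) / 2) / Real.Gamma (1 + (j : ℝ) / 2)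
      ≤ Real.exp s * Real.sqrt (Real.pi / s) ^ j := by
    intro j
    have hg := gamma_lower_aux ((j : ℝ) / 2) s (by positivity) hs
    have hpow : Real.sqrt (Real.pi / s) ^ j = Real.pi ^ ((j : ℝ) / 2) / s ^ ((j : ℝ) / 2) := by
      rw [← Real.div_rpow hpi.le hs.le, Real.sqrt_eq_rpow, ← Real.rpow_natCast,
        ← Real.rpow_mul (by positivity)]
      congr 1
      ring
    calc _ ≤ Real.pi ^ ((j : ℝ) / 2) / (s ^ ((j : ℝ) / 2) * Real.exp (-s)) := by
          gcongr
      _ = _ := by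
          rw [hpow, Real.exp_neg]
          field_simp
  calc _ ≤ ∑ j ∈ Finset.Icc 1 d,
        (d.choose j : ℝ) * (Real.exp s * Real.sqrt (Real.pi / s) ^ j) := by
        gcongr with j _
        exact hterm j
    _ ≤ ∑ j ∈ Finset.range (d + 1),
        (d.choose j : ℝ) * (Real.exp s * Real.sqrt (Real.pi / s) ^ j) := by
        refine Finset.sum_le_sum_of_subset_of_nonneg ?_ ?_
        · intro j hj
          simp only [Finset.mem_Icc, Finset.mem_range] at *
          omega
        · intros
          positivity
    _ = Real.exp s * (Real.sqrt (Real.pi / s) + 1) ^ d := by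
        rw [add_pow, Finset.mul_sum]
        refine Finset.sum_congr rfl fun j _ => ?_
        simp
        ring
    _ ≤ Real.exp s * (Real.exp (Real.sqrt (Real.pi / s))) ^ d := by
        gcongr
        exact Real.add_one_le_exp _
    _ = _ := by
        rw [← Real.exp_nat_mul, ← Real.exp_add]

/-- For every `κ > e · (2π)^(1/3)` there is a `C > 0` such that for
all `d ≥ 1`:
`∑_{j=1}^d binom(d,j) · π^(j/2)/Γ(1+j/2) ≤ C · (d · √(2e³π))^(κ · d^(2/3))`. -/
theorem sum_choose_unitBallVolume_upper (κ : ℝ)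
    (hκ : Real.exp 1 * (2 * Real.pi) ^ ((1 : ℝ) / 3) < κ) :
    ∃ C : ℝ, 0 < C ∧ ∀ d : ℕ, 1 ≤ d →
      ∑ j ∈ Finset.Icc 1 d,
          (d.choose j : ℝ) * (Real.pi ^ ((j : ℝ) / 2) / Real.Gamma (1 + (j : ℝ) / 2))
        ≤ C * ((d : ℝ) * Real.sqrt (2 * Real.exp 1 ^ 3 * Real.pi))
              ^ (κ * (d : ℝ) ^ ((2 : ℝ) / 3)) := by
  have hpi3 := Real.pi_gt_three
  have hpi4 := Real.pi_le_four
  have he : (2.7 : ℝ) < Real.exp 1 := by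
    have := Real.exp_one_gt_d9
    linarith
  have hκ3 : 3 ≤ κ := by
    have h : (1.5 : ℝ) ≤ (2 * Real.pi) ^ ((1 : ℝ) / 3) := by
      have h2 : ((1.5 : ℝ) ^ (3 : ℝ)) ^ ((1 : ℝ) / 3) = 1.5 := by
        rw [← Real.rpow_mul (by norm_num)]
        norm_num
      rw [← h2]
      refine Real.rpow_le_rpow (by positivity) ?_ (by norm_num)
      have : (1.5 : ℝ) ^ (3 : ℝ) = 1.5 ^ 3 := by
        exact_mod_cast Real.rpow_natCast (1.5 : ℝ) 3
      rw [this]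
      norm_num
      linarith
    nlinarith
  refine ⟨1, one_pos, fun d hd => ?_⟩
  have hd1 : (1 : ℝ) ≤ d := by exact_mod_cast hd
  have hd0 : (0 : ℝ) < d := by linarith
  set s : ℝ := (d : ℝ) ^ ((2 : ℝ) / 3) with hsdef
  have hs : 0 < s := by positivity
  have hs3 : s ^ 3 = (d : ℝ) ^ 2 := by
    rw [hsdef, ← Real.rpow_natCast, ← Real.rpow_mul hd0.le, ← Real.rpow_natCast]
    norm_num
  have hroot : d * Real.sqrt (Real.pi / s) ≤ 2 * s := by
    have h1 : Real.sqrt (Real.pi / s) ≤ 2 * s / d := by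
      apply Real.sqrt_le_iff.2 ⟨by positivity, ?_⟩
      rw [div_pow, ← hs3]
      rw [div_le_div_iff₀ hs (by positivity)]
      have : 0 < s ^ 3 := by positivity
      nlinarith
    calc d * Real.sqrt (Real.pi / s) ≤ d * (2 * s / d) := by gcongr
      _ = 2 * s := by field_simp
  have hbase : Real.exp 1 ≤ (d : ℝ) * Real.sqrt (2 * Real.exp 1 ^ 3 * Real.pi) := by
    have h1 : Real.exp 1 ≤ Real.sqrt (2 * Real.exp 1 ^ 3 * Real.pi) := by
      apply Real.le_sqrt_of_sq_le
      have h2 : 0 < Real.exp 1 ^ 2 := by positivity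
      have h3 : 1 ≤ 2 * Real.exp 1 * Real.pi := by nlinarith
      nlinarith
    have h0 := Real.sqrt_nonneg (2 * Real.exp 1 ^ 3 * Real.pi)
    nlinarith
  rw [one_mul]
  calc _ ≤ Real.exp (s + d * Real.sqrt (Real.pi / s)) := sum_bound_aux d s hs
    _ ≤ Real.exp (κ * s) := by
        apply Real.exp_le_exp.2
        nlinarith
    _ = Real.exp 1 ^ (κ * s) := by rw [Real.exp_one_rpow]
    _ ≤ _ := Real.rpow_le_rpow (by positivity) hbase (by positivity)
end

section
/- For every δ ∈ (0, 2/3) and every d ≥ 1: (1 / (√(2π) · e · d)) · d^(δ · d^(2/3 − δ)) ≤ ∑_{j=1}^d binom(d, j) · π^(j/2) / Γ(1 + j/2). -/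
open scoped Real

lemma aux_choose (n k : ℕ) (h : k ≤ n) : (n : ℝ) ^ k ≤ (n.choose k : ℝ) * (k : ℝ) ^ k := by
  induction k generalizing n with
  | zero => simp
  | succ k ih =>
    obtain ⟨n, rfl⟩ : ∃ m, n = m + 1 := ⟨n - 1, by omega⟩
    have hkn : k ≤ n := by omega
    have h1 := ih n hkn
    have h2 : ((n + 1 : ℕ) : ℝ) * (n.choose k : ℝ)
        = ((n + 1).choose (k + 1) : ℝ) * ((k + 1 : ℕ) : ℝ) := by
      exact_mod_cast Nat.add_one_mul_choose_eq n k
    have hknR : (k : ℝ) ≤ n := by exact_mod_cast hkn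
    have h3 : ((n + 1 : ℕ) : ℝ) ^ k * (k : ℝ) ^ k ≤ (n : ℝ) ^ k * ((k + 1 : ℕ) : ℝ) ^ k := by
      rw [← mul_pow, ← mul_pow]
      apply pow_le_pow_left₀ (by positivity)
      push_cast
      nlinarith
    have h4 : ((n + 1 : ℕ) : ℝ) ^ k ≤ (n.choose k : ℝ) * ((k + 1 : ℕ) : ℝ) ^ k := by
      rcases Nat.eq_zero_or_pos k with rfl | hk
      · simp
      · have hk' : (0 : ℝ) < (k : ℝ) ^ k := by positivity
        refine le_of_mul_le_mul_right ?_ hk'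
        calc _ ≤ _ := h3
          _ ≤ ((n.choose k : ℝ) * (k : ℝ) ^ k) * ((k + 1 : ℕ) : ℝ) ^ k := by gcongr
          _ = _ := by ring
    calc ((n + 1 : ℕ) : ℝ) ^ (k + 1) = ((n + 1 : ℕ) : ℝ) ^ k * ((n + 1 : ℕ) : ℝ) := pow_succ _ _
      _ ≤ ((n.choose k : ℝ) * ((k + 1 : ℕ) : ℝ) ^ k) * ((n + 1 : ℕ) : ℝ) := by gcongr
      _ = (((n + 1 : ℕ) : ℝ) * (n.choose k : ℝ)) * ((k + 1 : ℕ) : ℝ) ^ k := by ring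
      _ = _ := by rw [h2]; ring

lemma aux_term (d k : ℕ) (hk : 1 ≤ k) (h : 2 * k ≤ d)
    (hb : 4 * Real.exp 1 ^ 2 * (k : ℝ) ^ 3 ≤ (d : ℝ) ^ 2 * π) :
    Real.exp (2 * k) ≤ (d.choose (2 * k) : ℝ) *
      (Real.pi ^ (((2 * k : ℕ) : ℝ) / 2) / Real.Gamma (1 + ((2 * k : ℕ) : ℝ) / 2)) := by
  have e1 : ((2 * k : ℕ) : ℝ) / 2 = k := by push_cast; ring
  rw [e1, Real.rpow_natCast, add_comm, Real.Gamma_nat_eq_factorial]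
  have hf : (0 : ℝ) < (k.factorial : ℝ) := by exact_mod_cast k.factorial_pos
  have hf2 : (k.factorial : ℝ) ≤ (k : ℝ) ^ k := by exact_mod_cast Nat.factorial_le_pow k
  have hc := aux_choose d (2 * k) h
  have hk0 : (0 : ℝ) < k := by exact_mod_cast hk
  have hpos : (0 : ℝ) < ((2 * k : ℕ) : ℝ) ^ (2 * k) := by positivity
  have hexp : Real.exp (2 * k) = (Real.exp 1 ^ 2) ^ k := by
    rw [← pow_mul, ← Real.exp_nat_mul]; push_cast; ring_nf
  rw [← mul_div_assoc, le_div_iff₀ hf, hexp]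
  refine le_of_mul_le_mul_right ?_ hpos
  calc (Real.exp 1 ^ 2) ^ k * k.factorial * ((2 * k : ℕ) : ℝ) ^ (2 * k)
      ≤ (Real.exp 1 ^ 2) ^ k * (k : ℝ) ^ k * ((2 * k : ℕ) : ℝ) ^ (2 * k) := by gcongr
    _ = (4 * Real.exp 1 ^ 2 * (k : ℝ) ^ 3) ^ k := by
        push_cast
        rw [pow_mul (2 * (k : ℝ)), ← mul_pow, ← mul_pow]; congr 1; ring
    _ ≤ ((d : ℝ) ^ 2 * π) ^ k := by gcongr
    _ = (d : ℝ) ^ (2 * k) * π ^ k := by rw [mul_pow, pow_mul]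
    _ ≤ ((d.choose (2 * k) : ℝ) * ((2 * k : ℕ) : ℝ) ^ (2 * k)) * π ^ k := by gcongr
    _ = _ := by ring

/-- For every `δ ∈ (0, 2/3)` and every `d ≥ 1`:
`(1/(√(2π) · e · d)) · d^(δ · d^(2/3 − δ)) ≤ ∑_{j=1}^d binom(d,j) · π^(j/2)/Γ(1+j/2)`. -/
theorem sum_choose_unitBallVolume_lower (δ : ℝ) (hδ : δ ∈ Set.Ioo (0 : ℝ) (2 / 3))
    (d : ℕ) (hd : 1 ≤ d) :
    1 / (Real.sqrt (2 * Real.pi) * Real.exp 1 * (d : ℝ))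
        * (d : ℝ) ^ (δ * (d : ℝ) ^ ((2 : ℝ) / 3 - δ))
      ≤ ∑ j ∈ Finset.Icc 1 d,
          (d.choose j : ℝ) * (Real.pi ^ ((j : ℝ) / 2) / Real.Gamma (1 + (j : ℝ) / 2)) := by
  have hd1 : (1 : ℝ) ≤ d := by exact_mod_cast hd
  have hd0 : (0 : ℝ) < d := by linarith
  obtain ⟨y, hy⟩ : ∃ y, y = Real.exp (2 / 3 * Real.log d) := ⟨_, rfl⟩
  have hy0 : 0 < y := hy ▸ Real.exp_pos _
  have hy3 : y ^ 3 = (d : ℝ) ^ 2 := by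
    rw [hy, ← Real.exp_nat_mul]
    rw [show ((3 : ℕ) : ℝ) * (2 / 3 * Real.log d) = Real.log d + Real.log d by push_cast; ring,
      Real.exp_add, Real.exp_log hd0]; ring
  have he1 : (2.7 : ℝ) < Real.exp 1 := by linarith [Real.exp_one_gt_d9]
  have he2 : Real.exp 1 < 2.72 := by linarith [Real.exp_one_lt_d9]
  have hs : (2 : ℝ) ≤ Real.sqrt (2 * π) :=
    Real.le_sqrt_of_sq_le (by nlinarith [Real.pi_gt_three])
  have hA : (d : ℝ) ^ (δ * (d : ℝ) ^ ((2 : ℝ) / 3 - δ)) ≤ Real.exp (y / Real.exp 1) := by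
    rw [Real.rpow_def_of_pos hd0, Real.rpow_def_of_pos hd0]
    apply Real.exp_le_exp.2
    have h1 : δ * Real.log d ≤ Real.exp (δ * Real.log d - 1) := by
      linarith [Real.add_one_le_exp (δ * Real.log d - 1)]
    calc Real.log d * (δ * Real.exp (Real.log d * (2 / 3 - δ)))
        = (δ * Real.log d) * Real.exp (Real.log d * (2 / 3 - δ)) := by ring
      _ ≤ Real.exp (δ * Real.log d - 1) * Real.exp (Real.log d * (2 / 3 - δ)) := by gcongr
      _ = y / Real.exp 1 := by
        rw [hy, ← Real.exp_add, ← Real.exp_sub]; congr 1; ring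
  have hnn : ∀ j ∈ Finset.Icc 1 d, 0 ≤ (d.choose j : ℝ) *
      (Real.pi ^ ((j : ℝ) / 2) / Real.Gamma (1 + (j : ℝ) / 2)) := by
    intro j _
    have : 0 < Real.Gamma (1 + (j : ℝ) / 2) := Real.Gamma_pos_of_pos (by positivity)
    positivity
  rw [one_div_mul_eq_div, div_le_iff₀ (by positivity)]
  refine hA.trans ?_
  have hD : 1 ≤ Real.sqrt (2 * π) * Real.exp 1 * (d : ℝ) := by
    have : 1 ≤ Real.sqrt (2 * π) * Real.exp 1 := by nlinarith
    nlinarith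
  rcases le_total y 4 with h4 | h4
  · have ht := Finset.single_le_sum hnn (Finset.mem_Icc.2 ⟨le_refl 1, hd⟩)
    have hv : (d.choose 1 : ℝ) *
        (Real.pi ^ (((1 : ℕ) : ℝ) / 2) / Real.Gamma (1 + ((1 : ℕ) : ℝ) / 2)) = 2 * d := by
      rw [Nat.choose_one_right, Nat.cast_one, add_comm, Real.Gamma_add_one (by norm_num),
        Real.Gamma_one_half_eq, ← Real.sqrt_eq_rpow]
      have : Real.sqrt π ≠ 0 := (Real.sqrt_pos.2 Real.pi_pos).ne'
      field_simp
    rw [hv] at ht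
    have h5 : Real.exp (y / Real.exp 1) ≤ Real.exp 1 * Real.exp 1 := by
      rw [← Real.exp_add]
      apply Real.exp_le_exp.2
      rw [div_le_iff₀ (by positivity)]
      linarith
    have h6 : Real.exp 1 * Real.exp 1 ≤ 2 * d * (Real.sqrt (2 * π) * Real.exp 1 * d) := by
      have h7 : Real.exp 1 ≤ 2 * d * (Real.sqrt (2 * π) * d) := by
        have : 2 ≤ Real.sqrt (2 * π) * d := by nlinarith
        nlinarith
      nlinarith
    refine h5.trans (h6.trans ?_)
    gcongr
  · obtain ⟨k, hk⟩ : ∃ k, k = ⌈y / (2 * Real.exp 1)⌉₊ := ⟨_, rfl⟩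
    have hyp : 0 < y / (2 * Real.exp 1) := by positivity
    have hk1 : 1 ≤ k := by rw [hk]; exact Nat.ceil_pos.2 hyp
    have hk2 : y / (2 * Real.exp 1) ≤ k := by rw [hk]; exact Nat.le_ceil _
    have hk3 : (k : ℝ) < y / (2 * Real.exp 1) + 1 := by
      rw [hk]; exact Nat.ceil_lt_add_one hyp.le
    have hk4 : (k : ℝ) ≤ 0.44 * y := by
      have : y / (2 * Real.exp 1) ≤ 0.19 * y := by
        rw [div_le_iff₀ (by positivity)]; nlinarith
      linarith
    have hyd : y ≤ d := by
      have : y ^ 2 ≤ (d : ℝ) ^ 2 := by rw [← hy3]; nlinarith [sq_nonneg y]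
      exact le_of_sq_le_sq this hd0.le
    have hkd : 2 * k ≤ d := by
      have : (2 * k : ℝ) ≤ d := by linarith
      exact_mod_cast this
    have hb : 4 * Real.exp 1 ^ 2 * (k : ℝ) ^ 3 ≤ (d : ℝ) ^ 2 * π := by
      rw [← hy3]
      have h1 : (k : ℝ) ^ 3 ≤ (0.44 * y) ^ 3 := by gcongr
      have h2 : Real.exp 1 ^ 2 ≤ 2.72 ^ 2 := by gcongr
      have hy30 : 0 < y ^ 3 := by positivity
      calc 4 * Real.exp 1 ^ 2 * (k : ℝ) ^ 3 ≤ 4 * 2.72 ^ 2 * (0.44 * y) ^ 3 := by gcongr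
        _ = (4 * 2.72 ^ 2 * 0.44 ^ 3) * y ^ 3 := by ring
        _ ≤ 3 * y ^ 3 := by gcongr; norm_num
        _ ≤ y ^ 3 * π := by nlinarith [Real.pi_gt_three]
    have ht := Finset.single_le_sum hnn
      (Finset.mem_Icc.2 ⟨(by omega : 1 ≤ 2 * k), hkd⟩)
    have h8 := (aux_term d k hk1 hkd hb).trans ht
    have h9 : Real.exp (y / Real.exp 1) ≤ Real.exp (2 * k) := by
      apply Real.exp_le_exp.2
      have : y / Real.exp 1 = 2 * (y / (2 * Real.exp 1)) := by field_simp
      linarith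
    have h10 := h9.trans h8
    exact h10.trans (le_mul_of_one_le_right ((Real.exp_pos _).le.trans h10) hD)
end

section
/- For every d ≥ 1 one has ∑_{j=1}^d binom(d, j) · π^(j/2) / Γ(1 + j/2) ≤ (e / √(2π)) · ∑_{j=1}^d (d · √(2 e³ π))^j / j^(3j/2). -/
open scoped Real

lemma gamma_step (x : ℝ) (hx : 0 ≤ x) (h : x ^ x * Real.exp (-x) ≤ Real.Gamma (1 + x)) :
    (x + 1) ^ (x + 1) * Real.exp (-(x + 1)) ≤ Real.Gamma (1 + (x + 1)) := by
  have h1 : (x + 1) ^ x ≤ Real.exp 1 * x ^ x := by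
    rcases hx.eq_or_lt with rfl | hx
    · simp
    · have e1 : x + 1 = x * (1 / x + 1) := by field_simp; ring
      have e2 : (1 / x + 1) ^ x ≤ Real.exp 1 := by
        calc (1 / x + 1) ^ x ≤ (Real.exp (1 / x)) ^ x :=
              Real.rpow_le_rpow (by positivity) (Real.add_one_le_exp _) hx.le
          _ = Real.exp 1 := by
              rw [← Real.exp_mul]; congr 1; field_simp
      rw [e1, Real.mul_rpow hx.le (by positivity), mul_comm]
      gcongr
  have e3 : Real.Gamma (1 + (x + 1)) = (1 + x) * Real.Gamma (1 + x) := by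
    rw [← Real.Gamma_add_one (by positivity)]; congr 1; ring
  rw [e3, Real.rpow_add_one (by positivity)]
  calc (x + 1) ^ x * (x + 1) * Real.exp (-(x + 1))
      ≤ (Real.exp 1 * x ^ x) * (x + 1) * Real.exp (-(x + 1)) := by gcongr
    _ = (1 + x) * (x ^ x * (Real.exp 1 * Real.exp (-(x + 1)))) := by ring
    _ = (1 + x) * (x ^ x * Real.exp (-x)) := by
        rw [← Real.exp_add]; congr 3; ring_nf
    _ ≤ _ := by gcongr

lemma gamma_half_lower (n : ℕ) :
    ((n : ℝ) / 2) ^ ((n : ℝ) / 2) * Real.exp (-((n : ℝ) / 2)) ≤ Real.Gamma (1 + (n : ℝ) / 2) := by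
  induction n using Nat.twoStepInduction with
  | zero => simp
  | one =>
    have e : Real.Gamma (1 + ((1 : ℕ) : ℝ) / 2) = 1 / 2 * √π := by
      rw [add_comm, Nat.cast_one, Real.Gamma_add_one (by norm_num), Real.Gamma_one_half_eq]
    rw [e, Nat.cast_one, ← Real.sqrt_eq_rpow]
    have h1 : √(1 / 2 : ℝ) ≤ 3 / 4 := by
      rw [Real.sqrt_le_left (by norm_num)]; norm_num
    have h2 : (3 / 2 : ℝ) ≤ √π := by
      apply Real.le_sqrt_of_sq_le; linarith [Real.pi_gt_three]
    have h3 : Real.exp (-(1 / 2 : ℝ)) ≤ 1 := Real.exp_le_one_iff.2 (by norm_num)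
    calc _ ≤ (3 / 4 : ℝ) * 1 := by gcongr
      _ ≤ _ := by linarith
  | more n h _ =>
    have := gamma_step _ (by positivity) h
    have e : ((n + 2 : ℕ) : ℝ) / 2 = (n : ℝ) / 2 + 1 := by push_cast; ring
    rw [e]; exact this

lemma factorial_lower (n : ℕ) : (n : ℝ) ^ (n : ℝ) * Real.exp (-(n : ℝ)) ≤ (n.factorial : ℝ) := by
  have := gamma_half_lower (2 * n)
  have e : ((2 * n : ℕ) : ℝ) / 2 = n := by push_cast; ring
  rw [e, add_comm, Real.Gamma_nat_eq_factorial] at this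
  exact this

lemma term_bound (d j : ℕ) (hj : 1 ≤ j) :
    (d.choose j : ℝ) * (Real.pi ^ ((j : ℝ) / 2) / Real.Gamma (1 + (j : ℝ) / 2)) ≤
      ((d : ℝ) * Real.sqrt (2 * Real.exp 1 ^ 3 * Real.pi)) ^ j / (j : ℝ) ^ (3 * (j : ℝ) / 2) := by
  have hj0 : (0 : ℝ) < j := by exact_mod_cast hj
  have hc : (d.choose j : ℝ) ≤ (d : ℝ) ^ j / (j.factorial : ℝ) := Nat.choose_le_pow_div j d
  have hG := gamma_half_lower j
  have hF := factorial_lower j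
  have key : ((d : ℝ) * Real.sqrt (2 * Real.exp 1 ^ 3 * Real.pi)) ^ j / (j : ℝ) ^ (3 * (j : ℝ) / 2)
      = ((d : ℝ) ^ j / ((j : ℝ) ^ (j : ℝ) * Real.exp (-(j : ℝ)))) * (Real.pi ^ ((j : ℝ) / 2) /
        (((j : ℝ) / 2) ^ ((j : ℝ) / 2) * Real.exp (-((j : ℝ) / 2)))) := by
    have s : Real.sqrt (2 * Real.exp 1 ^ 3 * Real.pi) ^ j
        = 2 ^ ((j : ℝ) / 2) * (Real.exp j * Real.exp ((j : ℝ) / 2)) * Real.pi ^ ((j : ℝ) / 2) := by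
      rw [Real.sqrt_eq_rpow, ← Real.rpow_natCast, ← Real.rpow_mul (by positivity),
        Real.mul_rpow (by positivity) (by positivity), Real.mul_rpow (by positivity) (by positivity),
        ← Real.exp_nat_mul, ← Real.exp_mul, ← Real.exp_add]
      have q : (1 / 2 * (j : ℝ)) = (j : ℝ) / 2 := by ring
      rw [q]
      congr 3
      push_cast; ring
    have t : (j : ℝ) ^ (3 * (j : ℝ) / 2) = (j : ℝ) ^ (j : ℝ) * (j : ℝ) ^ ((j : ℝ) / 2) := by
      rw [← Real.rpow_add hj0]; congr 1; ring
    rw [mul_pow, s, t, Real.div_rpow hj0.le (by norm_num), Real.exp_neg, Real.exp_neg]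
    have := (Real.exp_pos (j : ℝ)).ne'
    have := (Real.exp_pos ((j : ℝ) / 2)).ne'
    have := (Real.rpow_pos_of_pos hj0 (j : ℝ)).ne'
    have := (Real.rpow_pos_of_pos hj0 ((j : ℝ) / 2)).ne'
    generalize (j : ℝ) ^ (j : ℝ) = a at *
    generalize (j : ℝ) ^ ((j : ℝ) / 2) = b at *
    generalize Real.exp (j : ℝ) = u at *
    generalize Real.exp ((j : ℝ) / 2) = v at *
    have := (Real.rpow_pos_of_pos (two_pos : (0 : ℝ) < 2) ((j : ℝ) / 2)).ne'
    generalize (2 : ℝ) ^ ((j : ℝ) / 2) = w at *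
    generalize Real.pi ^ ((j : ℝ) / 2) = p at *
    field_simp
  rw [key]
  have : 0 < Real.Gamma (1 + (j : ℝ) / 2) := Real.Gamma_pos_of_pos (by positivity)
  apply mul_le_mul
  · exact hc.trans (by gcongr)
  · gcongr
  · positivity
  · positivity

/-- For every `d ≥ 1`:
`∑_{j=1}^d binom(d,j) · π^(j/2)/Γ(1+j/2) ≤ (e/√(2π)) · ∑_{j=1}^d (d·√(2e³π))^j / j^(3j/2)`. -/
theorem sum_choose_unitBallVolume_le (d : ℕ) (hd : 1 ≤ d) :
    ∑ j ∈ Finset.Icc 1 d,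
        (d.choose j : ℝ) * (Real.pi ^ ((j : ℝ) / 2) / Real.Gamma (1 + (j : ℝ) / 2))
      ≤ Real.exp 1 / Real.sqrt (2 * Real.pi)
          * ∑ j ∈ Finset.Icc 1 d,
              ((d : ℝ) * Real.sqrt (2 * Real.exp 1 ^ 3 * Real.pi)) ^ j
                / (j : ℝ) ^ (3 * (j : ℝ) / 2) := by
  have h1 : 1 ≤ Real.exp 1 / Real.sqrt (2 * Real.pi) := by
    rw [one_le_div (by positivity), Real.sqrt_le_left (by positivity)]
    nlinarith [Real.pi_lt_d2, Real.exp_one_gt_d9]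
  refine le_trans (Finset.sum_le_sum fun j hj => term_bound d j (Finset.mem_Icc.1 hj).1) ?_
  exact le_mul_of_one_le_left (Finset.sum_nonneg fun j _ => by positivity) h1
end

section
/- Let d ≥ 1 and let K ⊆ ℝ^d be a nonempty compact convex set with inradius r(K). Then the function v : (−r(K), ∞) → ℝ, v(ρ) = Vol(K_ρ), where K_ρ = {x ∈ ℝ^d : dist(x, K) < ρ} for ρ ≥ 0 and K_ρ = {x ∈ K : dist(x, ℝ^d \ K) ≥ −ρ} for ρ < 0, is differentiable on (−r(K), ∞) and its derivative v′ is monotone nondecreasing on (−r(K), ∞). -/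
open MeasureTheory Metric
open scoped ENNReal Pointwise

/-- The inradius `r(K) = sup{ρ ≥ 0 : x + ρB ⊆ K for some x}` of `K`, where `B` is the
open Euclidean unit ball. -/
noncomputable def inradius {d : ℕ} (K : Set (EuclideanSpace ℝ (Fin d))) : ℝ :=
  sSup {ρ : ℝ | 0 ≤ ρ ∧ ∃ x : EuclideanSpace ℝ (Fin d),
    x +ᵥ ρ • Metric.ball (0 : EuclideanSpace ℝ (Fin d)) 1 ⊆ K}

/-- The family of parallel sets: `K_ρ = K + ρB = {x : dist(x,K) < ρ}` for `ρ ≥ 0`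
(Minkowski sum with the open ball `ρB`, so `K_0 = K`) and
`K_ρ = {x ∈ K : dist(x, K^C) ≥ −ρ}` for `ρ < 0`. -/
noncomputable def parallelSet {d : ℕ} (K : Set (EuclideanSpace ℝ (Fin d))) (ρ : ℝ) :
    Set (EuclideanSpace ℝ (Fin d)) :=
  if 0 ≤ ρ then K + ρ • Metric.ball (0 : EuclideanSpace ℝ (Fin d)) 1
  else {x | x ∈ K ∧ -ρ ≤ Metric.infDist x Kᶜ}


/-- Polar formula for the volume of a convex body around the origin. -/
lemma pv_polar {d : ℕ} (hd : 1 ≤ d) {A : Set (EuclideanSpace ℝ (Fin d))} (hc : Convex ℝ A)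
    (hcpt : IsCompact A) (h0 : A ∈ nhds 0) :
    Continuous (fun θ : sphere (0 : EuclideanSpace ℝ (Fin d)) 1 => ((gauge A θ)⁻¹) ^ d) ∧
    (volume A).toReal * d =
      ∫ θ, ((gauge A θ)⁻¹) ^ d ∂((volume : Measure (EuclideanSpace ℝ (Fin d))).toSphere) := by
  have hpos : ∀ θ : sphere (0 : EuclideanSpace ℝ (Fin d)) 1, 0 < gauge A θ := by
    intro θ
    rw [gauge_pos (absorbent_nhds_zero h0) (NormedSpace.isVonNBounded_of_isBounded _ hcpt.isBounded)]
    exact ne_zero_of_mem_unit_sphere θ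
  have hcont : Continuous (fun θ : sphere (0 : EuclideanSpace ℝ (Fin d)) 1 =>
      ((gauge A θ)⁻¹) ^ d) := by
    apply Continuous.pow
    apply Continuous.inv₀
    · exact (continuous_gauge hc h0).comp continuous_subtype_val
    · intro θ; exact (hpos θ).ne'
  refine ⟨hcont, ?_⟩
  have hdim : Module.finrank ℝ (EuclideanSpace ℝ (Fin d)) = d := by simp
  have : Nontrivial (EuclideanSpace ℝ (Fin d)) :=
    Module.nontrivial_of_finrank_pos (R := ℝ) (by rw [hdim]; omega)
  have h1 : volume A = volume (interior A) := by
    apply le_antisymm _ (measure_mono interior_subset)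
    calc volume A ≤ volume (interior A ∪ frontier A) := by
          apply measure_mono
          rw [← closure_eq_interior_union_frontier]; exact subset_closure
      _ ≤ volume (interior A) + volume (frontier A) := measure_union_le _ _
      _ = volume (interior A) := by rw [hc.addHaar_frontier volume, add_zero]
  set μ : Measure (EuclideanSpace ℝ (Fin d)) := volume with hμ
  have hmp := μ.measurePreserving_homeomorphUnitSphereProd
  have h2 : μ (interior A) = μ.comap ((↑) : ({0}ᶜ : Set (EuclideanSpace ℝ (Fin d))) → _)
      ((↑) ⁻¹' (interior A)) := by
    rw [comap_subtype_coe_apply (measurableSet_singleton _).compl, Subtype.image_preimage_coe,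
      Set.inter_comm, ← Set.sdiff_eq, measure_sdiff_null (measure_singleton _)]
  set T : Set (sphere (0 : EuclideanSpace ℝ (Fin d)) 1 × Set.Ioi (0:ℝ)) :=
    {p | p.2.1 < (gauge A p.1)⁻¹} with hT
  have hgc : Continuous (fun θ : sphere (0 : EuclideanSpace ℝ (Fin d)) 1 => (gauge A θ)⁻¹) := by
    apply Continuous.inv₀
    · exact (continuous_gauge hc h0).comp continuous_subtype_val
    · intro θ; exact (hpos θ).ne'
  have hTm : MeasurableSet T := by
    apply measurableSet_lt
    · exact measurable_subtype_coe.comp measurable_snd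
    · exact hgc.measurable.comp measurable_fst
  have h3 : ((↑) ⁻¹' (interior A) : Set ({0}ᶜ : Set (EuclideanSpace ℝ (Fin d)))) =
      homeomorphUnitSphereProd (EuclideanSpace ℝ (Fin d)) ⁻¹' T := by
    ext x
    simp only [Set.mem_preimage, hT, Set.mem_ofPred_eq, homeomorphUnitSphereProd_apply_snd_coe,
      homeomorphUnitSphereProd_apply_fst_coe]
    rw [← gauge_lt_one_iff_mem_interior hc h0]
    have hx : (0:ℝ) < ‖(x:EuclideanSpace ℝ (Fin d))‖ := norm_pos_iff.2 x.2
    rw [gauge_smul_of_nonneg (by positivity), smul_eq_mul, mul_inv, inv_inv]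
    have hg : 0 < gauge A x := by
      rw [gauge_pos (absorbent_nhds_zero h0)
        (NormedSpace.isVonNBounded_of_isBounded _ hcpt.isBounded)]
      exact x.2
    rw [lt_mul_iff_one_lt_right hx, one_lt_inv₀ hg]
  have h4 : μ A = ∫⁻ θ, ENNReal.ofReal (((gauge A θ)⁻¹) ^ d / d) ∂μ.toSphere := by
    rw [h1, h2, h3, hmp.measure_preimage hTm.nullMeasurableSet, Measure.prod_apply hTm]
    apply lintegral_congr
    intro θ
    have : (Prod.mk θ ⁻¹' T) = Set.Iio (⟨(gauge A θ)⁻¹, inv_pos.2 (hpos θ)⟩ : Set.Ioi (0:ℝ)) := by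
      ext r; simp [hT, ← Subtype.coe_lt_coe]
    rw [this, Measure.volumeIoiPow_apply_Iio, hdim, Nat.sub_add_cancel hd]
    congr 2
    rw [Nat.cast_sub hd]; simp
  have hd0 : (0:ℝ) < d := by exact_mod_cast hd
  rw [h4, ← integral_eq_lintegral_of_nonneg_ae, integral_div, div_mul_cancel₀ _ hd0.ne']
  · exact Filter.Eventually.of_forall fun θ => by have := hpos θ; positivity
  · exact (hcont.div_const _).aestronglyMeasurable

/-- One-dimensional inequality along a ray. -/
lemma pv_ray (d : ℕ) {p q m l : ℝ} (hp : 0 < p) (hq : 0 < q) (hqp : q ≤ p) (hm : (p + q) / 2 ≤ m)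
    (hl1 : l ≤ 1) (hlq : (1 - l) * p ≤ q) :
    p ^ d + q ^ d ≤ 2 * m ^ d + (d * l) ^ 2 * p ^ d := by
  have hPQ : q ^ d ≤ p ^ d := by gcongr
  have hP : 0 < p ^ d := by positivity
  have hQ : 0 < q ^ d := by positivity
  have hmm : 0 < m := by linarith
  have hN : 0 < m ^ d := by positivity
  have h1 : p ^ d * q ^ d ≤ (m ^ d) ^ 2 := by
    rw [← mul_pow, ← pow_mul, mul_comm d 2, pow_mul]
    gcongr
    nlinarith [sq_nonneg (p - q)]
  have h2 : (1 - d * l) * p ^ d ≤ q ^ d := by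
    calc (1 - d * l) * p ^ d ≤ (1 - l) ^ d * p ^ d := by
          gcongr
          have := one_add_mul_le_pow (a := -l) (by linarith) d
          calc (1 - d * l : ℝ) = 1 + d * -l := by ring
            _ ≤ _ := this
            _ = _ := by ring
      _ = ((1 - l) * p) ^ d := by rw [mul_pow]
      _ ≤ q ^ d := by
        apply pow_le_pow_left₀ _ hlq
        apply mul_nonneg <;> linarith
  generalize p ^ d = P at *
  generalize q ^ d = Q at *
  generalize m ^ d = N at *
  have h3 : (P - Q) ^ 2 ≤ ((d * l) * P) ^ 2 := by
    apply pow_le_pow_left₀ (by linarith); nlinarith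
  have h4 : P * (P + Q - 2 * N) ≤ (P - Q) ^ 2 := by
    by_cases h : P + Q - 2 * N ≤ 0
    · nlinarith [sq_nonneg (P - Q)]
    · push Not at h
      nlinarith [mul_pos h h]
  have h5 : P * (P + Q - 2 * N) ≤ P * ((d * l) ^ 2 * P) := by nlinarith
  have := le_of_mul_le_mul_left h5 hP
  linarith

lemma pv_second_diff {d : ℕ} (hd : 1 ≤ d) {A B M : Set (EuclideanSpace ℝ (Fin d))}
    (hAc : Convex ℝ A) (hA : IsCompact A) (hA0 : A ∈ nhds 0)
    (hBc : Convex ℝ B) (hB : IsCompact B) (hB0 : B ∈ nhds 0)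
    (hMc : Convex ℝ M) (hM : IsCompact M) (hM0 : M ∈ nhds 0) (hBA : B ⊆ A)
    (hABM : ∀ a ∈ A, ∀ b ∈ B, (1 / 2 : ℝ) • (a + b) ∈ M)
    {l : ℝ} (hl1 : l < 1) (hlB : ∀ a ∈ A, (1 - l) • a ∈ B) :
    (volume A).toReal + (volume B).toReal ≤
      2 * (volume M).toReal + (d * l) ^ 2 * (volume A).toReal := by
  obtain ⟨cA, eA⟩ := pv_polar hd hAc hA hA0
  obtain ⟨cB, eB⟩ := pv_polar hd hBc hB hB0
  obtain ⟨cM, eM⟩ := pv_polar hd hMc hM hM0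
  have hintg : ∀ f : sphere (0 : EuclideanSpace ℝ (Fin d)) 1 → ℝ, Continuous f →
      Integrable f ((volume : Measure (EuclideanSpace ℝ (Fin d))).toSphere) := fun f hf =>
    hf.integrable_of_hasCompactSupport (HasCompactSupport.of_compactSpace f)
  have hd0 : (0:ℝ) < d := by exact_mod_cast hd
  refine le_of_mul_le_mul_right ?_ hd0
  have key : ∀ S : Set (EuclideanSpace ℝ (Fin d)), Convex ℝ S → IsCompact S → S ∈ nhds 0 →
      ∀ θ : sphere (0 : EuclideanSpace ℝ (Fin d)) 1, 0 < gauge S θ ∧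
        ((gauge S θ)⁻¹ • (θ : EuclideanSpace ℝ (Fin d)) ∈ S) ∧
        ∀ r : ℝ, 0 < r → r • (θ : EuclideanSpace ℝ (Fin d)) ∈ S → r ≤ (gauge S θ)⁻¹ := by
    intro S hS hSc hS0 θ
    have hp : 0 < gauge S θ := by
      rw [gauge_pos (absorbent_nhds_zero hS0)
        (NormedSpace.isVonNBounded_of_isBounded _ hSc.isBounded)]
      exact ne_zero_of_mem_unit_sphere θ
    refine ⟨hp, ?_, ?_⟩
    · suffices (gauge S θ)⁻¹ • (θ : EuclideanSpace ℝ (Fin d)) ∈ closure S by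
        rwa [hSc.isClosed.closure_eq] at this
      rw [← gauge_le_one_iff_mem_closure hS hS0,
        gauge_smul_of_nonneg (by positivity), smul_eq_mul, inv_mul_cancel₀ hp.ne']
    · intro r hr hrS
      have := gauge_le_one_of_mem hrS
      rw [gauge_smul_of_nonneg hr.le, smul_eq_mul] at this
      rwa [le_inv_comm₀ hr hp, ← one_div, le_div_iff₀ hr, mul_comm]
  calc ((volume A).toReal + (volume B).toReal) * d
      = (volume A).toReal * d + (volume B).toReal * d := by ring
    _ = ∫ θ, (((gauge A θ)⁻¹) ^ d + ((gauge B θ)⁻¹) ^ d)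
          ∂((volume : Measure (EuclideanSpace ℝ (Fin d))).toSphere) := by
        rw [eA, eB, integral_add (hintg _ cA) (hintg _ cB)]
    _ ≤ ∫ θ, (2 * ((gauge M θ)⁻¹) ^ d + (d * l) ^ 2 * ((gauge A θ)⁻¹) ^ d)
          ∂((volume : Measure (EuclideanSpace ℝ (Fin d))).toSphere) := by
        apply integral_mono
        · exact hintg _ (cA.add cB)
        · exact hintg _ ((cM.const_mul _).add (cA.const_mul _))
        intro θ
        obtain ⟨a1, a2, a3⟩ := key A hAc hA hA0 θ
        obtain ⟨b1, b2, b3⟩ := key B hBc hB hB0 θ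
        obtain ⟨m1, m2, m3⟩ := key M hMc hM hM0 θ
        have a1' := inv_pos.2 a1
        have b1' := inv_pos.2 b1
        refine pv_ray d a1' b1' (a3 _ b1' (hBA b2)) ?_ hl1.le ?_
        · apply m3 _ (by linarith)
          have := hABM _ a2 _ b2
          rwa [← add_smul, smul_smul, one_div, inv_mul_eq_div] at this
        · apply b3 _ (mul_pos (by linarith) a1')
          have := hlB _ a2
          rwa [smul_smul] at this
    _ = 2 * ((volume M).toReal * d) + (d * l) ^ 2 * ((volume A).toReal * d) := by
        rw [integral_add (hintg _ (cM.const_mul _)) (hintg _ (cA.const_mul _)),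
          integral_const_mul, integral_const_mul, eA, eM]
    _ = _ := by ring
section
open Filter Topology

lemma pv_midpoint_convex {α : ℝ} {v : ℝ → ℝ} (hcont : ContinuousOn v (Set.Ioi α))
    (hmid : ∀ a h, 0 < h → α < a - h → 2 * v a ≤ v (a + h) + v (a - h)) :
    ConvexOn ℝ (Set.Ioi α) v := by
  refine LinearOrder.convexOn_of_lt (convex_Ioi α) ?_
  intro x hx y hy hxy p q hp hq hpq
  simp only [smul_eq_mul]
  by_contra hcon
  push Not at hcon
  -- subtract the chord
  set s : ℝ := (v y - v x) / (y - x) with hs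
  have hyx : 0 < y - x := by linarith
  have hsm : s * (y - x) = v y - v x := by rw [hs]; field_simp
  let g : ℝ → ℝ := fun z => v z - v x - s * (z - x)
  have hgx : g x = 0 := by simp [g]
  have hgy : g y = 0 := by simp only [g]; linarith
  have hIcc : Set.Icc x y ⊆ Set.Ioi α := fun z hz => lt_of_lt_of_le hx hz.1
  have hg : ContinuousOn g (Set.Icc x y) := by
    have := hcont.mono hIcc
    fun_prop
  obtain ⟨c0, hc0, hmax⟩ := isCompact_Icc.exists_isMaxOn (Set.nonempty_Icc.2 hxy.le) hg
  have hz : 0 < g (p * x + q * y) := by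
    have h1 : s * (p * x + q * y - x) = q * (v y - v x) := by
      rw [← hsm]; have : p = 1 - q := by linarith
      subst this; ring
    simp only [g, h1]
    have : p = 1 - q := by linarith
    subst this; linarith
  have hzI : p * x + q * y ∈ Set.Icc x y := by
    have : p = 1 - q := by linarith
    subst this
    constructor <;> nlinarith
  have hpos : 0 < g c0 := lt_of_lt_of_le hz (hmax hzI)
  -- the set of maximizers
  have hcl : IsClosed (Set.Icc x y ∩ g ⁻¹' {g c0}) :=
    hg.preimage_isClosed_of_isClosed isClosed_Icc isClosed_singleton
  have hcp : IsCompact (Set.Icc x y ∩ g ⁻¹' {g c0}) :=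
    isCompact_Icc.of_isClosed_subset hcl Set.inter_subset_left
  obtain ⟨c, ⟨hc, hcm⟩, hleast⟩ := hcp.exists_isLeast ⟨c0, hc0, rfl⟩
  have hgc : g c = g c0 := hcm
  have hxc : x < c := lt_of_le_of_ne hc.1 (fun h => by rw [← h] at hgc; linarith)
  have hcy : c < y := lt_of_le_of_ne hc.2 (fun h => by rw [h] at hgc; linarith)
  set h := min (c - x) (y - c) with hh
  have hh0 : 0 < h := lt_min (by linarith) (by linarith)
  have hl : h ≤ c - x := min_le_left _ _
  have hr : h ≤ y - c := min_le_right _ _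
  have hx' : α < x := hx
  have m1 := hmid c h hh0 (by linarith)
  have i1 : c - h ∈ Set.Icc x y := ⟨by linarith, by linarith⟩
  have i2 : c + h ∈ Set.Icc x y := ⟨by linarith, by linarith⟩
  have g1 : g (c - h) < g c0 := by
    refine lt_of_le_of_ne (hmax i1) (fun e => ?_)
    have := hleast ⟨i1, e⟩
    linarith
  have g2 : g (c + h) ≤ g c0 := hmax i2
  simp only [g] at g1 g2 hgc
  nlinarith

lemma pv_calculus {α : ℝ} {v : ℝ → ℝ} (hcont : ContinuousOn v (Set.Ioi α))
    (hmid : ∀ a h, 0 < h → α < a - h → 2 * v a ≤ v (a + h) + v (a - h))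
    (hsec : ∀ a, α < a → ∃ C δ : ℝ, 0 < δ ∧ ∀ h, 0 < h → h < δ →
      v (a + h) + v (a - h) ≤ 2 * v a + C * h ^ 2) :
    ∃ v' : ℝ → ℝ, (∀ ρ ∈ Set.Ioi α, HasDerivAt v (v' ρ) ρ) ∧ MonotoneOn v' (Set.Ioi α) := by
  have hconv := pv_midpoint_convex hcont hmid
  have hder : ∀ ρ ∈ Set.Ioi α, DifferentiableAt ℝ v ρ := by
    intro a ha
    have hi : a ∈ interior (Set.Ioi α) := by rwa [interior_Ioi]
    have hR := hconv.hasDerivWithinAt_rightDeriv_of_mem_interior hi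
    have hL := hconv.hasDerivWithinAt_leftDeriv_of_mem_interior hi
    have hLR := hconv.leftDeriv_le_rightDeriv_of_mem_interior hi
    set R := derivWithin v (Set.Ioi a) a
    set L := derivWithin v (Set.Iio a) a
    obtain ⟨C, δ, hδ, hC⟩ := hsec a ha
    have hRL : R ≤ L := by
      have t1 : Tendsto (fun h : ℝ => a + h) (𝓝[>] 0) (𝓝[>] a) := by
        apply tendsto_nhdsWithin_of_tendsto_nhds_of_eventually_within
        · have : Tendsto (fun h : ℝ => a + h) (𝓝 0) (𝓝 (a + 0)) := by
            apply Continuous.tendsto; fun_prop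
          rw [add_zero] at this
          exact this.mono_left nhdsWithin_le_nhds
        · filter_upwards [self_mem_nhdsWithin] with h hh
          have : (0:ℝ) < h := hh
          simpa using this
      have t2 : Tendsto (fun h : ℝ => a - h) (𝓝[>] 0) (𝓝[<] a) := by
        apply tendsto_nhdsWithin_of_tendsto_nhds_of_eventually_within
        · have : Tendsto (fun h : ℝ => a - h) (𝓝 0) (𝓝 (a - 0)) := by
            apply Continuous.tendsto; fun_prop
          rw [sub_zero] at this
          exact this.mono_left nhdsWithin_le_nhds
        · filter_upwards [self_mem_nhdsWithin] with h hh
          have : (0:ℝ) < h := hh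
          simpa using this
      have s1 := (hasDerivWithinAt_iff_tendsto_slope' (by simp)).1 hR
      have s2 := (hasDerivWithinAt_iff_tendsto_slope' (by simp)).1 hL
      have u1 := s1.comp t1
      have u2 := s2.comp t2
      have u3 : Tendsto (fun h : ℝ => C * h) (𝓝[>] 0) (𝓝 0) := by
        have : Tendsto (fun h : ℝ => C * h) (𝓝 0) (𝓝 (C * 0)) := by
          apply Continuous.tendsto; fun_prop
        rw [mul_zero] at this
        exact this.mono_left nhdsWithin_le_nhds
      have u4 := u2.add u3
      rw [add_zero] at u4
      refine le_of_tendsto_of_tendsto u1 u4 ?_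
      filter_upwards [Ioo_mem_nhdsGT hδ] with h hh
      have := hC h hh.1 hh.2
      have h0 := hh.1
      simp only [Function.comp, slope_def_field]
      rw [show a + h - a = h by ring, show a - h - a = -h by ring, div_neg, ← neg_div]
      rw [div_add' _ _ _ h0.ne', div_le_div_iff_of_pos_right h0]
      nlinarith
    have hEq : L = R := le_antisymm hLR hRL
    rw [hEq] at hL
    have := (hasDerivWithinAt_Iio_iff_Iic.1 hL).union (hasDerivWithinAt_Ioi_iff_Ici.1 hR)
    rw [Set.Iic_union_Ici] at this
    exact (hasDerivWithinAt_univ.1 this).differentiableAt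
  exact ⟨deriv v, fun ρ hρ => (hder ρ hρ).hasDerivAt, hconv.monotoneOn_deriv hder⟩
end

/-- The convex set cut out by the half-spaces `⟪u, x⟫ ≤ h u + t`. -/
def pvC {d : ℕ} (h : EuclideanSpace ℝ (Fin d) → ℝ) (t : ℝ) : Set (EuclideanSpace ℝ (Fin d)) :=
  {x | ∀ u : EuclideanSpace ℝ (Fin d), ‖u‖ = 1 → inner ℝ u x ≤ h u + t}

section
variable {d : ℕ} {h : EuclideanSpace ℝ (Fin d) → ℝ}

lemma pvC_closed (t : ℝ) : IsClosed (pvC h t) := by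
  have : pvC h t = ⋂ u : EuclideanSpace ℝ (Fin d), ⋂ _ : ‖u‖ = 1,
      {x | inner ℝ u x ≤ h u + t} := by
    ext x; simp [pvC]
  rw [this]
  refine isClosed_iInter fun u => isClosed_iInter fun _ => ?_
  exact isClosed_le (by fun_prop) (by fun_prop)

lemma pvC_comb {s t p q : ℝ} (hp : 0 ≤ p) (hq : 0 ≤ q) (hpq : p + q = 1)
    {x y : EuclideanSpace ℝ (Fin d)} (hx : x ∈ pvC h s) (hy : y ∈ pvC h t) :
    p • x + q • y ∈ pvC h (p * s + q * t) := by
  intro u hu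
  have h1 := mul_le_mul_of_nonneg_left (hx u hu) hp
  have h2 := mul_le_mul_of_nonneg_left (hy u hu) hq
  rw [inner_add_right, inner_smul_right, inner_smul_right]
  have : p = 1 - q := by linarith
  subst this
  linarith

lemma pvC_convex (t : ℝ) : Convex ℝ (pvC h t) := by
  intro x hx y hy p q hp hq hpq
  have := pvC_comb hp hq hpq hx hy
  rwa [← add_mul, hpq, one_mul] at this

lemma pvC_mono {s t : ℝ} (hst : s ≤ t) : pvC h s ⊆ pvC h t := fun _ hx u hu =>
  (hx u hu).trans (by linarith)

lemma pvC_add {s t : ℝ} {x w : EuclideanSpace ℝ (Fin d)} (hx : x ∈ pvC h s) (hw : ‖w‖ ≤ t) :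
    x + w ∈ pvC h (s + t) := by
  intro u hu
  have h1 := hx u hu
  have h2 := real_inner_le_norm u w
  rw [hu, one_mul] at h2
  rw [inner_add_right]
  linarith

lemma pvC_compact {R : ℝ} (hR : ∀ u : EuclideanSpace ℝ (Fin d), ‖u‖ = 1 → h u ≤ R) (t : ℝ) :
    IsCompact (pvC h t) := by
  apply Metric.isCompact_of_isClosed_isBounded (pvC_closed t)
  apply (Metric.isBounded_closedBall (x := (0 : EuclideanSpace ℝ (Fin d))) (r := |R + t|)).subset
  intro x hx
  rw [mem_closedBall_zero_iff]
  by_cases h0 : x = 0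
  · simp [h0]
  have hn : 0 < ‖x‖ := norm_pos_iff.2 h0
  have hu : ‖(‖x‖⁻¹ • x)‖ = 1 := by rw [norm_smul, norm_inv, norm_norm, inv_mul_cancel₀ hn.ne']
  have h1 := hx _ hu
  have h2 := hR _ hu
  rw [real_inner_smul_left, real_inner_self_eq_norm_sq] at h1
  have h3 : ‖x‖⁻¹ * ‖x‖ ^ 2 = ‖x‖ := by field_simp
  rw [h3] at h1
  exact (by linarith : ‖x‖ ≤ R + t).trans (le_abs_self _)

lemma pv_lipschitz_volume {f : EuclideanSpace ℝ (Fin d) → EuclideanSpace ℝ (Fin d)}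
    (hf : LipschitzWith 1 f) (s : Set (EuclideanSpace ℝ (Fin d))) :
    volume (f '' s) ≤ volume s := by
  have h1 := Measure.isAddLeftInvariant_eq_smul (volume : Measure (EuclideanSpace ℝ (Fin d)))
    (Measure.hausdorffMeasure (d : ℝ))
  have h2 := hf.hausdorffMeasure_image_le (d := (d : ℝ)) (by positivity) s
  rw [h1, Measure.smul_apply, Measure.smul_apply]
  simp only [ENNReal.coe_one, ENNReal.one_rpow, one_mul] at h2
  gcongr

/-- The reflection in the metric projection onto a closed convex set. -/
lemma pv_reflection {L : Set (EuclideanSpace ℝ (Fin d))} (hL : Convex ℝ L) (hLc : IsClosed L)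
    (hne : L.Nonempty) :
    ∃ f : EuclideanSpace ℝ (Fin d) → EuclideanSpace ℝ (Fin d), LipschitzWith 1 f ∧
      ∀ y p, p ∈ L → (∀ z ∈ L, inner ℝ (y - p) (z - p) ≤ 0) → f y = p + (p - y) := by
  have hex : ∀ y, ∃ p ∈ L, ∀ z ∈ L, inner ℝ (y - p) (z - p) ≤ 0 := by
    intro y
    obtain ⟨p, hp, he⟩ := exists_norm_eq_iInf_of_complete_convex hne hLc.isComplete hL y
    exact ⟨p, hp, (norm_eq_iInf_iff_real_inner_le_zero hL hp).1 he⟩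
  choose P hPL hP using hex
  have firm : ∀ y1 y2 p1 p2 : EuclideanSpace ℝ (Fin d), p1 ∈ L → p2 ∈ L →
      (∀ z ∈ L, inner ℝ (y1 - p1) (z - p1) ≤ 0) → (∀ z ∈ L, inner ℝ (y2 - p2) (z - p2) ≤ 0) →
      ‖p1 - p2‖ ^ 2 ≤ inner ℝ (p1 - p2) (y1 - y2) := by
    intro y1 y2 p1 p2 h1 h2 k1 k2
    have a1 := k1 p2 h2
    have a2 := k2 p1 h1
    rw [← real_inner_self_eq_norm_sq]
    simp only [inner_sub_left, inner_sub_right] at *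
    rw [real_inner_comm p1 y1, real_inner_comm p2 y1, real_inner_comm p1 y2,
      real_inner_comm p2 y2] at *
    linarith
  refine ⟨fun y => P y + (P y - y), ?_, ?_⟩
  · apply LipschitzWith.of_dist_le_mul
    intro y1 y2
    have hfm := firm y1 y2 _ _ (hPL y1) (hPL y2) (hP y1) (hP y2)
    rw [dist_eq_norm, dist_eq_norm, NNReal.coe_one, one_mul]
    have e : P y1 + (P y1 - y1) - (P y2 + (P y2 - y2)) = (2:ℝ) • (P y1 - P y2) - (y1 - y2) := by
      rw [two_smul]; abel
    rw [e]
    rw [← pow_le_pow_iff_left₀ (norm_nonneg _) (norm_nonneg _) two_ne_zero]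
    rw [norm_sub_sq_real, norm_smul, real_inner_smul_left, Real.norm_two]
    nlinarith
  · intro y p hp hpz
    have hfm := firm y y _ _ (hPL y) hp (hP y) hpz
    rw [sub_self, inner_zero_right] at hfm
    have : P y = p := by
      rw [← sub_eq_zero, ← norm_eq_zero]
      nlinarith [norm_nonneg (P y - p)]
    simp only [this]

lemma pvC_shell_subset {a e : ℝ}
    {x : EuclideanSpace ℝ (Fin d)} (hx : x ∈ interior (pvC h a)) (hxe : x ∉ pvC h (a - e)) :
    ∃ y ∈ pvC h (a + e) \ pvC h a, ∃ p ∈ pvC h a,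
      (∀ z ∈ pvC h a, inner ℝ (y - p) (z - p) ≤ 0) ∧ x = p + (p - y) := by
  set L := pvC h a with hLdef
  have hLc : IsClosed L := pvC_closed a
  have hxL : x ∈ L := interior_subset hx
  simp only [pvC, Set.mem_ofPred_eq, not_forall, not_le] at hxe
  obtain ⟨u, hu, hux⟩ := hxe
  -- a point outside `L` at distance less than `e`
  set g : ℝ := h u + a - inner ℝ u x with hg
  have hg0 : 0 ≤ g := by have := hxL u hu; linarith
  have hge : g < e := by linarith
  obtain ⟨s, hs1, hs2⟩ := exists_between hge
  have hout : x + s • u ∈ Lᶜ := by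
    intro hmem
    have := hmem u hu
    rw [inner_add_right, inner_smul_right, real_inner_self_eq_norm_sq, hu] at this
    linarith
  have hdist : infDist x Lᶜ ≤ s := by
    refine (infDist_le_dist_of_mem hout).trans ?_
    rw [dist_self_add_right, norm_smul, hu, mul_one, Real.norm_of_nonneg (by linarith)]
  have hne : (Lᶜ).Nonempty := ⟨_, hout⟩
  set t := infDist x Lᶜ with ht
  have hxcl : x ∉ closure Lᶜ := by rw [closure_compl]; simpa using hx
  have ht0 : 0 < t := by
    rw [ht, ← infDist_closure]
    exact (isClosed_closure.notMem_iff_infDist_pos hne.closure).1 hxcl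
  obtain ⟨p, hp, hpd⟩ := isClosed_closure.exists_infDist_eq_dist hne.closure x
  rw [infDist_closure, ← ht] at hpd
  have hball : closedBall x t ⊆ L := by
    rw [← closure_ball x ht0.ne']
    apply closure_minimal _ hLc
    intro z hz
    by_contra hzL
    have := infDist_le_dist_of_mem (x := x) (s := Lᶜ) hzL
    rw [mem_ball, dist_comm] at hz
    linarith
  have hpL : p ∈ L := hball (by rw [mem_closedBall, dist_comm]; exact hpd.ge)
  have hpint : p ∉ interior L := by rw [closure_compl] at hp; exact hp
  -- supporting hyperplane
  obtain ⟨φ, hφ⟩ := geometric_hahn_banach_open_point (pvC_convex a).interior isOpen_interior hpint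
  obtain ⟨w, rfl⟩ : ∃ w, innerSL ℝ w = φ :=
    ⟨(InnerProductSpace.toDual ℝ _).symm φ, by ext z; simp⟩
  simp only [innerSL_apply_apply] at hφ
  have hsupp : ∀ z ∈ L, inner ℝ w z ≤ inner ℝ w p := by
    have hcl : closure (interior L) = closure L :=
      (pvC_convex a).closure_interior_eq_closure_of_nonempty_interior ⟨x, hx⟩
    intro z hz
    have hz' : z ∈ closure (interior L) := by rw [hcl]; exact subset_closure hz
    refine le_on_closure (f := fun z => inner ℝ w z) (g := fun _ => inner ℝ w p)
      (fun z hz => (hφ z hz).le) (by fun_prop) (by fun_prop) hz'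
  have hw0 : w ≠ 0 := by
    rintro rfl
    have := hφ x hx
    simp at this
  have hwn : 0 < ‖w‖ := norm_pos_iff.2 hw0
  have hnpx : ‖p - x‖ = t := by rw [hpd, dist_comm, dist_eq_norm]
  have h1 : t * ‖w‖ ≤ inner ℝ w (p - x) := by
    have := hsupp (x + (t * ‖w‖⁻¹) • w) (hball (by
      rw [mem_closedBall, dist_comm, dist_self_add_right, norm_smul, Real.norm_of_nonneg (by positivity),
        mul_assoc, inv_mul_cancel₀ hwn.ne', mul_one]))
    rw [inner_add_right, inner_smul_right, real_inner_self_eq_norm_sq] at this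
    rw [inner_sub_right]
    have e1 : t * ‖w‖⁻¹ * ‖w‖ ^ 2 = t * ‖w‖ := by field_simp
    linarith
  have hpx : p - x = (t / ‖w‖) • w := by
    have h2 : inner ℝ w (p - x) = ‖w‖ * ‖p - x‖ := by
      apply le_antisymm (real_inner_le_norm _ _)
      rw [hnpx]; linarith
    rw [inner_eq_norm_mul_iff_real, hnpx] at h2
    rw [div_eq_inv_mul, mul_smul, h2, smul_smul, inv_mul_cancel₀ hwn.ne', one_smul]
  refine ⟨p + (p - x), ⟨?_, ?_⟩, p, hpL, ?_, by abel⟩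
  · exact pvC_add hpL (by linarith)
  · intro hmem
    have := hsupp _ hmem
    rw [inner_add_right] at this
    have : 0 < t * ‖w‖ := by positivity
    linarith
  · intro z hz
    rw [add_sub_cancel_left, hpx, real_inner_smul_left, inner_sub_right]
    have := hsupp z hz
    apply mul_nonpos_of_nonneg_of_nonpos (by positivity) (by linarith)

lemma pvC_shell {R : ℝ}
    (hR : ∀ u : EuclideanSpace ℝ (Fin d), ‖u‖ = 1 → h u ≤ R) {a e : ℝ} (he : 0 < e) :
    2 * (volume (pvC h a)).toReal ≤
      (volume (pvC h (a + e))).toReal + (volume (pvC h (a - e))).toReal := by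
  have hfin : ∀ t, volume (pvC h t) ≠ ⊤ := fun t => (pvC_compact hR t).measure_lt_top.ne
  have hsh : volume (pvC h a \ pvC h (a - e)) ≤ volume (pvC h (a + e) \ pvC h a) := by
    rcases (pvC h a).eq_empty_or_nonempty with hem | hne
    · simp [hem]
    obtain ⟨f, hf, hfy⟩ := pv_reflection (pvC_convex (h := h) a) (pvC_closed a) hne
    calc volume (pvC h a \ pvC h (a - e))
        ≤ volume ((interior (pvC h a) \ pvC h (a - e)) ∪ frontier (pvC h a)) := by
          apply measure_mono
          rintro x ⟨hx1, hx2⟩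
          by_cases hxi : x ∈ interior (pvC h a)
          · exact Or.inl ⟨hxi, hx2⟩
          · exact Or.inr ⟨subset_closure hx1, hxi⟩
      _ ≤ volume (interior (pvC h a) \ pvC h (a - e)) + volume (frontier (pvC h a)) :=
          measure_union_le _ _
      _ = volume (interior (pvC h a) \ pvC h (a - e)) := by
          rw [(pvC_convex a).addHaar_frontier volume, add_zero]
      _ ≤ volume (f '' (pvC h (a + e) \ pvC h a)) := by
          apply measure_mono
          rintro x ⟨hx1, hx2⟩
          obtain ⟨y, hy, p, hp, hpz, hxe⟩ := pvC_shell_subset hx1 hx2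
          exact ⟨y, hy, by rw [hfy y p hp hpz, hxe]⟩
      _ ≤ _ := pv_lipschitz_volume hf _
  have d1 := measureReal_sdiff (μ := volume) (pvC_mono (h := h) (by linarith : a - e ≤ a))
    (pvC_closed (a - e)).measurableSet (hfin _)
  have d2 := measureReal_sdiff (μ := volume) (pvC_mono (h := h) (by linarith : a ≤ a + e))
    (pvC_closed a).measurableSet (hfin _)
  have hsh' := ENNReal.toReal_mono
    ((measure_mono Set.sdiff_subset).trans_lt (hfin (a + e)).lt_top).ne hsh
  simp only [measureReal_def] at d1 d2
  linarith

lemma pvC_scale {ρ a e : ℝ} (h0 : (0 : EuclideanSpace ℝ (Fin d)) ∈ pvC h (-ρ)) (he : 0 < e)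
    (hae : -ρ < a - e) {x : EuclideanSpace ℝ (Fin d)} (hx : x ∈ pvC h (a + e)) :
    (1 - 2 * e / (a + e + ρ)) • x ∈ pvC h (a - e) := by
  have hpos : 0 < a + e + ρ := by linarith
  have hl1 : 2 * e / (a + e + ρ) ≤ 1 := by rw [div_le_one hpos]; linarith
  have := pvC_comb (p := 1 - 2 * e / (a + e + ρ)) (q := 2 * e / (a + e + ρ))
    (by linarith) (by positivity) (by ring) hx h0
  rw [smul_zero, add_zero] at this
  have e1 : (1 - 2 * e / (a + e + ρ)) * (a + e) + 2 * e / (a + e + ρ) * -ρ = a - e := by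
    field_simp
    ring
  rwa [e1] at this

lemma pvC_nhds {ρ a : ℝ} (h0 : (0 : EuclideanSpace ℝ (Fin d)) ∈ pvC h (-ρ)) (ha : -ρ < a) :
    pvC h a ∈ nhds (0 : EuclideanSpace ℝ (Fin d)) := by
  refine Filter.mem_of_superset (closedBall_mem_nhds 0 (show 0 < a + ρ by linarith)) ?_
  intro w hw
  have := pvC_add h0 (mem_closedBall_zero_iff.1 hw)
  rwa [zero_add, neg_add_cancel_comm_assoc] at this

/-- Second difference bound and Lipschitz-type bound, centered at the origin. -/
lemma pvC_bounds_zero (hd : 1 ≤ d) {R : ℝ}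
    (hR : ∀ u : EuclideanSpace ℝ (Fin d), ‖u‖ = 1 → h u ≤ R) {ρ a e : ℝ}
    (h0 : (0 : EuclideanSpace ℝ (Fin d)) ∈ pvC h (-ρ)) (he : 0 < e) (hae : -ρ < a - e) :
    (volume (pvC h (a + e))).toReal + (volume (pvC h (a - e))).toReal ≤
      2 * (volume (pvC h a)).toReal +
        (d * (2 * e / (a + e + ρ))) ^ 2 * (volume (pvC h (a + e))).toReal ∧
    (1 - d * (2 * e / (a + e + ρ))) * (volume (pvC h (a + e))).toReal ≤
      (volume (pvC h (a - e))).toReal := by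
  have hpos : 0 < a + e + ρ := by linarith
  have hl1 : 2 * e / (a + e + ρ) < 1 := by rw [div_lt_one hpos]; linarith
  constructor
  · refine pv_second_diff hd (pvC_convex _) (pvC_compact hR _) (pvC_nhds h0 (by linarith))
      (pvC_convex _) (pvC_compact hR _) (pvC_nhds h0 (by linarith))
      (pvC_convex _) (pvC_compact hR _) (pvC_nhds h0 (by linarith))
      (pvC_mono (by linarith)) ?_ hl1 (fun x hx => pvC_scale h0 he hae hx)
    intro x hx y hy
    have := pvC_comb (p := 1 / 2) (q := 1 / 2) (by norm_num) (by norm_num) (by norm_num) hx hy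
    rw [smul_add]
    have e1 : 1 / 2 * (a + e) + 1 / 2 * (a - e) = a := by ring
    rwa [e1] at this
  · have hsub : (1 - 2 * e / (a + e + ρ)) • pvC h (a + e) ⊆ pvC h (a - e) := by
      rintro _ ⟨x, hx, rfl⟩
      exact pvC_scale h0 he hae hx
    have h1 := measure_mono (μ := volume) hsub
    rw [Measure.addHaar_smul_of_nonneg _ (by linarith)] at h1
    have h2 := ENNReal.toReal_mono (pvC_compact hR _).measure_lt_top.ne h1
    rw [ENNReal.toReal_mul, ENNReal.toReal_ofReal (by apply pow_nonneg; linarith),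
      finrank_euclideanSpace_fin] at h2
    refine le_trans ?_ h2
    gcongr
    have := one_add_mul_le_pow (a := -(2 * e / (a + e + ρ))) (by linarith) d
    calc (1 - d * (2 * e / (a + e + ρ)) : ℝ) = 1 + d * -(2 * e / (a + e + ρ)) := by ring
      _ ≤ _ := this
      _ = _ := by ring

lemma pvC_translate (x0 : EuclideanSpace ℝ (Fin d)) (t : ℝ) :
    pvC (fun u => h u - inner ℝ u x0) t = (fun x => x0 + x) ⁻¹' (pvC h t) := by
  ext x
  simp only [pvC, Set.mem_preimage, Set.mem_ofPred_eq, inner_add_right]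
  refine forall_congr' fun u => forall_congr' fun _ => ?_
  constructor <;> intro H <;> linarith

lemma pvC_bounds (hd : 1 ≤ d) {R : ℝ}
    (hR : ∀ u : EuclideanSpace ℝ (Fin d), ‖u‖ = 1 → h u ≤ R) {ρ a e : ℝ}
    {x0 : EuclideanSpace ℝ (Fin d)}
    (h0 : x0 ∈ pvC h (-ρ)) (he : 0 < e) (hae : -ρ < a - e) :
    (volume (pvC h (a + e))).toReal + (volume (pvC h (a - e))).toReal ≤
      2 * (volume (pvC h a)).toReal +
        (d * (2 * e / (a + e + ρ))) ^ 2 * (volume (pvC h (a + e))).toReal ∧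
    (1 - d * (2 * e / (a + e + ρ))) * (volume (pvC h (a + e))).toReal ≤
      (volume (pvC h (a - e))).toReal := by
  have hvol : ∀ t, volume (pvC (fun u => h u - inner ℝ u x0) t) = volume (pvC h t) := by
    intro t
    rw [pvC_translate, measure_preimage_add]
  have := pvC_bounds_zero (h := fun u => h u - inner ℝ u x0) hd (R := R + ‖x0‖) (ρ := ρ) (a := a)
    (e := e) ?_ ?_ he hae
  · simpa only [hvol] using this
  · intro u hu
    have h1 := hR u hu
    have h2 := abs_real_inner_le_norm u x0
    rw [hu, one_mul] at h2
    have := neg_abs_le (inner ℝ u x0)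
    linarith
  · rw [pvC_translate]; simpa using h0

/-- Main statement for the half-space family. -/
lemma pvC_main (hd : 1 ≤ d) {R : ℝ}
    (hR : ∀ u : EuclideanSpace ℝ (Fin d), ‖u‖ = 1 → h u ≤ R) {α : ℝ}
    (hin : ∀ a, α < a → ∃ b, b < a ∧ (pvC h b).Nonempty) :
    ∃ v' : ℝ → ℝ, (∀ ρ ∈ Set.Ioi α,
        HasDerivAt (fun t => (volume (pvC h t)).toReal) (v' ρ) ρ) ∧
      MonotoneOn v' (Set.Ioi α) := by
  have hmono : Monotone (fun t => (volume (pvC h t)).toReal) := fun s t hst =>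
    ENNReal.toReal_mono (pvC_compact hR t).measure_lt_top.ne (measure_mono (pvC_mono hst))
  apply pv_calculus
  · intro a ha
    apply ContinuousAt.continuousWithinAt
    obtain ⟨b, hb, x0, hx0⟩ := hin a ha
    have hab : 0 < a - b := by linarith
    -- Lipschitz type estimate
    have hlip : ∀ e, 0 < e → e < min (a - b) 1 →
        (volume (pvC h (a + e))).toReal - (volume (pvC h (a - e))).toReal ≤
          (d * (2 / (a - b)) * (volume (pvC h (a + 1))).toReal) * e := by
      intro e he he1
      have e1 := he1.trans_le (min_le_left _ _)
      have e2 := he1.trans_le (min_le_right _ _)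
      have h1 := (pvC_bounds hd hR (ρ := -b) (a := a) (e := e) (by simpa using hx0) he
        (by linarith)).2
      have h2 : 2 * e / (a + e + -b) ≤ 2 * e / (a - b) := by gcongr; linarith
      have h3 : (volume (pvC h (a + e))).toReal ≤ (volume (pvC h (a + 1))).toReal :=
        hmono (by linarith)
      have h4 : d * (2 * e / (a + e + -b)) * (volume (pvC h (a + e))).toReal ≤
          d * (2 * e / (a - b)) * (volume (pvC h (a + 1))).toReal := by gcongr
      have h5 : d * (2 * e / (a - b)) * (volume (pvC h (a + 1))).toReal =
        (d * (2 / (a - b)) * (volume (pvC h (a + 1))).toReal) * e := by ring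
      linarith
    set C := d * (2 / (a - b)) * (volume (pvC h (a + 1))).toReal with hC
    have hC0 : 0 ≤ C := by positivity
    rw [Metric.continuousAt_iff]
    intro ε hε
    set e := min (min ((a - b) / 2) (1 / 2)) (ε / (2 * (C + 1))) with hedef
    have he0 : 0 < e := by positivity
    have m1 : e ≤ (a - b) / 2 := (min_le_left _ _).trans (min_le_left _ _)
    have m2 : e ≤ 1 / 2 := (min_le_left _ _).trans (min_le_right _ _)
    have m3 : e ≤ ε / (2 * (C + 1)) := min_le_right _ _
    have hl := hlip e he0 (lt_min (by linarith) (by linarith))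
    have hCe : C * e < ε := by
      rw [le_div_iff₀ (by positivity)] at m3
      nlinarith
    refine ⟨e, he0, fun {x} hx => ?_⟩
    rw [Real.dist_eq, abs_lt] at hx
    rw [Real.dist_eq, abs_lt]
    have k1 := hmono (show x ≤ a + e by linarith)
    have k2 := hmono (show a - e ≤ x by linarith)
    have k3 := hmono (show a ≤ a + e by linarith)
    have k4 := hmono (show a - e ≤ a by linarith)
    simp only at k1 k2 k3 k4
    constructor <;> linarith
  · intro a e he _
    exact pvC_shell hR he
  · intro a ha
    obtain ⟨b, hb, x0, hx0⟩ := hin a ha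
    have hab : 0 < a - b := by linarith
    refine ⟨(d * (2 / (a - b))) ^ 2 * (volume (pvC h (a + 1))).toReal, min (a - b) 1,
      by positivity, fun e he he1 => ?_⟩
    have e1 := he1.trans_le (min_le_left _ _)
    have e2 := he1.trans_le (min_le_right _ _)
    have h1 := (pvC_bounds hd hR (ρ := -b) (a := a) (e := e) (by simpa using hx0) he
      (by linarith)).1
    have h2 : 2 * e / (a + e + -b) ≤ 2 * e / (a - b) := by gcongr; linarith
    have h2' : 0 ≤ 2 * e / (a + e + -b) := by apply div_nonneg <;> linarith
    have h3 : (volume (pvC h (a + e))).toReal ≤ (volume (pvC h (a + 1))).toReal :=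
      hmono (by linarith)
    have h4 : (d * (2 * e / (a + e + -b))) ^ 2 * (volume (pvC h (a + e))).toReal ≤
        (d * (2 * e / (a - b))) ^ 2 * (volume (pvC h (a + 1))).toReal := by gcongr
    have h5 : (d * (2 * e / (a - b))) ^ 2 * (volume (pvC h (a + 1))).toReal =
      ((d * (2 / (a - b))) ^ 2 * (volume (pvC h (a + 1))).toReal) * e ^ 2 := by ring
    linarith

end

/-- The support function of `K`. -/
noncomputable def pvSupp {d : ℕ} (K : Set (EuclideanSpace ℝ (Fin d)))
    (u : EuclideanSpace ℝ (Fin d)) : ℝ := sSup ((fun x => inner ℝ u x) '' K)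

section
variable {d : ℕ} {K : Set (EuclideanSpace ℝ (Fin d))}

lemma pvSupp_ge (hcpt : IsCompact K) (u : EuclideanSpace ℝ (Fin d))
    {x : EuclideanSpace ℝ (Fin d)} (hx : x ∈ K) : inner ℝ u x ≤ pvSupp K u := by
  have hb : BddAbove ((fun x => inner ℝ u x) '' K) :=
    (hcpt.image (f := fun x => inner ℝ u x) (by fun_prop)).bddAbove
  exact le_csSup hb ⟨x, hx, rfl⟩

lemma pvSupp_le (hne : K.Nonempty) {u : EuclideanSpace ℝ (Fin d)} {c : ℝ}
    (hc : ∀ x ∈ K, inner ℝ u x ≤ c) : pvSupp K u ≤ c := by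
  apply csSup_le (hne.image _)
  rintro _ ⟨x, hx, rfl⟩
  exact hc x hx

lemma pvC_supp_subset_cthickening (hne : K.Nonempty) (hcpt : IsCompact K) (hconv : Convex ℝ K)
    {t : ℝ} (ht : 0 ≤ t) : pvC (pvSupp K) t ⊆ cthickening t K := by
  intro x hx
  obtain ⟨p, hp, he⟩ := exists_norm_eq_iInf_of_complete_convex hne hcpt.isClosed.isComplete hconv x
  have hP := (norm_eq_iInf_iff_real_inner_le_zero hconv hp).1 he
  refine mem_cthickening_of_dist_le x p t K hp ?_
  rw [dist_eq_norm]
  by_cases h0 : x - p = 0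
  · rw [h0, norm_zero]; exact ht
  have hn : 0 < ‖x - p‖ := norm_pos_iff.2 h0
  have hu : ‖(‖x - p‖⁻¹ • (x - p))‖ = 1 := by
    rw [norm_smul, norm_inv, norm_norm, inv_mul_cancel₀ hn.ne']
  have h1 := hx _ hu
  have h2 : pvSupp K (‖x - p‖⁻¹ • (x - p)) ≤ inner ℝ (‖x - p‖⁻¹ • (x - p)) p := by
    apply pvSupp_le hne
    intro z hz
    have h3 := hP z hz
    rw [real_inner_smul_left, real_inner_smul_left]
    rw [inner_sub_right] at h3
    gcongr
    linarith
  have h4 : inner ℝ (‖x - p‖⁻¹ • (x - p)) x - inner ℝ (‖x - p‖⁻¹ • (x - p)) p = ‖x - p‖ := by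
    rw [← inner_sub_right, real_inner_smul_left, real_inner_self_eq_norm_sq]
    field_simp
  linarith

lemma pvC_supp_zero (hne : K.Nonempty) (hcpt : IsCompact K) (hconv : Convex ℝ K) :
    pvC (pvSupp K) 0 = K := by
  apply Set.Subset.antisymm
  · have := pvC_supp_subset_cthickening hne hcpt hconv le_rfl
    rwa [cthickening_zero, hcpt.isClosed.closure_eq] at this
  · intro x hx u hu
    rw [add_zero]; exact pvSupp_ge hcpt u hx

lemma pv_volume_eq (hd : 1 ≤ d) (hne : K.Nonempty) (hcpt : IsCompact K) (hconv : Convex ℝ K)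
    (t : ℝ) : volume (parallelSet K t) = volume (pvC (pvSupp K) t) := by
  have hK0 := pvC_supp_zero hne hcpt hconv
  unfold parallelSet
  split_ifs with ht
  · rcases ht.eq_or_lt with rfl | ht0
    · rw [Set.zero_smul_set (nonempty_ball.2 one_pos), add_zero, hK0]
    · rw [smul_unitBall ht0.ne', Real.norm_of_nonneg ht, add_ball_zero]
      have hcv : Convex ℝ (thickening t K) := hconv.thickening t
      apply le_antisymm
      · apply measure_mono
        intro x hx
        obtain ⟨z, hz, hxz⟩ := mem_thickening_iff.1 hx
        rw [← hK0] at hz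
        rw [dist_eq_norm] at hxz
        have := pvC_add hz hxz.le
        rwa [zero_add, add_sub_cancel] at this
      · have hsub := pvC_supp_subset_cthickening hne hcpt hconv ht
        calc volume (pvC (pvSupp K) t) ≤ volume (thickening t K ∪ frontier (thickening t K)) := by
              apply measure_mono
              refine hsub.trans ?_
              rw [← closure_thickening ht0, closure_eq_self_union_frontier]
          _ ≤ volume (thickening t K) + volume (frontier (thickening t K)) := measure_union_le _ _
          _ = volume (thickening t K) := by rw [hcv.addHaar_frontier volume, add_zero]
  · push Not at ht
    congr 1
    ext x
    constructor
    · rintro ⟨hxK, hx⟩ u hu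
      refine le_of_forall_pos_lt_add fun ε hε => ?_
      -- a point slightly inside
      have key : ∀ s, 0 ≤ s → s < -t → inner ℝ u x + s ≤ pvSupp K u := by
        intro s hs hst
        have hmem : x + s • u ∈ K := by
          by_contra hout
          have h1 := infDist_le_dist_of_mem (x := x) (s := Kᶜ) hout
          rw [dist_self_add_right, norm_smul, hu, mul_one, Real.norm_of_nonneg hs] at h1
          linarith
        have := pvSupp_ge hcpt u hmem
        rwa [inner_add_right, inner_smul_right, real_inner_self_eq_norm_sq, hu, one_pow,
          mul_one] at this
      have h2 := key (max 0 (-t - ε / 2)) (le_max_left _ _) (max_lt (by linarith) (by linarith))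
      have h3 := le_max_right 0 (-t - ε / 2)
      linarith
    · intro hx
      have hxK : x ∈ K := by rw [← hK0]; exact pvC_mono ht.le hx
      refine ⟨hxK, ?_⟩
      have : Nontrivial (EuclideanSpace ℝ (Fin d)) :=
        Module.nontrivial_of_finrank_pos (R := ℝ) (by rw [finrank_euclideanSpace_fin]; omega)
      have hcn : (Kᶜ).Nonempty := by
        rw [Set.nonempty_compl]
        rintro rfl
        exact NormedSpace.unbounded_univ ℝ (EuclideanSpace ℝ (Fin d)) hcpt.isBounded
      rw [le_infDist hcn]
      intro z hz
      have hz' : z ∉ pvC (pvSupp K) 0 := by rw [hK0]; exact hz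
      simp only [pvC, Set.mem_ofPred_eq, not_forall, not_le] at hz'
      obtain ⟨u, hu, huz⟩ := hz'
      have h1 := hx u hu
      have h2 := real_inner_le_norm u (z - x)
      rw [hu, one_mul, inner_sub_right] at h2
      rw [dist_comm, dist_eq_norm]
      linarith
end

/-- For a nonempty compact convex `K ⊆ ℝ^d`, the function
`v(ρ) = Vol(K_ρ)` is differentiable on `(−r(K), ∞)` and its derivative is monotone
nondecreasing there. -/
theorem parallelVolume_differentiable_and_deriv_monotone (d : ℕ) (hd : 1 ≤ d)
    (K : Set (EuclideanSpace ℝ (Fin d))) (hne : K.Nonempty) (hcpt : IsCompact K)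
    (hconv : Convex ℝ K) :
    ∃ v' : ℝ → ℝ,
      (∀ ρ ∈ Set.Ioi (-(inradius K)),
        HasDerivAt (fun t => (volume (parallelSet K t)).toReal) (v' ρ) ρ) ∧
      MonotoneOn v' (Set.Ioi (-(inradius K))) := by
  have hfun : (fun t => (volume (parallelSet K t)).toReal) =
      fun t => (volume (pvC (pvSupp K) t)).toReal := by
    funext t; rw [pv_volume_eq hd hne hcpt hconv]
  rw [hfun]
  obtain ⟨R, hRpos⟩ := hcpt.isBounded.exists_norm_le
  refine pvC_main hd (R := R) ?_ ?_
  · intro u hu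
    apply pvSupp_le hne
    intro x hx
    have := real_inner_le_norm u x
    rw [hu, one_mul] at this
    exact this.trans (hRpos x hx)
  · intro a ha
    have hna : -a < inradius K := by linarith
    obtain ⟨k, hk⟩ := hne
    have hS : ({ρ : ℝ | 0 ≤ ρ ∧ ∃ x : EuclideanSpace ℝ (Fin d),
        x +ᵥ ρ • Metric.ball (0 : EuclideanSpace ℝ (Fin d)) 1 ⊆ K}).Nonempty := by
      refine ⟨0, le_rfl, k, ?_⟩
      rw [Set.zero_smul_set (nonempty_ball.2 one_pos)]
      rintro _ ⟨z, hz, rfl⟩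
      have hz0 : z = 0 := hz
      rw [hz0]
      simpa using hk
    obtain ⟨ρ, ⟨hρ0, x, hx⟩, hρ⟩ := exists_lt_of_lt_csSup hS hna
    refine ⟨-ρ, by linarith, x, ?_⟩
    intro u hu
    refine le_of_forall_pos_lt_add fun ε hε => ?_
    -- points of the open ball, approaching its boundary in direction `u`
    have key : ∀ s : ℝ, 0 ≤ s → s < 1 → inner ℝ u x + ρ * s ≤ pvSupp K u := by
      intro s hs hs1
      have hmem : x + ρ • (s • u) ∈ K := by
        apply hx
        refine ⟨ρ • (s • u), ⟨s • u, ?_, rfl⟩, rfl⟩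
        rw [mem_ball_zero_iff, norm_smul, hu, mul_one, Real.norm_of_nonneg hs]
        exact hs1
      have := pvSupp_ge hcpt u hmem
      rwa [inner_add_right, inner_smul_right, inner_smul_right, real_inner_self_eq_norm_sq, hu,
        one_pow, mul_one] at this
    have hq : 0 < ρ + ε := by linarith
    have h2 := key (ρ / (ρ + ε)) (by positivity) (by rw [div_lt_one hq]; linarith)
    have h3 : ρ - ε < ρ * (ρ / (ρ + ε)) := by
      rw [← mul_div_assoc, lt_div_iff₀ hq]
      nlinarith
    linarith
end
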